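/- arXiv:1002.2314 — 12 statements merged into one kernel-verified Lean document; each statement's English description precedes it below -/
import Mathlib

section
/- Let n ≥ 2 be a natural number, p = n(n+1), let L_n be the Legendre polynomial given by the Rodrigues formula, and let z ∈ (−1,1) satisfy L_n(z) = 0 and L_n(x) > 0 for all x ∈ (z, 1]. Define β(x) = [(1+x)^p·L_n'(x) − p·(1+x)^{p−1}·L_n(x)] / [(1−x)^p·L_n'(x) + p·(1−x)^{p−1}·L_n(x)]. Then the denominator (1−x)^p·L_n'(x) + p·(1−x)^{p−1}·L_n(x) is strictly positive for every x ∈ [z, 1), and β is strictly monotone increasing on [z, 1). -/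
/-- The Legendre polynomial via the Rodrigues formula:
`L_n(x) = (1/(2^n n!)) (d/dx)^n (x²−1)^n`. -/
noncomputable def legendre (n : ℕ) (x : ℝ) : ℝ :=
  (1 / (2 ^ n * (Nat.factorial n : ℝ))) * iteratedDeriv n (fun t : ℝ => (t ^ 2 - 1) ^ n) x

open Polynomial in
theorem aux_rec (n k : ℕ) :
    ((X:ℝ[X])^2-1) * derivative^[k+2] ((X^2-1)^n) =
      C (2*(n:ℝ)-2*(k+1)) * X * derivative^[k+1] ((X^2-1)^n)
      + C (((k:ℝ)+1)*(2*n-k)) * derivative^[k] ((X^2-1)^n) := by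
  have c2 : (C 2 : ℝ[X]) = 2 := map_ofNat C 2
  have key : ((X:ℝ[X])^2-1) * derivative ((X^2-1)^n) = C (2*(n:ℝ)) * X * (X^2-1)^n := by
    rcases n with _ | n
    · simp
    · rw [derivative_pow_succ]
      simp [c2]
      ring
  induction k with
  | zero =>
    have h := congrArg derivative key
    simp only [derivative_mul, derivative_sub, derivative_X_pow, derivative_one, derivative_C,
      derivative_X] at h
    simp only [Function.iterate_succ_apply', Function.iterate_zero, id]
    simp [c2] at h ⊢
    linear_combination h
  | succ k ih =>
    have h := congrArg derivative ih
    simp only [derivative_mul, derivative_add, derivative_sub, derivative_X_pow, derivative_one,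
      derivative_C, derivative_X, ← Function.iterate_succ_apply' (f := derivative)] at h
    simp [c2] at h ⊢
    linear_combination h

open Polynomial in
theorem aux_leg (n : ℕ) : ∃ P : ℝ[X], (legendre n = fun x => P.eval x) ∧
    (X^2-1) * derivative (derivative P) = -2 * X * derivative P + C ((n:ℝ)*(n+1)) * P := by
  refine ⟨C (1 / (2 ^ n * (Nat.factorial n : ℝ))) * derivative^[n] ((X^2-1)^n), ?_, ?_⟩
  · funext x
    have h : ∀ k, iteratedDeriv k (fun t : ℝ => (t ^ 2 - 1) ^ n) =
        fun x => (derivative^[k] (((X:ℝ[X])^2-1)^n)).eval x := by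
      intro k
      induction k with
      | zero => funext x; simp
      | succ k ih =>
        rw [iteratedDeriv_succ, ih]
        funext x
        rw [Polynomial.deriv, Function.iterate_succ_apply']
    unfold legendre
    rw [h n]
    simp
  · have h := aux_rec n n
    simp only [Function.iterate_succ_apply'] at h
    simp only [derivative_C_mul]
    have c2 : (C 2 : ℝ[X]) = 2 := map_ofNat C 2
    simp [c2] at h ⊢
    linear_combination (C (Nat.factorial n : ℝ)⁻¹ * C (2 ^ n : ℝ)⁻¹) * h

/-- if `F(1)=0` and `F' < 0` on `(z,1)` then `F>0` on `[z,1)` -/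
theorem aux_pos (F F' : ℝ → ℝ) (z : ℝ) (hF : ∀ x, HasDerivAt F (F' x) x)
    (h1 : F 1 = 0) (hneg : ∀ x ∈ Set.Ioo z 1, F' x < 0) : ∀ x ∈ Set.Ico z 1, 0 < F x := by
  intro x hx
  have hanti : StrictAntiOn F (Set.Icc z 1) := by
    apply strictAntiOn_of_deriv_neg (convex_Icc z 1)
    · exact fun y _ => (hF y).continuousAt.continuousWithinAt
    · intro y hy
      rw [interior_Icc] at hy
      rw [(hF y).deriv]
      exact hneg y hy
  have := hanti (Set.Ico_subset_Icc_self hx) ⟨hx.1.trans hx.2.le, le_rfl⟩ hx.2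
  linarith

/-- For `p = n(n+1)`, `n ≥ 2`, and `z` the largest zero of `L_n`, the denominator
`(1−x)^p L_n'(x) + p (1−x)^{p−1} L_n(x)` is positive on `[z,1)` and the function
`β(x) = ((1+x)^p L_n'(x) − p (1+x)^{p−1} L_n(x)) / ((1−x)^p L_n'(x) + p (1−x)^{p−1} L_n(x))`
is strictly increasing on `[z,1)`. -/
theorem beta_strictMonoOn (n : ℕ) (hn : 2 ≤ n) (z : ℝ)
    (hz : z ∈ Set.Ioo (-1 : ℝ) 1) (hz0 : legendre n z = 0)
    (hpos : ∀ x ∈ Set.Ioc z (1 : ℝ), 0 < legendre n x) :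
    (∀ x ∈ Set.Ico z (1 : ℝ),
      0 < (1 - x) ^ (n * (n + 1)) * deriv (legendre n) x
            + (n * (n + 1) : ℝ) * (1 - x) ^ (n * (n + 1) - 1) * legendre n x) ∧
    StrictMonoOn (fun x : ℝ =>
      ((1 + x) ^ (n * (n + 1)) * deriv (legendre n) x
          - (n * (n + 1) : ℝ) * (1 + x) ^ (n * (n + 1) - 1) * legendre n x) /
      ((1 - x) ^ (n * (n + 1)) * deriv (legendre n) x
          + (n * (n + 1) : ℝ) * (1 - x) ^ (n * (n + 1) - 1) * legendre n x))
      (Set.Ico z 1) := by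
  obtain ⟨P, hP, hode⟩ := aux_leg n
  have hdL : deriv (legendre n) = fun x => (Polynomial.derivative P).eval x := by
    funext x
    rw [hP, Polynomial.deriv]
  rw [hdL]
  rw [hP] at hpos hz0 ⊢
  clear hdL hP
  simp only at hpos hz0 ⊢
  obtain ⟨p, hp⟩ : ∃ p : ℝ, p = (n:ℝ)*(n+1) := ⟨_, rfl⟩
  have hn2 : (2:ℝ) ≤ n := by exact_mod_cast hn
  have hp6 : 6 ≤ p := by rw [hp]; nlinarith
  obtain ⟨m, hm⟩ : ∃ m, n*(n+1) = m+2 := ⟨n*(n+1)-2, by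
    have : 2 ≤ n*(n+1) := by nlinarith
    omega⟩
  have hpm : p = m + 2 := by
    rw [hp]; exact_mod_cast hm
  rw [← hp] at hode ⊢
  rw [hm]
  have hm1 : m + 2 - 1 = m + 1 := rfl
  rw [hm1]
  have d0 : ∀ x, HasDerivAt (fun x => P.eval x) (P.derivative.eval x) x := fun x => P.hasDerivAt x
  have d1 : ∀ x, HasDerivAt (fun x => P.derivative.eval x) (P.derivative.derivative.eval x) x :=
    fun x => P.derivative.hasDerivAt x
  have d2 : ∀ x, HasDerivAt (fun x => P.derivative.derivative.eval x)
      (P.derivative.derivative.derivative.eval x) x :=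
    fun x => P.derivative.derivative.hasDerivAt x
  have e0 : ∀ x, (x^2-1) * P.derivative.derivative.eval x =
      -2*x*P.derivative.eval x + p * P.eval x := by
    intro x
    have := congrArg (Polynomial.eval x) hode
    simpa using this
  have e1 : ∀ x, (x^2-1) * P.derivative.derivative.derivative.eval x =
      -4*x*P.derivative.derivative.eval x + (p-2) * P.derivative.eval x := by
    intro x
    have := congrArg (fun Q => Polynomial.eval x (Polynomial.derivative Q)) hode
    simp at this
    linear_combination this
  generalize hL : (fun x => P.eval x) = L at *
  generalize hL1 : (fun x => P.derivative.eval x) = L1 at *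
  generalize hL2 : (fun x => P.derivative.derivative.eval x) = L2 at *
  generalize hL3 : (fun x => P.derivative.derivative.derivative.eval x) = L3 at *
  have q0 : ∀ x, P.eval x = L x := fun x => congrFun hL x
  have q1 : ∀ x, P.derivative.eval x = L1 x := fun x => congrFun hL1 x
  have q2 : ∀ x, P.derivative.derivative.eval x = L2 x := fun x => congrFun hL2 x
  have q3 : ∀ x, P.derivative.derivative.derivative.eval x = L3 x := fun x => congrFun hL3 x
  simp only [q0, q1, q2, q3] at *
  have hL1pos : ∀ x ∈ Set.Ico z 1, 0 < L1 x := by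
    intro x hx
    have hF := aux_pos (fun x => (1-x^2) * L1 x) (fun x => -p * L x) z (by
      intro x
      have := (((hasDerivAt_id x).pow 2).const_sub 1).mul (d1 x)
      refine (this.congr_deriv ?_)
      simp
      linear_combination -e0 x) (by simp) (by
      intro x hx
      have := hpos x ⟨hx.1, hx.2.le⟩
      nlinarith) x hx
    have : 0 < 1 - x^2 := by nlinarith [hx.1, hx.2, hz.1]
    exact (mul_pos_iff_of_pos_left this).1 hF
  have hL2pos : ∀ x ∈ Set.Ico z 1, 0 < L2 x := by
    intro x hx
    have hF := aux_pos (fun x => (1-x^2)^2 * L2 x) (fun x => -((p-2) * ((1-x^2) * L1 x))) z (by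
      intro x
      have := ((((hasDerivAt_id x).pow 2).const_sub 1).pow 2).mul (d2 x)
      refine (this.congr_deriv ?_)
      simp
      linear_combination -(1-x^2) * e1 x) (by simp) (by
      intro x hx
      have h1 := hL1pos x ⟨hx.1.le, hx.2⟩
      have h2 : 0 < 1 - x^2 := by nlinarith [hx.1, hx.2, hz.1]
      have h3 : 0 < p - 2 := by linarith
      have := mul_pos h3 (mul_pos h2 h1)
      linarith) x hx
    have : 0 < 1 - x^2 := by nlinarith [hx.1, hx.2, hz.1]
    exact (mul_pos_iff_of_pos_left (pow_pos this 2)).1 hF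
  have hL0 : ∀ x ∈ Set.Ico z 1, 0 ≤ L x := by
    intro x hx
    rcases eq_or_lt_of_le hx.1 with h | h
    · rw [← h, hz0]
    · exact (hpos x ⟨h, hx.2.le⟩).le
  have hD : ∀ x ∈ Set.Ico z 1, 0 < (1-x)^(m+2) * L1 x + p * (1-x)^(m+1) * L x := by
    intro x hx
    have h1 : 0 < 1 - x := by linarith [hx.2]
    have h2 := hL1pos x hx
    have h3 := hL0 x hx
    positivity
  refine ⟨hD, ?_⟩
  have dN : ∀ x, HasDerivAt (fun x => (1+x)^(m+2) * L1 x - p * (1+x)^(m+1) * L x)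
      ((1+x)^(m+2) * L2 x - p * (m+1) * (1+x)^m * L x) x := by
    intro x
    have := ((((hasDerivAt_id x).const_add 1).pow (m+2)).mul (d1 x)).sub
      (((((hasDerivAt_id x).const_add 1).pow (m+1)).const_mul p).mul (d0 x))
    refine this.congr_deriv ?_
    simp [hpm]
    ring
  have dD : ∀ x, HasDerivAt (fun x => (1-x)^(m+2) * L1 x + p * (1-x)^(m+1) * L x)
      ((1-x)^(m+2) * L2 x - p * (m+1) * (1-x)^m * L x) x := by
    intro x
    have := ((((hasDerivAt_id x).const_sub 1).pow (m+2)).mul (d1 x)).add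
      (((((hasDerivAt_id x).const_sub 1).pow (m+1)).const_mul p).mul (d0 x))
    refine this.congr_deriv ?_
    simp [hpm]
    ring
  apply strictMonoOn_of_deriv_pos (convex_Ico z 1)
  · intro x hx
    exact ((dN x).div (dD x) (hD x hx).ne').continuousAt.continuousWithinAt
  · intro x hx
    rw [interior_Ico] at hx
    have hx' : x ∈ Set.Ico z 1 := ⟨hx.1.le, hx.2⟩
    have := ((dN x).div (dD x) (hD x hx').ne').deriv
    refine lt_of_lt_of_eq ?_ this.symm
    refine div_pos ?_ (pow_pos (hD x hx') 2)
    have hp0 : 0 < p := by linarith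
    have h1 : 0 < 1 - x := by linarith [hx.2]
    have h2 : 0 < 1 + x := by linarith [hx.1, hz.1]
    have h3 := hL2pos x hx'
    have h4 := hpos x ⟨hx.1, hx.2.le⟩
    have hpos' : 0 < (1+x)^m * (1-x)^m * (2 * p^2 * L x * L2 x * ((1+x)*(1-x))) := by positivity
    refine lt_of_lt_of_eq hpos' ?_
    have hm' : (m:ℝ) = p - 2 := by linarith
    rw [hm']
    simp only [pow_succ (1+x), pow_succ (1-x)]
    linear_combination ((1+x)^m * (1-x)^m * (-2*p*(p-1)) * L x) * e0 x
end

section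
/- Let n ≥ 2 be a natural number, p = n(n+1), let L_n be the Legendre polynomial given by the Rodrigues formula, and let z ∈ (−1,1) satisfy L_n(z) = 0 and L_n(x) > 0 for all x ∈ (z, 1]. Define β(x) = [(1+x)^p·L_n'(x) − p·(1+x)^{p−1}·L_n(x)] / [(1−x)^p·L_n'(x) + p·(1−x)^{p−1}·L_n(x)] and a(x) = (p/2)·[((1+x)/2)^{p−1} + β(x)·((1−x)/2)^{p−1}] / L_n'(x). Then L_n'(x) > 0 for every x ∈ [z, 1), and a is strictly monotone decreasing on [z, 1). -/
/-- The function `β` from the touching-triple analysis. -/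
noncomputable def betaFn (n : ℕ) (x : ℝ) : ℝ :=
  ((1 + x) ^ (n * (n + 1)) * deriv (legendre n) x
      - (n * (n + 1) : ℝ) * (1 + x) ^ (n * (n + 1) - 1) * legendre n x) /
  ((1 - x) ^ (n * (n + 1)) * deriv (legendre n) x
      + (n * (n + 1) : ℝ) * (1 - x) ^ (n * (n + 1) - 1) * legendre n x)

open Polynomial in
lemma iterDeriv_poly (W : ℝ[X]) (k : ℕ) :
    iteratedDeriv k (fun t => W.eval t) = fun t => (derivative^[k] W).eval t := by
  induction k with
  | zero => simp
  | succ k ih =>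
    rw [iteratedDeriv_succ, ih, Function.iterate_succ_apply']
    funext t
    exact Polynomial.deriv _

open Polynomial in
lemma ode_aux (n : ℕ) (k : ℕ) :
    (X ^ 2 - 1) * derivative^[k+2] ((X ^ 2 - 1 : ℝ[X]) ^ n)
      + C (2 * (k + 1) - 2 * n : ℝ) * X * derivative^[k+1] ((X ^ 2 - 1 : ℝ[X]) ^ n)
      + C (k * (k + 1) - 2 * n * (k + 1) : ℝ) * derivative^[k] ((X ^ 2 - 1 : ℝ[X]) ^ n) = 0 := by
  induction k with
  | zero =>
    have h : (X ^ 2 - 1) * derivative ((X ^ 2 - 1 : ℝ[X]) ^ n)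
        = C (2 * n : ℝ) * X * (X ^ 2 - 1 : ℝ[X]) ^ n := by
      rcases n with _ | m
      · simp
      · rw [derivative_pow_succ]
        simp only [derivative_sub, derivative_X_pow, derivative_one, map_mul, map_add, map_one,
          map_natCast, Nat.cast_add, Nat.cast_one, pow_succ]
        simp [show (C (2:ℝ) : ℝ[X]) = 2 from rfl]
        ring
    have h2 := congrArg derivative h
    simp only [derivative_mul, derivative_sub, derivative_X_pow, derivative_one, derivative_C,
      derivative_X] at h2
    simp only [Function.iterate_succ_apply', Function.iterate_zero, id]
    simp only [map_mul, map_sub, map_add, map_natCast, Nat.cast_zero, Nat.cast_ofNat, map_one, map_zero, map_ofNat] at h2 ⊢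
    norm_num at h2 ⊢
    linear_combination h2
  | succ k ih =>
    have h2 := congrArg derivative ih
    simp only [derivative_mul, derivative_add, derivative_sub, derivative_X_pow, derivative_one,
      derivative_C, derivative_X, derivative_zero, ← Function.iterate_succ_apply'] at h2
    simp only [map_mul, map_sub, map_add, map_natCast, Nat.cast_zero, Nat.cast_ofNat, map_one,
      map_zero, map_ofNat, Nat.cast_add, Nat.cast_one] at h2 ⊢
    norm_num at h2 ⊢
    linear_combination h2

open Polynomial in
lemma legendre_poly (n : ℕ) : ∃ Q : ℝ[X], legendre n = (fun x => Q.eval x) ∧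
    ∀ x, (1 - x ^ 2) * (derivative (derivative Q)).eval x - 2 * x * (derivative Q).eval x
      + (n * (n + 1)) * Q.eval x = 0 := by
  refine ⟨C (1 / (2 ^ n * (Nat.factorial n : ℝ))) * derivative^[n] ((X ^ 2 - 1) ^ n), ?_, ?_⟩
  · funext x
    have := congrFun (iterDeriv_poly ((X ^ 2 - 1) ^ n) n) x
    simp only [eval_pow, eval_sub, eval_X, eval_one] at this
    simp only [legendre, this, eval_mul, eval_C]
  · intro x
    have h := congrArg (eval x) (ode_aux n n)
    simp only [Function.iterate_succ_apply', eval_add, eval_mul, eval_sub, eval_pow, eval_X,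
      eval_one, eval_C, eval_zero] at h
    simp only [derivative_C_mul, eval_mul, eval_C]
    linear_combination (-(1 / (2 ^ n * (Nat.factorial n : ℝ)))) * h

/-- a function with negative derivative vanishing at `1` is positive before -/
lemma pos_of_deriv_neg (f : ℝ → ℝ) (f' : ℝ → ℝ) (z : ℝ) (hf : ∀ x, HasDerivAt f (f' x) x)
    (h1 : f 1 = 0) (hneg : ∀ x ∈ Set.Ioo z 1, f' x < 0) : ∀ x ∈ Set.Ico z (1:ℝ), 0 < f x := by
  intro x hx
  have hA : StrictAntiOn f (Set.Icc z 1) := by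
    apply strictAntiOn_of_deriv_neg (convex_Icc _ _)
      (fun y _ => (hf y).continuousAt.continuousWithinAt)
    intro y hy
    rw [interior_Icc] at hy
    rw [(hf y).deriv]
    exact hneg y hy
  have := hA ⟨hx.1, hx.2.le⟩ ⟨hx.1.trans hx.2.le, le_refl _⟩ hx.2
  linarith

/-- For `p = n(n+1)`, `n ≥ 2`, and `z` the largest zero of `L_n`:
`L_n' > 0` on `[z,1)` and the function
`a(x) = (p/2) (((1+x)/2)^{p−1} + β(x) ((1−x)/2)^{p−1}) / L_n'(x)`
is strictly decreasing on `[z,1)`. -/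
theorem a_strictAntiOn (n : ℕ) (hn : 2 ≤ n) (z : ℝ)
    (hz : z ∈ Set.Ioo (-1 : ℝ) 1) (hz0 : legendre n z = 0)
    (hpos : ∀ x ∈ Set.Ioc z (1 : ℝ), 0 < legendre n x) :
    (∀ x ∈ Set.Ico z (1 : ℝ), 0 < deriv (legendre n) x) ∧
    StrictAntiOn (fun x : ℝ =>
      ((n * (n + 1) : ℝ) / 2) *
        (((1 + x) / 2) ^ (n * (n + 1) - 1)
          + betaFn n x * ((1 - x) / 2) ^ (n * (n + 1) - 1)) / deriv (legendre n) x)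
      (Set.Ico z 1) := by
  obtain ⟨Q, hQ, ode⟩ := legendre_poly n
  have hd : ∀ x, deriv (legendre n) x = (Polynomial.derivative Q).eval x := by
    intro x; rw [hQ]; exact Polynomial.deriv _
  have hL : ∀ x, legendre n x = Q.eval x := fun x => by rw [hQ]
  have hn' : (2:ℝ) ≤ n := by exact_mod_cast hn
  obtain ⟨q, hq⟩ : ∃ q, n * (n + 1) = q + 1 := ⟨n * (n+1) - 1, by
    have : 0 < n * (n+1) := by positivity
    omega⟩
  have hqr : (n * (n + 1) : ℝ) = q + 1 := by exact_mod_cast hq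
  have hp6 : (6:ℝ) ≤ q + 1 := by rw [← hqr]; nlinarith
  simp only [betaFn, hq, hqr, hd, Nat.add_sub_cancel, hL] at *
  clear hq hqr hQ hd hL
  set L1 := Polynomial.derivative Q with hL1
  set L2 := Polynomial.derivative L1 with hL2
  have d0 : ∀ x, HasDerivAt (fun x => Q.eval x) (L1.eval x) x := fun x => Q.hasDerivAt x
  have d1 : ∀ x, HasDerivAt (fun x => L1.eval x) (L2.eval x) x := fun x => L1.hasDerivAt x
  have d2 : ∀ x, HasDerivAt (fun x => L2.eval x) ((Polynomial.derivative L2).eval x) x :=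
    fun x => L2.hasDerivAt x
  have dw : ∀ x : ℝ, HasDerivAt (fun x : ℝ => 1 - x ^ 2) (-(2 * x)) x := fun x => by
    simpa using ((hasDerivAt_id x).pow 2).const_sub 1
  have ode3 : ∀ x, (1 - x ^ 2) * (Polynomial.derivative L2).eval x - 4 * x * L2.eval x
      + (q - 1) * L1.eval x = 0 := by
    intro x
    have h := (((dw x).mul (d2 x |> fun _ => d1 x |> fun _ => d2 x)).sub
      (((hasDerivAt_id x).const_mul 2).mul (d1 x))).add ((d0 x).const_mul ((q:ℝ) + 1))
    have h0 := h.unique ((hasDerivAt_const x (0:ℝ)).congr_of_eventuallyEq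
      (Filter.Eventually.of_forall fun y => by simpa using ode y))
    simp only [id] at h0
    linear_combination h0
  have P1 : ∀ x ∈ Set.Ico z (1:ℝ), 0 < (1 - x ^ 2) * L1.eval x := by
    refine pos_of_deriv_neg _ (fun x => -((q + 1) * Q.eval x)) z (fun x => ?_) (by norm_num) ?_
    · refine ((dw x).mul (d1 x)).congr_deriv ?_
      linear_combination ode x
    · intro x hx
      have := hpos x ⟨hx.1, hx.2.le⟩
      simp only [neg_lt_zero]; positivity
  have hw : ∀ x ∈ Set.Ico z (1:ℝ), 0 < 1 - x ^ 2 := fun x hx => by nlinarith [hx.1, hx.2, hz.1]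
  have Q1 : ∀ x ∈ Set.Ico z (1:ℝ), 0 < L1.eval x := fun x hx =>
    (pos_iff_pos_of_mul_pos (P1 x hx)).1 (hw x hx)
  have P2 : ∀ x ∈ Set.Ico z (1:ℝ), 0 < (1 - x ^ 2) ^ 2 * L2.eval x := by
    refine pos_of_deriv_neg _ (fun x => -((q - 1) * ((1 - x ^ 2) * L1.eval x))) z
      (fun x => ?_) (by norm_num) ?_
    · refine (((dw x).pow 2).mul (d2 x)).congr_deriv ?_
      simp
      linear_combination (1 - x ^ 2) * (ode3 x)
    · intro x hx
      have := P1 x ⟨hx.1.le, hx.2⟩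
      simp only [neg_lt_zero]
      exact mul_pos (by linarith) this
  have Q2 : ∀ x ∈ Set.Ico z (1:ℝ), 0 < L2.eval x := fun x hx =>
    (pos_iff_pos_of_mul_pos (P2 x hx)).1 (pow_pos (hw x hx) 2)
  have Q0 : ∀ x ∈ Set.Ico z (1:ℝ), 0 ≤ Q.eval x := by
    intro x hx
    rcases hx.1.eq_or_lt with h | h
    · rw [← h, hz0]
    · exact (hpos x ⟨h, hx.2.le⟩).le
  have QD : ∀ x ∈ Set.Ico z (1:ℝ), 0 < (1 - x) * L1.eval x + (q + 1) * Q.eval x := by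
    intro x hx
    have h1 := mul_pos (sub_pos.2 hx.2) (Q1 x hx)
    have h2 := Q0 x hx
    positivity
  refine ⟨Q1, ?_⟩
  have key : StrictAntiOn (fun x : ℝ => (q + 1 : ℝ) * ((1 + x) / 2) ^ q /
      ((1 - x) * L1.eval x + (q + 1) * Q.eval x)) (Set.Ico z 1) := by
    have dD : ∀ x, HasDerivAt (fun x : ℝ => (1 - x) * L1.eval x + (q + 1) * Q.eval x)
        (q * L1.eval x + (1 - x) * L2.eval x) x := by
      intro x
      refine ((((hasDerivAt_id x).const_sub 1).mul (d1 x)).add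
        ((d0 x).const_mul ((q:ℝ) + 1))).congr_deriv ?_
      simp; ring
    have dN : ∀ x : ℝ, HasDerivAt (fun x : ℝ => (q + 1 : ℝ) * ((1 + x) / 2) ^ q)
        ((q + 1) * (q * ((1 + x) / 2) ^ (q - 1) * (1 / 2))) x := by
      intro x
      exact ((((hasDerivAt_id x).const_add 1).div_const 2).pow q).const_mul _
    have dF := fun x hx => (dN x).div (dD x) (QD x hx).ne'
    apply strictAntiOn_of_deriv_neg (convex_Ico _ _)
      (fun y hy => (dF y hy).continuousAt.continuousWithinAt)
    intro x hx
    rw [interior_Ico] at hx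
    have hx' : x ∈ Set.Ico z (1:ℝ) := ⟨hx.1.le, hx.2⟩
    have h1 := (dF x hx').deriv
    refine lt_of_eq_of_lt h1 ?_
    apply div_neg_of_neg_of_pos _ (pow_pos (QD x hx') 2)
    obtain ⟨r, rfl⟩ : ∃ r, q = r + 1 := ⟨q - 1, by
      have : 1 ≤ q := by
        by_contra h
        have : q = 0 := by omega
        subst this; norm_num at hp6
      omega⟩
    have hu : 0 < (1 + x) / 2 := by linarith [hz.1, hx.1]
    have hpw := pow_pos hu r
    have hneg : 0 < ((r + 1 : ℕ) + 1 : ℝ) * ((1 + x) / 2) ^ r * (1 / 2) *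
        (((r + 1 : ℕ) + 1 : ℝ) * ((1 - x ^ 2) * L2.eval x)) := by
      have := mul_pos (hw x hx') (Q2 x hx')
      positivity
    have o := ode x
    simp only [Nat.add_sub_cancel, pow_succ ((1 + x) / 2) r]
    push_cast at *
    have e : ∀ A B : ℝ, A = -B → 0 < B → A < 0 := fun A B h h' => by linarith
    refine e _ _ ?_ hneg
    linear_combination ((r:ℝ) + 1 + 1) * ((1 + x) / 2) ^ r * (1 / 2) * (r + 1) * o
  refine key.congr ?_
  intro x hx
  have h1 := Q1 x hx
  have hD := QD x hx
  have hv : 0 < 1 - x := sub_pos.2 hx.2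
  have hvq := pow_pos hv q
  have hb : (1 - x) ^ (q + 1) * L1.eval x + (q + 1) * (1 - x) ^ q * Q.eval x
      = (1 - x) ^ q * ((1 - x) * L1.eval x + (q + 1) * Q.eval x) := by ring
  simp only [hb, div_pow]
  have := hD.ne'
  field_simp
  ring
end

section
/- Let p > 2 be a real number. Let f : ℝ → ℝ be twice continuously differentiable on (−1,1), satisfy (1−x²)f''(x) − 2x·f'(x) + p·f(x) = 0 for all x ∈ (−1,1), and satisfy f(x) → 1 as x → 1⁻. Let z ∈ (−1,1) satisfy f(z) = 0 and f(x) > 0 for all x ∈ (z,1). Then f''(x) > 0 for every x ∈ [z, 1), i.e., f is strictly convex on [z, 1). -/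
/-- A bounded Legendre solution of parameter `p`: twice continuously differentiable on
`(−1,1)`, solving the Legendre equation there, and tending to `1` at `1⁻`. -/
def IsBddLegendreSol (p : ℝ) (f : ℝ → ℝ) : Prop :=
  ContDiffOn ℝ 2 f (Set.Ioo (-1 : ℝ) 1) ∧
  (∀ x ∈ Set.Ioo (-1 : ℝ) 1,
    (1 - x ^ 2) * deriv (deriv f) x - 2 * x * deriv f x + p * f x = 0) ∧
  Filter.Tendsto f (nhdsWithin 1 (Set.Iio 1)) (nhds 1)

/-- `z` is the largest zero of `f` in `(−1,1)`: `f(z) = 0` and `f > 0` on `(z,1)`. -/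
def IsLargestZero (f : ℝ → ℝ) (z : ℝ) : Prop :=
  z ∈ Set.Ioo (-1 : ℝ) 1 ∧ f z = 0 ∧ ∀ x ∈ Set.Ioo z (1 : ℝ), 0 < f x

/-- The bounded Legendre solution is strictly convex on `[z,1)`, where `z` is its
largest zero. -/
theorem bddLegendreSol_convex (p : ℝ) (hp : 2 < p) (f : ℝ → ℝ) (z : ℝ)
    (hf : IsBddLegendreSol p f) (hz : IsLargestZero f z) :
    ∀ x ∈ Set.Ico z (1 : ℝ), 0 < deriv (deriv f) x := by
  obtain ⟨hC, hode, hlim⟩ := hf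
  obtain ⟨hz1, hfz, hpos⟩ := hz
  have d1 : ∀ x ∈ Set.Ioo (-1 : ℝ) 1, HasDerivAt f (deriv f x) x := fun x hx =>
    ((hC.differentiableOn (by norm_num)).differentiableAt (isOpen_Ioo.mem_nhds hx)).hasDerivAt
  have hC1 : ContDiffOn ℝ 1 (deriv f) (Set.Ioo (-1 : ℝ) 1) :=
    hC.deriv_of_isOpen isOpen_Ioo (by norm_num)
  have d2 : ∀ x ∈ Set.Ioo (-1 : ℝ) 1, HasDerivAt (deriv f) (deriv (deriv f) x) x := fun x hx =>
    ((hC1.differentiableOn (by norm_num)).differentiableAt (isOpen_Ioo.mem_nhds hx)).hasDerivAt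
  have sub : ∀ x ∈ Set.Ico z (1 : ℝ), x ∈ Set.Ioo (-1 : ℝ) 1 := fun x hx =>
    ⟨lt_of_lt_of_le hz1.1 hx.1, hx.2⟩
  have dw : ∀ x : ℝ, HasDerivAt (fun x : ℝ => 1 - x ^ 2) (-(2 * x)) x := fun x => by
    simpa using (hasDerivAt_pow 2 x).const_sub 1
  have dH : ∀ x ∈ Set.Ioo (-1 : ℝ) 1,
      HasDerivAt (fun x => (1 - x ^ 2) * deriv f x) (-(p * f x)) x := fun x hx => by
    have := (dw x).mul (d2 x hx)
    refine this.congr_deriv ?_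
    linarith [hode x hx]
  have dG : ∀ x ∈ Set.Ioo (-1 : ℝ) 1,
      HasDerivAt (fun x => 2 * x * ((1 - x ^ 2) * deriv f x) - p * ((1 - x ^ 2) * f x))
        (-((p - 2) * ((1 - x ^ 2) * deriv f x))) x := fun x hx => by
    have := ((((hasDerivAt_id x).const_mul 2).mul (dH x hx))).sub
      (((dw x).mul (d1 x hx)).const_mul p)
    refine this.congr_deriv ?_
    simp only [id]
    ring
  have aH : StrictAntiOn (fun x => (1 - x ^ 2) * deriv f x) (Set.Ico z 1) := by
    apply strictAntiOn_of_deriv_neg (convex_Ico z 1)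
    · exact fun x hx => (dH x (sub x hx)).continuousAt.continuousWithinAt
    · intro x hx
      rw [interior_Ico] at hx
      rw [(dH x (sub x ⟨hx.1.le, hx.2⟩)).deriv]
      have := hpos x hx
      have : 0 < p * f x := by positivity
      linarith
  have hIoo : ∀ d < (1 : ℝ), ∀ᶠ x in nhdsWithin (1 : ℝ) (Set.Iio 1), x ∈ Set.Ioo d 1 :=
    fun d hd => Ioo_mem_nhdsLT hd
  have wpos : ∀ x ∈ Set.Ioo (-1 : ℝ) 1, 0 < 1 - x ^ 2 := fun x hx => by
    nlinarith [hx.1, hx.2]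
  have Hpos : ∀ x ∈ Set.Ico z (1 : ℝ), 0 < (1 - x ^ 2) * deriv f x := by
    intro c hc
    by_contra! hneg
    obtain ⟨d, hcd, hd1⟩ := exists_between hc.2
    have hdI : d ∈ Set.Ico z (1 : ℝ) := ⟨hc.1.trans hcd.le, hd1⟩
    have hHd := aH hc hdI hcd
    simp only at hHd
    obtain ⟨e, he⟩ : ∃ e, e = -((1 - d ^ 2) * deriv f d) := ⟨_, rfl⟩
    have hepos : 0 < e := by linarith
    have dK : ∀ x ∈ Set.Ioo (-1 : ℝ) 1, HasDerivAt (fun x => f x - e / 2 * Real.log (1 - x))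
        (deriv f x - e / 2 * (-1 / (1 - x))) x := fun x hx =>
      (d1 x hx).sub ((((hasDerivAt_id x).const_sub 1).log
        (by simp only [id]; linarith [hx.2])).const_mul _)
    have aK : AntitoneOn (fun x => f x - e / 2 * Real.log (1 - x)) (Set.Ico d 1) := by
      apply antitoneOn_of_deriv_nonpos (convex_Ico d 1)
      · exact fun x hx => (dK x (sub x ⟨hdI.1.trans hx.1, hx.2⟩)).continuousAt.continuousWithinAt
      · intro x hx
        rw [interior_Ico] at hx
        exact (dK x (sub x ⟨hdI.1.trans hx.1.le, hx.2⟩)).differentiableAt.differentiableWithinAt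
      · intro x hx
        rw [interior_Ico] at hx
        have hxI : x ∈ Set.Ico z (1 : ℝ) := ⟨hdI.1.trans hx.1.le, hx.2⟩
        have hx' := sub x hxI
        rw [(dK x hx').deriv]
        have h1 := aH hdI hxI hx.1
        simp only at h1
        have h2 : 0 < 1 - x := by linarith [hx.2]
        have h3 : 0 < 1 + x := by linarith [hx'.1]
        have h4 : deriv f x * (1 - x) ≤ -(e / 2) := by
          have h5 : (1 + x) * (deriv f x * (1 - x)) < -e := by linarith
          by_contra! h6
          nlinarith [mul_lt_mul_of_pos_left h6 h3, mul_pos hepos h2]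
        have h7 : deriv f x - e / 2 * (-1 / (1 - x))
            = (deriv f x * (1 - x) + e / 2) / (1 - x) := by field_simp; ring
        rw [h7]
        exact div_nonpos_of_nonpos_of_nonneg (by linarith) h2.le
    have hlog : Filter.Tendsto (fun x : ℝ => Real.log (1 - x)) (nhdsWithin 1 (Set.Iio 1))
        Filter.atBot := by
      apply Real.tendsto_log_nhdsGT_zero.comp
      apply tendsto_nhdsWithin_iff.2 ⟨?_, ?_⟩
      · have : Filter.Tendsto (fun x : ℝ => 1 - x) (nhds 1) (nhds (1 - 1)) :=
          (continuous_const.sub continuous_id).tendsto 1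
        rw [sub_self] at this
        exact this.mono_left nhdsWithin_le_nhds
      · filter_upwards [self_mem_nhdsWithin] with x hx
        have : x < 1 := hx
        simpa using this
    obtain ⟨x, hx, hfx, hl⟩ := ((hIoo d hd1).and ((hlim.eventually
      (lt_mem_nhds (show (0 : ℝ) < 1 by norm_num))).and (hlog.eventually
        (Filter.eventually_lt_atBot (-(2 / e * (f d - e / 2 * Real.log (1 - d)))))))).exists
    have := aK ⟨le_rfl, hd1⟩ ⟨hx.1.le, hx.2⟩ hx.1.le
    simp only at this
    have h8 := mul_lt_mul_of_pos_left hl (show 0 < e / 2 by positivity)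
    have h9 : e / 2 * (-(2 / e * (f d - e / 2 * Real.log (1 - d))))
      = -(f d - e / 2 * Real.log (1 - d)) := by field_simp
    linarith
  have aG : StrictAntiOn (fun x => 2 * x * ((1 - x ^ 2) * deriv f x) - p * ((1 - x ^ 2) * f x))
      (Set.Ico z 1) := by
    apply strictAntiOn_of_deriv_neg (convex_Ico z 1)
    · exact fun x hx => (dG x (sub x hx)).continuousAt.continuousWithinAt
    · intro x hx
      rw [interior_Ico] at hx
      have hxI : x ∈ Set.Ico z (1 : ℝ) := ⟨hx.1.le, hx.2⟩
      rw [(dG x (sub x hxI)).deriv]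
      have := mul_pos (sub_pos.2 hp) (Hpos x hxI)
      linarith
  intro c hc
  have hw := wpos c (sub c hc)
  by_contra! hneg
  have hGc : 2 * c * ((1 - c ^ 2) * deriv f c) - p * ((1 - c ^ 2) * f c) ≤ 0 := by
    have h1 : 2 * c * ((1 - c ^ 2) * deriv f c) - p * ((1 - c ^ 2) * f c)
      = (1 - c ^ 2) * ((1 - c ^ 2) * deriv (deriv f) c) := by
      have := hode c (sub c hc)
      linear_combination (-(1 - c ^ 2)) * this
    rw [h1]
    exact mul_nonpos_of_nonneg_of_nonpos hw.le (mul_nonpos_of_nonneg_of_nonpos hw.le hneg)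
  obtain ⟨d, hcd, hd1⟩ := exists_between hc.2
  have hdI : d ∈ Set.Ico z (1 : ℝ) := ⟨hc.1.trans hcd.le, hd1⟩
  have hGd := aG hc hdI hcd
  simp only at hGd
  have hT : Filter.Tendsto (fun x : ℝ => p * ((1 - x ^ 2) * f x)) (nhdsWithin 1 (Set.Iio 1))
      (nhds 0) := by
    have h1 : Filter.Tendsto (fun x : ℝ => 1 - x ^ 2) (nhdsWithin 1 (Set.Iio 1))
      (nhds (1 - 1 ^ 2)) := (dw 1).continuousAt.tendsto.mono_left nhdsWithin_le_nhds
    simpa using (h1.mul hlim).const_mul p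
  obtain ⟨x, hx, hx0, hxT⟩ := ((hIoo d hd1).and ((hIoo 0 one_pos).and (hT.eventually
    (gt_mem_nhds (show 0 < -(2 * d * ((1 - d ^ 2) * deriv f d) - p * ((1 - d ^ 2) * f d)) by
      linarith))))).exists
  have hxI : x ∈ Set.Ico z (1 : ℝ) := ⟨hdI.1.trans hx.1.le, hx.2⟩
  have h1 := aG hdI hxI hx.1
  simp only at h1
  have h2 := mul_pos hx0.1 (Hpos x hxI)
  linarith
end

section
/- Let p > 2 be a real number, let f be a bounded Legendre solution of parameter p with largest zero z ∈ (−1,1). Then every solution y of the Legendre equation on (−1,1) (i.e., y twice continuously differentiable on (−1,1) with (1−x²)y''(x) − 2x·y'(x) + p·y(x) = 0 for all x ∈ (−1,1)) that is not identically zero on (−1,1) has a zero in [z, 1): there exists x ∈ [z, 1) with y(x) = 0. -/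
theorem legendre_core (p : ℝ) (f f1 f2 y y1 y2 : ℝ → ℝ) (z : ℝ)
    (hf1 : ∀ x ∈ Set.Ioo (-1 : ℝ) 1, HasDerivAt f (f1 x) x)
    (hf2 : ∀ x ∈ Set.Ioo (-1 : ℝ) 1, HasDerivAt f1 (f2 x) x)
    (hfo : ∀ x ∈ Set.Ioo (-1 : ℝ) 1, (1 - x ^ 2) * f2 x - 2 * x * f1 x + p * f x = 0)
    (hft : Filter.Tendsto f (nhdsWithin 1 (Set.Iio 1)) (nhds 1))
    (hz : IsLargestZero f z)
    (hy1 : ∀ x ∈ Set.Ioo (-1 : ℝ) 1, HasDerivAt y (y1 x) x)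
    (hy2 : ∀ x ∈ Set.Ioo (-1 : ℝ) 1, HasDerivAt y1 (y2 x) x)
    (hyo : ∀ x ∈ Set.Ioo (-1 : ℝ) 1, (1 - x ^ 2) * y2 x - 2 * x * y1 x + p * y x = 0)
    (hpos : ∀ x ∈ Set.Ico z (1 : ℝ), 0 < y x) : False := by
  obtain ⟨⟨hz1, hz2⟩, hfz, hfpos⟩ := hz
  let W : ℝ → ℝ := fun x => (1 - x ^ 2) * (f1 x * y x - f x * y1 x)
  have hW : ∀ x ∈ Set.Ioo (-1 : ℝ) 1, HasDerivAt W 0 x := by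
    intro x hx
    have h1 : HasDerivAt (fun x : ℝ => 1 - x ^ 2) (-(2 * x)) x := by
      simpa using ((hasDerivAt_id x).pow 2).const_sub 1
    have h := h1.mul (((hf2 x hx).mul (hy1 x hx)).sub ((hf1 x hx).mul (hy2 x hx)))
    refine (h.congr_deriv ?_)
    simp only [Pi.mul_apply, Pi.sub_apply]
    linear_combination y x * hfo x hx - f x * hyo x hx
  -- a point where the Wronskian is positive
  obtain ⟨ξ, hξ, hcpos⟩ : ∃ ξ ∈ Set.Ioo (-1 : ℝ) 1, 0 < W ξ := by
    have hm : z < (z + 1) / 2 := by linarith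
    have hd : ∀ x ∈ Set.Ico z (1 : ℝ), HasDerivAt (fun x => f x / y x)
        ((f1 x * y x - f x * y1 x) / y x ^ 2) x := fun x hx =>
      (hf1 x ⟨by linarith [hx.1], hx.2⟩).div (hy1 x ⟨by linarith [hx.1], hx.2⟩) (hpos x hx).ne'
    obtain ⟨ξ, hξ, he⟩ := exists_hasDerivAt_eq_slope (fun x => f x / y x) _ hm
      (fun x hx => (hd x ⟨hx.1, by linarith [hx.2]⟩).continuousAt.continuousWithinAt)
      (fun x hx => hd x ⟨hx.1.le, by linarith [hx.2]⟩)
    have hξ1 : ξ < 1 := by linarith [hξ.2]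
    have hξ0 : -1 < ξ := by linarith [hξ.1]
    refine ⟨ξ, ⟨hξ0, hξ1⟩, ?_⟩
    have hy := hpos ξ ⟨hξ.1.le, hξ1⟩
    have h0 : 0 < (f1 ξ * y ξ - f ξ * y1 ξ) / y ξ ^ 2 := by
      rw [he]
      have := hfpos ((z + 1) / 2) ⟨hm, by linarith⟩
      have := hpos ((z + 1) / 2) ⟨hm.le, by linarith⟩
      have : 0 < (z + 1) / 2 - z := by linarith
      simp only [hfz, zero_div, sub_zero]
      positivity
    have h1 := (div_pos_iff_of_pos_right (by positivity)).1 h0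
    exact mul_pos (by nlinarith) h1
  have hWc : ∀ x ∈ Set.Ioo (-1 : ℝ) 1, W x = W ξ := fun x hx =>
    isOpen_Ioo.is_const_of_deriv_eq_zero isPreconnected_Ioo
      (fun x hx => (hW x hx).differentiableAt.differentiableWithinAt)
      (fun x hx => (hW x hx).deriv) hx hξ
  generalize W ξ = c at hcpos hWc
  -- f < 2 near 1
  obtain ⟨a, ha, hfa⟩ : ∃ a ∈ Set.Ioo z (1 : ℝ), ∀ x ∈ Set.Ico a (1 : ℝ), f x < 2 := by
    have h := hft.eventually (gt_mem_nhds (by norm_num : (1 : ℝ) < 2))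
    obtain ⟨l, hl, hl2⟩ := (mem_nhdsLT_iff_exists_Ioo_subset).1 h
    have hl : l < 1 := hl
    have hM : max l z < 1 := max_lt hl hz2
    refine ⟨(max l z + 1) / 2, ⟨?_, by linarith⟩, fun x hx => hl2 ⟨?_, hx.2⟩⟩
    · linarith [le_max_right l z]
    · linarith [le_max_left l z, hx.1]
  have hH : ∀ x ∈ Set.Ico a (1 : ℝ), HasDerivAt (fun x => y x / f x - c / 8 * Real.log (1 - x))
      ((y1 x * f x - y x * f1 x) / f x ^ 2 - c / 8 * (-1 / (1 - x))) x := by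
    intro x hx
    have hx' : x ∈ Set.Ioo (-1 : ℝ) 1 := ⟨by linarith [hx.1, ha.1], hx.2⟩
    have h1 : HasDerivAt (fun x : ℝ => 1 - x) (-1) x := by
      simpa using (hasDerivAt_id x).const_sub 1
    exact ((hy1 x hx').div (hf1 x hx') (hfpos x ⟨by linarith [hx.1, ha.1], hx.2⟩).ne').sub
      ((h1.log (by linarith [hx.2])).const_mul (c / 8))
  have hanti : AntitoneOn (fun x => y x / f x - c / 8 * Real.log (1 - x)) (Set.Ico a 1) := by
    apply antitoneOn_of_deriv_nonpos (convex_Ico a 1)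
    · exact fun x hx => (hH x hx).continuousAt.continuousWithinAt
    · intro x hx
      exact (hH x (interior_subset hx)).differentiableAt.differentiableWithinAt
    · intro x hx
      have hx := interior_subset hx
      rw [(hH x hx).deriv]
      have hx1 : 0 < 1 - x := by linarith [hx.2]
      have hx0 : 0 < 1 + x := by linarith [hx.1, ha.1]
      have hw := hWc x ⟨by linarith, hx.2⟩
      have hfx := hfpos x ⟨by linarith [hx.1, ha.1], hx.2⟩
      have hf2' := hfa x hx
      have e : (y1 x * f x - y x * f1 x) = - c / ((1 - x) * (1 + x)) := by
        rw [eq_div_iff (by positivity), ← hw]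
        ring
      have e2 : (y1 x * f x - y x * f1 x) / f x ^ 2 - c / 8 * (-1 / (1 - x))
          = - (c / (1 - x)) * (1 / ((1 + x) * f x ^ 2) - 1 / 8) := by
        rw [e]; field_simp; ring
      rw [e2]
      have h8 : 1 / 8 ≤ 1 / ((1 + x) * f x ^ 2) := by
        apply one_div_le_one_div_of_le (by positivity)
        have : f x ^ 2 ≤ 4 := by nlinarith
        nlinarith
      have : 0 < c / (1 - x) := by positivity
      nlinarith
  set A := y a / f a - c / 8 * Real.log (1 - a) with hA
  set t := max (8 * A / c) (- Real.log (1 - a)) with ht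
  have hx1 : 1 - Real.exp (-t) < 1 := by linarith [Real.exp_pos (-t)]
  have hx0 : a ≤ 1 - Real.exp (-t) := by
    have h : -t ≤ Real.log (1 - a) := by linarith [le_max_right (8 * A / c) (- Real.log (1 - a))]
    have := Real.exp_le_exp.2 h
    rw [Real.exp_log (by linarith [ha.2])] at this
    linarith
  have h := hanti ⟨le_rfl, ha.2⟩ ⟨hx0, hx1⟩ hx0
  simp only [sub_sub_cancel, Real.log_exp] at h
  have hp1 : 0 < y (1 - Real.exp (-t)) / f (1 - Real.exp (-t)) :=
    div_pos (hpos _ ⟨by linarith [ha.1], hx1⟩) (hfpos _ ⟨by linarith [ha.1], hx1⟩)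
  have h3 : A ≤ c / 8 * t := by
    have := le_max_left (8 * A / c) (- Real.log (1 - a))
    rw [← ht, div_le_iff₀ hcpos] at this
    linarith
  linarith

theorem legendre_derivs (f : ℝ → ℝ) (hf : ContDiffOn ℝ 2 f (Set.Ioo (-1 : ℝ) 1)) :
    (∀ x ∈ Set.Ioo (-1 : ℝ) 1, HasDerivAt f (deriv f x) x) ∧
    (∀ x ∈ Set.Ioo (-1 : ℝ) 1, HasDerivAt (deriv f) (deriv (deriv f) x) x) := by
  constructor
  · intro x hx
    exact ((hf.differentiableOn (by norm_num)).differentiableAt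
      (isOpen_Ioo.mem_nhds hx)).hasDerivAt
  · intro x hx
    have h : ContDiffOn ℝ 1 (deriv f) (Set.Ioo (-1 : ℝ) 1) :=
      hf.deriv_of_isOpen isOpen_Ioo (by norm_num)
    exact ((h.differentiableOn (by norm_num)).differentiableAt
      (isOpen_Ioo.mem_nhds hx)).hasDerivAt

/-- Every nontrivial solution of the Legendre equation on `(−1,1)` has a zero in `[z,1)`,
where `z` is the largest zero of the bounded solution. -/
theorem rightmost_zero_minimal (p : ℝ) (hp : 2 < p) (f : ℝ → ℝ) (z : ℝ)
    (hf : IsBddLegendreSol p f) (hz : IsLargestZero f z)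
    (y : ℝ → ℝ) (hy : ContDiffOn ℝ 2 y (Set.Ioo (-1 : ℝ) 1))
    (hode : ∀ x ∈ Set.Ioo (-1 : ℝ) 1,
      (1 - x ^ 2) * deriv (deriv y) x - 2 * x * deriv y x + p * y x = 0)
    (hnt : ∃ x ∈ Set.Ioo (-1 : ℝ) 1, y x ≠ 0) :
    ∃ x ∈ Set.Ico z (1 : ℝ), y x = 0 := by
  by_contra! hne
  obtain ⟨hf0, hfo, hft⟩ := hf
  obtain ⟨hf1, hf2⟩ := legendre_derivs f hf0
  obtain ⟨hy1, hy2⟩ := legendre_derivs y hy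
  have hzm := hz.1
  have hsub : Set.Ico z 1 ⊆ Set.Ioo (-1 : ℝ) 1 := fun x hx => ⟨by linarith [hx.1, hzm.1], hx.2⟩
  have hc : ContinuousOn y (Set.Ico z 1) := hy.continuousOn.mono hsub
  have hzI : z ∈ Set.Ico z 1 := ⟨le_rfl, hzm.2⟩
  have key : ∀ x ∈ Set.Ico z (1 : ℝ), 0 < y z * y x := by
    intro x hx
    by_contra! hcon
    have hsurj2 := isPreconnected_Ico.intermediate_value hx hzI (hc.const_smul (y z))
    obtain ⟨w, hw, hw0⟩ := hsurj2 ⟨by simpa using hcon, by simpa using mul_self_nonneg (y z)⟩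
    rcases mul_eq_zero.1 (show y z * y w = 0 by simpa using hw0) with h | h
    · exact hne z hzI h
    · exact hne w hw h
  refine legendre_core p f _ _ (fun x => y z * y x) (fun x => y z * deriv y x)
    (fun x => y z * deriv (deriv y) x) z hf1 hf2 hfo hft hz
    (fun x hx => (hy1 x hx).const_mul _) (fun x hx => (hy2 x hx).const_mul _) ?_ key
  intro x hx
  linear_combination y z * hode x hx
end

section
/- Let p > 2 be a real number, let f be a bounded Legendre solution of parameter p with largest zero z ∈ (−1,1). Then (1+z)/2 ≥ p/(p+2); equivalently, (1+z)/(1−z) ≥ p/2. -/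
open Filter Topology Set in
lemma log_blowup (f f' : ℝ → ℝ) (a c l : ℝ) (ha : a < 1) (hc : 0 < c)
    (hd : ∀ x ∈ Ioo a 1, HasDerivAt f (f' x) x)
    (hb : ∀ x ∈ Ioo a 1, c ≤ (1 - x) * f' x)
    (hl : Tendsto f (𝓝[<] 1) (𝓝 l)) : False := by
  have hder : ∀ x ∈ Ioo a 1,
      HasDerivAt (fun x => f x + c * Real.log (1 - x)) (f' x + c * (-1 / (1 - x))) x := by
    intro x hx
    have h1 : HasDerivAt (fun x : ℝ => 1 - x) (-1) x := by
      simpa using (hasDerivAt_id x).const_sub 1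
    have hne : (1 : ℝ) - x ≠ 0 := by linarith [hx.2]
    exact (hd x hx).add ((h1.log hne).const_mul c)
  have hmono : MonotoneOn (fun x => f x + c * Real.log (1 - x)) (Ioo a 1) := by
    apply monotoneOn_of_deriv_nonneg (convex_Ioo a 1)
    · exact fun x hx => (hder x hx).continuousAt.continuousWithinAt
    · rw [interior_Ioo]
      exact fun x hx => (hder x hx).differentiableAt.differentiableWithinAt
    · rw [interior_Ioo]
      intro x hx
      rw [(hder x hx).deriv]
      have h1 : 0 < 1 - x := by linarith [hx.2]
      have h2 : f' x + c * (-1 / (1 - x)) = ((1 - x) * f' x - c) / (1 - x) := by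
        field_simp
        ring
      rw [h2]
      exact div_nonneg (by linarith [hb x hx]) h1.le
  have ht0 : Tendsto (fun x : ℝ => 1 - x) (𝓝[<] 1) (𝓝[>] 0) := by
    apply tendsto_nhdsWithin_of_tendsto_nhds_of_eventually_within
    · have : Tendsto (fun x : ℝ => 1 - x) (𝓝 1) (𝓝 (1 - 1)) :=
        (continuous_const.sub continuous_id).tendsto 1
      rw [sub_self] at this
      exact this.mono_left nhdsWithin_le_nhds
    · filter_upwards [self_mem_nhdsWithin] with x hx
      have : x < 1 := hx
      simpa using this
  have ht : Tendsto (fun x => f x + c * Real.log (1 - x)) (𝓝[<] 1) atBot :=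
    hl.add_atBot ((Real.tendsto_log_nhdsGT_zero.comp ht0).const_mul_atBot hc)
  have hm : (a + 1) / 2 ∈ Ioo a 1 := ⟨by linarith, by linarith⟩
  have e1 := ht.eventually (eventually_lt_atBot
    ((fun x => f x + c * Real.log (1 - x)) ((a + 1) / 2)))
  have e2 : ∀ᶠ x in 𝓝[<] (1 : ℝ), x ∈ Ioo ((a + 1) / 2) 1 := Ioo_mem_nhdsLT hm.2
  obtain ⟨x, h1, h2⟩ := (e1.and e2).exists
  have := hmono hm ⟨hm.1.trans h2.1, h2.2⟩ h2.1.le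
  simp only at this h1
  linarith

open Filter Topology Set in
theorem largest_zero_core (p : ℝ) (hp : 2 < p) (f : ℝ → ℝ) (z : ℝ)
    (hf : IsBddLegendreSol p f) (hz : IsLargestZero f z) :
    p * (1 - z) ≤ 2 * (1 + z) := by
  obtain ⟨hC, hode, hlim⟩ := hf
  obtain ⟨⟨hz1, hz2⟩, hfz, hpos⟩ := hz
  have hd1 : ∀ x ∈ Ioo (-1 : ℝ) 1, HasDerivAt f (deriv f x) x := fun x hx =>
    ((hC.differentiableOn (by norm_num)).differentiableAt (isOpen_Ioo.mem_nhds hx)).hasDerivAt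
  have hd2 : ∀ x ∈ Ioo (-1 : ℝ) 1, HasDerivAt (deriv f) (deriv (deriv f) x) x := fun x hx =>
    (((hC.deriv_of_isOpen (m := 1) isOpen_Ioo (by norm_num)).differentiableOn
      (by norm_num)).differentiableAt (isOpen_Ioo.mem_nhds hx)).hasDerivAt
  have hw : ∀ x : ℝ, HasDerivAt (fun x : ℝ => 1 - x ^ 2) (-(2 * x)) x := fun x => by
    simpa using (hasDerivAt_pow 2 x).const_sub 1
  set q : ℝ → ℝ := fun x => (1 - x ^ 2) * deriv f x with hq
  have hqd : ∀ x ∈ Ioo (-1 : ℝ) 1, HasDerivAt q (-p * f x) x := fun x hx => by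
    have := (hw x).mul (hd2 x hx)
    refine HasDerivAt.congr_deriv this ?_
    linarith [hode x hx]
  have sub : ∀ x ∈ Ioo z 1, x ∈ Ioo (-1 : ℝ) 1 := fun x hx => ⟨hz1.trans hx.1, hx.2⟩
  have hqanti : StrictAntiOn q (Ioo z 1) := by
    apply strictAntiOn_of_deriv_neg (convex_Ioo z 1)
    · exact fun x hx => (hqd x (sub x hx)).continuousAt.continuousWithinAt
    · rw [interior_Ioo]
      intro x hx
      rw [(hqd x (sub x hx)).deriv]
      nlinarith [hpos x hx]
  have hqpos : ∀ x ∈ Ioo z 1, 0 < q x := by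
    intro x hx
    by_contra hcon
    push Not at hcon
    have hy : (x + 1) / 2 ∈ Ioo z 1 := ⟨by linarith [hx.1, hx.2], by linarith [hx.2]⟩
    have hqy : q ((x + 1) / 2) < 0 := (hqanti hx hy (by linarith [hx.2])).trans_le hcon
    refine log_blowup (fun t => - f t) (fun t => - deriv f t) ((x + 1) / 2)
      (- q ((x + 1) / 2) / 2) (-1) hy.2 (by linarith) ?_ ?_ hlim.neg
    · exact fun t ht => (hd1 t (sub t ⟨hy.1.trans ht.1, ht.2⟩)).neg
    · intro t ht
      have ht' : t ∈ Ioo z 1 := ⟨hy.1.trans ht.1, ht.2⟩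
      have h1 : q t < q ((x + 1) / 2) := hqanti hy ht' ht.1
      have h2 := sub t ht'
      have h3 : q t = (1 + t) * ((1 - t) * deriv f t) := by simp only [hq]; ring
      have h4 : 0 < -((1 - t) * deriv f t) := by
        by_contra h
        have : 0 ≤ q t := by
          rw [h3]; exact mul_nonneg (by linarith [h2.1]) (by linarith)
        linarith
      nlinarith [h2.1, h2.2]
  have hqlim : Tendsto q (𝓝[<] 1) (𝓝 0) := by
    rw [Metric.tendsto_nhds]
    intro ε hε
    have : ∃ x ∈ Ioo z 1, q x < ε := by
      by_contra hcon
      push Not at hcon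
      refine log_blowup f (deriv f) z (ε / 2) 1 hz2 (by linarith)
        (fun t ht => hd1 t (sub t ht)) ?_ hlim
      intro t ht
      have h1 := hcon t ht
      have h2 := sub t ht
      have h3 : q t = (1 + t) * ((1 - t) * deriv f t) := by simp only [hq]; ring
      have h4 : 0 < ((1 - t) * deriv f t) := by
        by_contra h
        have : q t ≤ 0 := by
          rw [h3]; exact mul_nonpos_of_nonneg_of_nonpos (by linarith [h2.1]) (by linarith)
        linarith
      nlinarith [h2.1, h2.2]
    obtain ⟨x, hx, hxq⟩ := this
    filter_upwards [Ioo_mem_nhdsLT hx.2] with t ht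
    have ht' : t ∈ Ioo z 1 := ⟨hx.1.trans ht.1, ht.2⟩
    have h1 := hqanti hx ht' ht.1
    have h2 := hqpos t ht'
    rw [Real.dist_eq, sub_zero, abs_of_pos h2]
    linarith
  by_contra hcon
  push Not at hcon
  set H : ℝ → ℝ := fun x => (1 - x) * (-(1 + x) + p / 2 * (1 + x - 2 * z)) with hH
  have hHd : ∀ x, HasDerivAt H (2 * x - p * x + p * z) x := fun x => by
    have h1 : HasDerivAt (fun x : ℝ => 1 - x) (-1) x := by
      simpa using (hasDerivAt_id x).const_sub 1
    have h2 : HasDerivAt (fun x : ℝ => 1 + x) 1 x := by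
      simpa using (hasDerivAt_id x).const_add 1
    have := h1.mul (h2.neg.add ((h2.sub_const (2 * z)).const_mul (p / 2)))
    refine HasDerivAt.congr_deriv this ?_
    simp only [Pi.add_apply, Pi.neg_apply]
    ring
  set Φ : ℝ → ℝ := fun x => (1 - x ^ 2) * f x - (x - z) * q x + f x * H x with hΦ
  have hΦd : ∀ x ∈ Ioo (-1 : ℝ) 1, HasDerivAt Φ (deriv f x * H x) x := fun x hx => by
    have := (((hw x).mul (hd1 x hx)).sub
      (((hasDerivAt_id x).sub_const z).mul (hqd x hx))).add ((hd1 x hx).mul (hHd x))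
    refine HasDerivAt.congr_deriv this ?_
    simp only [hq, id]
    ring
  have hmono : StrictMonoOn Φ (Ico z 1) := by
    apply strictMonoOn_of_deriv_pos (convex_Ico z 1)
    · exact fun x hx => (hΦd x ⟨hz1.trans_le hx.1, hx.2⟩).continuousAt.continuousWithinAt
    · rw [interior_Ico]
      intro x hx
      have h2 := sub x hx
      rw [(hΦd x h2).deriv]
      apply mul_pos
      · have h1 := hqpos x hx
        exact (mul_pos_iff_of_pos_left (by nlinarith [h2.1, h2.2])).1 h1
      · apply mul_pos (by linarith [hx.2])
        nlinarith [hx.1, mul_pos (sub_pos.2 hp) (sub_pos.2 hx.1)]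
  have hΦz : Φ z = 0 := by simp [hΦ, hfz]
  have hΦlim : Tendsto Φ (𝓝[<] 1) (𝓝 0) := by
    have c1 : Tendsto (fun x : ℝ => 1 - x ^ 2) (𝓝[<] 1) (𝓝 (1 - 1 ^ 2)) :=
      (hw 1).continuousAt.tendsto.mono_left nhdsWithin_le_nhds
    have c2 : Tendsto (fun x : ℝ => x - z) (𝓝[<] 1) (𝓝 (1 - z)) :=
      ((continuous_id.sub continuous_const).tendsto (1 : ℝ)).mono_left nhdsWithin_le_nhds
    have c3 : Tendsto H (𝓝[<] 1) (𝓝 (H 1)) :=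
      (hHd 1).continuousAt.tendsto.mono_left nhdsWithin_le_nhds
    have := ((c1.mul hlim).sub (c2.mul hqlim)).add (hlim.mul c3)
    convert this using 2
    simp [hH]
  have hm : (z + 1) / 2 ∈ Ico z 1 := ⟨by linarith, by linarith⟩
  have hpm : 0 < Φ ((z + 1) / 2) := by
    rw [← hΦz]; exact hmono ⟨le_rfl, hz2⟩ hm (by linarith)
  have : Φ ((z + 1) / 2) ≤ 0 := by
    apply ge_of_tendsto hΦlim
    filter_upwards [Ioo_mem_nhdsLT hm.2] with t ht
    exact (hmono hm ⟨hm.1.trans ht.1.le, ht.2⟩ ht.1).le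
  linarith

/-- Estimate for the largest zero of the bounded Legendre solution:
`(1+z)/2 ≥ p/(p+2)`, equivalently `(1+z)/(1−z) ≥ p/2`. -/
theorem largest_zero_estimate (p : ℝ) (hp : 2 < p) (f : ℝ → ℝ) (z : ℝ)
    (hf : IsBddLegendreSol p f) (hz : IsLargestZero f z) :
    p / (p + 2) ≤ (1 + z) / 2 ∧ p / 2 ≤ (1 + z) / (1 - z) := by
  have h := largest_zero_core p hp f z hf hz
  have h2 := hz.1.2
  constructor
  · rw [div_le_div_iff₀ (by linarith) (by norm_num)]
    nlinarith
  · rw [div_le_div_iff₀ (by norm_num) (by linarith)]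
    linarith
end

section
/- Let p > 2 be a real number, let f be a bounded Legendre solution of parameter p with largest zero z ∈ (−1,1). Then p·((1+z)/2)^{p−1} ≥ 1, where the power is a real power. -/
lemma num_ineq (p : ℝ) (hp : 2 < p) :
    0 ≤ Real.log p + (p - 1) * (Real.log (2 * p - 1) - Real.log (2 * p + 2)) := by
  have key : MonotoneOn (fun p : ℝ => Real.log p +
      (p - 1) * (Real.log (2 * p - 1) - Real.log (2 * p + 2))) (Set.Ici 2) := by
    have hd : ∀ x : ℝ, 2 ≤ x → HasDerivAt (fun p : ℝ => Real.log p +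
        (p - 1) * (Real.log (2 * p - 1) - Real.log (2 * p + 2)))
        (1 / x + (1 * (Real.log (2 * x - 1) - Real.log (2 * x + 2)) +
          (x - 1) * ((2 * 1) / (2 * x - 1) - (2 * 1) / (2 * x + 2)))) x := by
      intro x hx
      have h1 : HasDerivAt (fun p : ℝ => Real.log p) (1 / x) x :=
        (hasDerivAt_id x).log (by simp; linarith)
      have h2 : HasDerivAt (fun p : ℝ => Real.log (2 * p - 1)) ((2 * 1) / (2 * x - 1)) x :=
        (((hasDerivAt_id x).const_mul 2).sub_const 1).log (by simp; linarith)
      have h3 : HasDerivAt (fun p : ℝ => Real.log (2 * p + 2)) ((2 * 1) / (2 * x + 2)) x :=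
        (((hasDerivAt_id x).const_mul 2).add_const 2).log (by simp; linarith)
      exact h1.add (((hasDerivAt_id x).sub_const 1).mul (h2.sub h3))
    apply monotoneOn_of_deriv_nonneg (convex_Ici 2)
    · intro x hx
      exact (hd x hx).continuousAt.continuousWithinAt
    · intro x hx
      rw [interior_Ici] at hx
      exact (hd x (le_of_lt hx)).differentiableAt.differentiableWithinAt
    · intro x hx
      rw [interior_Ici] at hx
      have hx2 : 2 < x := hx
      rw [(hd x hx2.le).deriv]
      set R : ℝ := 1 / x + (x - 1) * ((2 * 1) / (2 * x - 1) - (2 * 1) / (2 * x + 2)) with hR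
      have ha : 0 < 2 * x - 1 := by linarith
      have hb : 0 < 2 * x + 2 := by linarith
      have hR' : R = 1 / x + 3 * (x - 1) / ((2 * x - 1) * (x + 1)) := by
        rw [hR]
        have : x + 1 ≠ 0 := by linarith
        have h1 : 2 * x - 1 ≠ 0 := ha.ne'
        have h2 : 2 * x + 2 ≠ 0 := hb.ne'
        have h3 : (2 * 1) / (2 * x - 1) - (2 * 1) / (2 * x + 2) = 3 / ((2 * x - 1) * (x + 1)) := by
          rw [div_sub_div _ _ h1 h2, div_eq_div_iff (mul_ne_zero h1 h2) (mul_ne_zero h1 this)]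
          ring
        rw [h3]
        ring
      have hRpos : 0 ≤ R := by
        rw [hR']
        have : 0 < x - 1 := by linarith
        positivity
      have hlog : Real.log (2 * x + 2) - Real.log (2 * x - 1) ≤ R := by
        rw [← Real.log_div hb.ne' ha.ne']
        have hs : (2 * x + 2) / (2 * x - 1) ≤ (1 + R / 2) ^ 2 := by
          rw [hR', ← sub_nonneg]
          obtain ⟨q, rfl⟩ : ∃ q, x = 2 + q := ⟨x - 2, by ring⟩
          have hq : 0 < q := by linarith
          have e : (1 + (1 / (2 + q) + 3 * (2 + q - 1) / ((2 * (2 + q) - 1) * (2 + q + 1))) / 2) ^ 2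
            - (2 * (2 + q) + 2) / (2 * (2 + q) - 1) =
            ((2 * (2 + q) * (2 * (2 + q) - 1) * (2 + q + 1) + (2 * (2 + q) - 1) * (2 + q + 1) + 3 * (2 + q - 1) * (2 + q))^2
             - 4 * (2 + q)^2 * (2 * (2 + q) - 1) * (2 + q + 1)^2 * (2 * (2 + q) + 2)) / (2 * (2 + q) * (2 * (2 + q) - 1) * (2 + q + 1))^2 := by
            have h1 : 2 * (2 + q) - 1 ≠ 0 := ha.ne'
            have h2 : 2 + q + 1 ≠ 0 := by positivity
            field_simp
            ring
          rw [e]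
          apply div_nonneg _ (sq_nonneg _)
          ring_nf
          positivity
        calc Real.log ((2 * x + 2) / (2 * x - 1)) ≤ Real.log ((1 + R / 2) ^ 2) :=
              Real.log_le_log (by positivity) hs
          _ = 2 * Real.log (1 + R / 2) := by rw [Real.log_pow]; norm_num
          _ ≤ 2 * ((1 + R / 2) - 1) := by
              have := Real.log_le_sub_one_of_pos (show 0 < 1 + R / 2 by linarith)
              linarith
          _ = R := by ring
      linarith
  have h := key (Set.mem_Ici.2 le_rfl) (Set.mem_Ici.2 hp.le) hp.le
  have e : Real.log 2 + ((2:ℝ) - 1) * (Real.log (2 * 2 - 1) - Real.log (2 * 2 + 2)) = 0 := by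
    rw [show (2 * 2 + 2 : ℝ) = 2 * 3 by norm_num, show (2 * 2 - 1 : ℝ) = 3 by norm_num,
      Real.log_mul (by norm_num) (by norm_num)]
    ring
  simp only [e] at h
  exact h

lemma zero_ge (p : ℝ) (hp : 2 < p) (f : ℝ → ℝ) (z : ℝ)
    (hf : IsBddLegendreSol p f) (hz : IsLargestZero f z) : (p - 2) / (p + 1) ≤ z := by
  by_contra hlt
  push Not at hlt
  obtain ⟨hC, hode, hlim⟩ := hf
  obtain ⟨hzI, hz0, hpos⟩ := hz
  obtain ⟨c, hzc, hcp⟩ := exists_between hlt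
  have hc : c * (p + 1) < p - 2 := (lt_div_iff₀ (by linarith)).1 hcp
  have hc1 : c < 1 := by nlinarith
  have hcm : -1 < c := lt_trans hzI.1 hzc
  have hf1 : ∀ x ∈ Set.Ioo (-1 : ℝ) 1, HasDerivAt f (deriv f x) x := fun x hx =>
    ((hC.differentiableOn (by norm_num)).differentiableAt (isOpen_Ioo.mem_nhds hx)).hasDerivAt
  have hf2 : ∀ x ∈ Set.Ioo (-1 : ℝ) 1, HasDerivAt (deriv f) (deriv (deriv f) x) x := by
    intro x hx
    have h2 : ContDiffOn ℝ (1 + 1) f (Set.Ioo (-1 : ℝ) 1) := by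
      convert hC using 1; norm_num
    have h3 := ((contDiffOn_succ_iff_deriv_of_isOpen isOpen_Ioo).1 h2).2.2
    exact ((h3.differentiableOn (by norm_num)).differentiableAt
      (isOpen_Ioo.mem_nhds hx)).hasDerivAt
  set G : ℝ → ℝ := fun x => (x - x ^ 3 / 3) - p * (x - c) ^ 3 / 3 - (c - c ^ 3 / 3) with hG
  set W : ℝ → ℝ := fun x => (1 - x ^ 2) * (x - c) ^ 2 * deriv f x / f x with hW
  have hGd : ∀ x, HasDerivAt G ((1 - x ^ 2) - p * (x - c) ^ 2) x := by
    intro x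
    have i := hasDerivAt_id x
    have := ((i.sub ((i.pow 3).div_const 3)).sub
      ((((i.sub_const c).pow 3).const_mul p).div_const 3)).sub_const (c - c ^ 3 / 3)
    have e : (1 - x ^ 2) - p * (x - c) ^ 2 = 1 - ((3 : ℕ) : ℝ) * id x ^ (3 - 1) * 1 / 3 -
        p * (((3 : ℕ) : ℝ) * (id x - c) ^ (3 - 1) * 1) / 3 := by
      simp
      ring
    rw [e]
    exact this
  have hWd : ∀ x ∈ Set.Ico c 1, ∃ D, HasDerivAt (fun x => W x - G x) D x ∧ D ≤ 0 := by
    intro x hx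
    have hxI : x ∈ Set.Ioo (-1 : ℝ) 1 := ⟨by linarith [hx.1], hx.2⟩
    have hfx : 0 < f x := hpos x ⟨by linarith [hx.1], hx.2⟩
    have i := hasDerivAt_id x
    have hd := (((((i.pow 2).const_sub 1).mul ((i.sub_const c).pow 2)).mul (hf2 x hxI)).div
      (hf1 x hxI) hfx.ne').sub (hGd x)
    refine ⟨_, hd, ?_⟩
    have ho := hode x hxI
    have hx2 : 0 ≤ 1 - x ^ 2 := by nlinarith [hxI.1, hxI.2]
    have e : (1 - x ^ 2) * deriv (deriv f) x = 2 * x * deriv f x - p * f x := by linarith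
    have key : 0 ≤ (1 - x ^ 2) * (1 - (x - c) * deriv f x / f x) ^ 2 := by positivity
    refine le_of_eq_of_le ?_ (neg_nonpos.2 key)
    simp
    field_simp
    linear_combination ((x - c) ^ 2 * f x) * e
  have hanti : AntitoneOn (fun x => W x - G x) (Set.Ico c 1) := by
    apply antitoneOn_of_deriv_nonpos (convex_Ico c 1)
    · intro x hx
      obtain ⟨D, h, -⟩ := hWd x hx
      exact h.continuousAt.continuousWithinAt
    · intro x hx
      obtain ⟨D, h, -⟩ := hWd x (interior_subset hx)
      exact h.differentiableAt.differentiableWithinAt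
    · intro x hx
      obtain ⟨D, h, h'⟩ := hWd x (interior_subset hx)
      rw [h.deriv]; exact h'
  have hWG : ∀ x ∈ Set.Ico c 1, W x ≤ G x := by
    intro x hx
    have := hanti (Set.left_mem_Ico.2 hc1) hx hx.1
    simp [hW, hG] at this
    simp only [hW, hG]
    linarith
  have hG1 : G 1 < 0 := by
    have : G 1 = (1 - c) ^ 2 / 3 * (2 + c - p * (1 - c)) := by simp only [hG]; ring
    rw [this]
    have h1 : 0 < 1 - c := by linarith
    exact mul_neg_of_pos_of_neg (by positivity) (by linarith)
  obtain ⟨d, hd0, hGd'⟩ : ∃ d : ℝ, 0 < d ∧ G 1 < -d := ⟨-G 1 / 2, by linarith, by linarith⟩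
  have hev : ∀ᶠ x in nhdsWithin (1:ℝ) (Set.Iio 1), G x < -d ∧ 1 / 2 < f x ∧ 0 < x ∧ c < x := by
    have a1 : ∀ᶠ x in nhdsWithin (1:ℝ) (Set.Iio 1), G x < -d :=
      (((hGd 1).continuousAt.tendsto).mono_left nhdsWithin_le_nhds).eventually_lt_const hGd'
    have a2 : ∀ᶠ x in nhdsWithin (1:ℝ) (Set.Iio 1), 1 / 2 < f x :=
      hlim.eventually_const_lt (by norm_num)
    have a3 : ∀ᶠ x in nhdsWithin (1:ℝ) (Set.Iio 1), (0:ℝ) < x :=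
      nhdsWithin_le_nhds (lt_mem_nhds (by norm_num))
    have a4 : ∀ᶠ x in nhdsWithin (1:ℝ) (Set.Iio 1), c < x :=
      nhdsWithin_le_nhds (lt_mem_nhds hc1)
    filter_upwards [a1, a2, a3, a4] with x b1 b2 b3 b4 using ⟨b1, b2, b3, b4⟩
  obtain ⟨b0, hb01, hb⟩ := (mem_nhdsLT_iff_exists_Ioo_subset).1 hev
  obtain ⟨b, hb0b, hb1⟩ := exists_between (show b0 < 1 from hb01)
  have hH : AntitoneOn (fun x => f x - d / 16 * Real.log (1 - x)) (Set.Ico b 1) := by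
    have hHd : ∀ x ∈ Set.Ico b 1, ∃ D, HasDerivAt (fun x => f x - d / 16 * Real.log (1 - x)) D x
        ∧ D ≤ 0 := by
      intro x hx
      obtain ⟨c1, c2, c3, c4⟩ := hb (show x ∈ Set.Ioo b0 1 from ⟨by linarith [hx.1], hx.2⟩)
      have hx1 : 0 < 1 - x := by linarith [hx.2]
      have hxI : x ∈ Set.Ioo (-1 : ℝ) 1 := ⟨by linarith, hx.2⟩
      refine ⟨_, (hf1 x hxI).sub
        ((((hasDerivAt_id x).const_sub 1).log (by simpa using hx1.ne')).const_mul (d / 16)), ?_⟩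
      have hw : W x < -d := lt_of_le_of_lt (hWG x ⟨c4.le, hx.2⟩) c1
      simp only [hW] at hw
      rw [div_lt_iff₀ (by linarith)] at hw
      have h1 : (1 - x ^ 2) * (x - c) ^ 2 * deriv f x < - (d / 2) := by nlinarith
      have hA : 0 < (1 - x ^ 2) * (x - c) ^ 2 := by
        have : 0 < x - c := by linarith
        have : 0 < 1 - x ^ 2 := by nlinarith
        positivity
      have hneg : deriv f x < 0 := by
        by_contra h
        push Not at h
        have := mul_nonneg hA.le h
        linarith
      have hA2 : (1 - x ^ 2) * (x - c) ^ 2 ≤ 8 * (1 - x) := by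
        have k1 : (x - c) ^ 2 ≤ 4 := by nlinarith [hx.2]
        have k2 : 1 - x ^ 2 ≤ 2 * (1 - x) := by nlinarith
        have k3 : 0 ≤ (x - c) ^ 2 := sq_nonneg _
        nlinarith
      have h2 : 8 * (1 - x) * deriv f x ≤ (1 - x ^ 2) * (x - c) ^ 2 * deriv f x :=
        mul_le_mul_of_nonpos_right hA2 hneg.le
      have h3 : deriv f x ≤ - (d / 16) / (1 - x) := by
        rw [le_div_iff₀ hx1]; linarith
      have e : d / 16 * (-1 / (1 - id x)) = - (d / 16) / (1 - x) := by simp; ring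
      rw [e]; linarith
    apply antitoneOn_of_deriv_nonpos (convex_Ico b 1)
    · intro x hx
      obtain ⟨D, h, -⟩ := hHd x hx
      exact h.continuousAt.continuousWithinAt
    · intro x hx
      obtain ⟨D, h, -⟩ := hHd x (interior_subset hx)
      exact h.differentiableAt.differentiableWithinAt
    · intro x hx
      obtain ⟨D, h, h'⟩ := hHd x (interior_subset hx)
      rw [h.deriv]; exact h'
  have hl1 : Filter.Tendsto (fun x : ℝ => 1 - x) (nhdsWithin 1 (Set.Iio 1))
      (nhdsWithin 0 (Set.Ioi 0)) := by
    apply tendsto_nhdsWithin_of_tendsto_nhds_of_eventually_within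
    · have : ContinuousAt (fun x : ℝ => 1 - x) 1 := by fun_prop
      have h := this.tendsto.mono_left (nhdsWithin_le_nhds (s := Set.Iio 1))
      simpa using h
    · filter_upwards [self_mem_nhdsWithin] with x hx
      have : x < 1 := hx
      simp; exact this
  have hl2 := Real.tendsto_log_nhdsGT_zero.comp hl1
  set M := f b - d / 16 * Real.log (1 - b) with hM
  have hl3 := hl2.eventually_lt_atBot (-(16 / d) * |M|)
  have hIo : ∀ᶠ x in nhdsWithin (1:ℝ) (Set.Iio 1), x ∈ Set.Ioo b 1 :=
    Ioo_mem_nhdsLT hb1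
  obtain ⟨x, hx3, hxb, hxe⟩ := (hl3.and (hIo.and hev)).exists
  have h4 := hH (Set.left_mem_Ico.2 hb1) ⟨hxb.1.le, hxb.2⟩ hxb.1.le
  simp only [Function.comp] at hx3
  have h5 : d / 16 * Real.log (1 - x) < d / 16 * (-(16 / d) * |M|) :=
    mul_lt_mul_of_pos_left hx3 (by positivity)
  have h6 : d / 16 * (-(16 / d) * |M|) = - |M| := by field_simp
  have h7 := le_abs_self M
  simp only [← hM] at h4
  linarith [hxe.2.1]

/-- The tangent-line value at the endpoint: `p ((1+z)/2)^{p−1} ≥ 1` (real power),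
where `z` is the largest zero of the bounded Legendre solution. -/
theorem tangent_value_ge_one (p : ℝ) (hp : 2 < p) (f : ℝ → ℝ) (z : ℝ)
    (hf : IsBddLegendreSol p f) (hz : IsLargestZero f z) :
    1 ≤ p * ((1 + z) / 2) ^ (p - 1) := by
  have h1 := zero_ge p hp f z hf hz
  have h2 := num_ineq p hp
  have ha : 0 < 2 * p - 1 := by linarith
  have hb : 0 < 2 * p + 2 := by linarith
  have h3 : (2 * p - 1) / (2 * p + 2) ≤ (1 + z) / 2 := by
    have : (2 * p - 1) / (2 * p + 2) = (1 + (p - 2) / (p + 1)) / 2 := by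
      have : p + 1 ≠ 0 := by linarith
      field_simp
      ring
    linarith
  have h4 : ((2 * p - 1) / (2 * p + 2)) ^ (p - 1) ≤ ((1 + z) / 2) ^ (p - 1) :=
    Real.rpow_le_rpow (by positivity) h3 (by linarith)
  have h5 : 1 ≤ p * ((2 * p - 1) / (2 * p + 2)) ^ (p - 1) := by
    have hp0 : 0 < p := by linarith
    have hq : 0 < ((2 * p - 1) / (2 * p + 2)) ^ (p - 1) := by positivity
    rw [← Real.log_nonneg_iff (by positivity), Real.log_mul hp0.ne' hq.ne',
      Real.log_rpow (by positivity), Real.log_div ha.ne' hb.ne']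
    exact h2
  have := mul_le_mul_of_nonneg_left h4 (show 0 ≤ p by linarith)
  linarith
end

section
/- For every real number p ≥ 2, p^p ≥ (p+2)^{p−1} (real powers), with equality if and only if p = 2. Equivalently, (p/(p+2))^{p−1} ≥ 1/p for p ≥ 2. -/
theorem pow_ineq_aux (p : ℝ) (hp : 2 < p) : Real.log (p + 2) - Real.log p < 3 / (p + 2) := by
  have h0 : 0 < p := by linarith
  have hx : 1 < (p + 2) / p := by rw [lt_div_iff₀ h0]; linarith
  have h1 : Real.log ((p + 2) / p) < Real.sinh (Real.log ((p + 2) / p)) :=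
    Real.self_lt_sinh_iff.2 (Real.log_pos hx)
  rw [Real.sinh_log (by positivity), Real.log_div (by positivity) (by positivity)] at h1
  refine h1.trans_le ?_
  have : ((p + 2) / p - ((p + 2) / p)⁻¹) / 2 = (2 * p + 2) / p / (p + 2) := by
    field_simp
    ring
  rw [this]
  gcongr
  rw [div_le_iff₀ h0]
  linarith

theorem pow_ineq_mono :
    StrictMonoOn (fun p : ℝ => p * Real.log p - (p - 1) * Real.log (p + 2)) (Set.Ici 2) := by
  have hd : ∀ p : ℝ, 2 ≤ p → HasDerivAt
      (fun p : ℝ => p * Real.log p - (p - 1) * Real.log (p + 2))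
      ((1 * Real.log p + p * p⁻¹) - (1 * Real.log (p + 2) + (p - 1) * (1 / (p + 2)))) p := by
    intro p hp
    have h1 := (hasDerivAt_id p).mul (Real.hasDerivAt_log (x := p) (by linarith))
    have h2 := ((hasDerivAt_id p).sub_const 1).mul
      (((hasDerivAt_id p).add_const 2).log (by simp only [id]; linarith))
    exact h1.sub h2
  apply strictMonoOn_of_deriv_pos (convex_Ici 2)
  · intro p hp
    exact (hd p hp).continuousAt.continuousWithinAt
  · intro p hp
    rw [interior_Ici] at hp
    have hp : 2 < p := hp
    rw [(hd p hp.le).deriv]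
    have h := pow_ineq_aux p hp
    have e1 : p * p⁻¹ = 1 := mul_inv_cancel₀ (by linarith)
    have h3 : p + 2 ≠ 0 := by linarith
    have e2 : (p - 1) * (1 / (p + 2)) = 1 - 3 / (p + 2) := by field_simp; ring
    rw [e1, e2]
    linarith

/-- Elementary inequality: for real `p ≥ 2`, `p^p ≥ (p+2)^{p−1}` (real powers), with
equality iff `p = 2`; equivalently `(p/(p+2))^{p−1} ≥ 1/p`. -/
theorem pow_ineq (p : ℝ) (hp : 2 ≤ p) :
    (p + 2) ^ (p - 1) ≤ p ^ p ∧
    (p ^ p = (p + 2) ^ (p - 1) ↔ p = 2) ∧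
    1 / p ≤ (p / (p + 2)) ^ (p - 1) := by
  have h0 : 0 < p := by linarith
  have h2 : 0 < p + 2 := by linarith
  have e : ((2:ℝ) + 2) ^ ((2:ℝ) - 1) = 2 ^ (2:ℝ) := by
    rw [show (2:ℝ) - 1 = 1 by norm_num, Real.rpow_one, Real.rpow_two]; norm_num
  have key : 2 < p → (p + 2) ^ (p - 1) < p ^ p := by
    intro h
    have hm := pow_ineq_mono (Set.mem_Ici.2 le_rfl) (Set.mem_Ici.2 hp) h
    have e' := congrArg Real.log e
    rw [Real.log_rpow (by norm_num), Real.log_rpow (by norm_num)] at e'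
    simp only [] at hm
    rw [← Real.log_lt_log_iff (by positivity) (by positivity), Real.log_rpow h2, Real.log_rpow h0]
    linarith
  have hle : (p + 2) ^ (p - 1) ≤ p ^ p := by
    rcases hp.eq_or_lt with h | h
    · rw [← h]; exact e.le
    · exact (key h).le
  refine ⟨hle, ⟨fun h => ?_, fun h => ?_⟩, ?_⟩
  · by_contra hne
    exact (key (lt_of_le_of_ne hp (Ne.symm hne))).ne' h
  · rw [h]; exact e.symm
  · rw [Real.div_rpow h0.le h2.le, div_le_div_iff₀ h0 (by positivity), one_mul,
      ← Real.rpow_add_one h0.ne']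
    simpa using hle
end

section
/- Let p > 2 be a real number, let f be a bounded Legendre solution of parameter p with largest zero z ∈ (−1,1), let c = (1+z)/(1−z), let h_c(s) = ((1+s)/2)^p − c^p·((1−s)/2)^p, let a = h_c'(z)/f'(z), and let ℓ(s) = h_c'(z)·(s − z) be the common tangent line at z. Then for every s ∈ (z, 1), h_c(s) ≤ ℓ(s) ≤ a·f(s): the tangent line separates the graph of h_c from the graph of a·f on (z, 1). -/
/-- The obstacle function `h_c(s) = ((1+s)/2)^p − c^p ((1−s)/2)^p` (real powers). -/
noncomputable def hc (p c : ℝ) (s : ℝ) : ℝ :=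
  ((1 + s) / 2) ^ p - c ^ p * ((1 - s) / 2) ^ p

open Set Filter Topology

lemma aux_mono {g g' : ℝ → ℝ} {a b : ℝ} (hg : ∀ x ∈ Ico a b, HasDerivAt g (g' x) x)
    (h0 : ∀ x ∈ Ioo a b, 0 ≤ g' x) : MonotoneOn g (Ico a b) := by
  apply monotoneOn_of_hasDerivWithinAt_nonneg (f' := g') (convex_Ico a b)
  · intro x hx
    exact (hg x hx).continuousAt.continuousWithinAt
  · intro x hx
    rw [interior_Ico] at hx
    exact (hg x ⟨hx.1.le, hx.2⟩).hasDerivWithinAt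
  · intro x hx
    rw [interior_Ico] at hx
    exact h0 x hx

lemma aux_anti {g g' : ℝ → ℝ} {a b : ℝ} (hg : ∀ x ∈ Ico a b, HasDerivAt g (g' x) x)
    (h0 : ∀ x ∈ Ioo a b, g' x ≤ 0) : AntitoneOn g (Ico a b) := by
  apply antitoneOn_of_hasDerivWithinAt_nonpos (f' := g') (convex_Ico a b)
  · intro x hx
    exact (hg x hx).continuousAt.continuousWithinAt
  · intro x hx
    rw [interior_Ico] at hx
    exact (hg x ⟨hx.1.le, hx.2⟩).hasDerivWithinAt
  · intro x hx
    rw [interior_Ico] at hx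
    exact h0 x hx

lemma aux_ev {a : ℝ} (ha : a < 1) : ∀ᶠ x in 𝓝[<] (1:ℝ), x ∈ Ioo a 1 :=
  Ioo_mem_nhdsLT ha

/-- antitone with limit 0 implies nonneg -/
lemma aux_lim_anti {g : ℝ → ℝ} {a l : ℝ} (ha : a < 1) (hg : AntitoneOn g (Ico a 1))
    (hl : Tendsto g (𝓝[<] (1:ℝ)) (𝓝 l)) : l ≤ g a := by
  refine le_of_tendsto hl ?_
  filter_upwards [aux_ev ha] with x hx
  exact hg ⟨le_rfl, ha⟩ ⟨hx.1.le, hx.2⟩ hx.1.le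

lemma aux_lim_mono {g : ℝ → ℝ} {a l : ℝ} (ha : a < 1) (hg : MonotoneOn g (Ico a 1))
    (hl : Tendsto g (𝓝[<] (1:ℝ)) (𝓝 l)) : g a ≤ l := by
  refine ge_of_tendsto hl ?_
  filter_upwards [aux_ev ha] with x hx
  exact hg ⟨le_rfl, ha⟩ ⟨hx.1.le, hx.2⟩ hx.1.le

lemma aux_blow {g g' : ℝ → ℝ} {a l δ : ℝ} (ha : -1 < a) (ha1 : a < 1) (hδ : 0 < δ)
    (hg : ∀ x ∈ Ico a 1, HasDerivAt g (g' x) x)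
    (h0 : ∀ x ∈ Ioo a 1, δ ≤ (1 - x ^ 2) * g' x)
    (hl : Tendsto g (𝓝[<] (1:ℝ)) (𝓝 l)) : False := by
  have hm : MonotoneOn (fun x => g x + δ / 2 * Real.log (1 - x)) (Ico a 1) := by
    refine aux_mono (g' := fun x => g' x + δ / 2 * (-1 / (1 - x))) ?_ ?_
    · intro x hx
      have h1 : HasDerivAt (fun x : ℝ => 1 - x) (-1) x := by
        simpa using (hasDerivAt_id x).const_sub 1
      have h2 := (h1.log (by linarith [hx.2])).const_mul (δ / 2)
      exact (hg x hx).add h2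
    · intro x hx
      have hx1 : 0 < 1 - x := by linarith [hx.2]
      have hx2 : 0 < 1 + x := by linarith [hx.1]
      have h := h0 x hx
      have h3 : δ / ((1 - x) * (1 + x)) ≤ g' x := by
        rw [div_le_iff₀ (by positivity)]
        nlinarith
      have h4 : δ / 2 * (1 / (1 - x)) ≤ δ / ((1 - x) * (1 + x)) := by
        rw [div_mul_div_comm, mul_one, div_le_div_iff₀ (by positivity) (by positivity)]
        have : 0 ≤ δ * (1 - x) * (1 - x) := by positivity
        nlinarith
      have h5 : (-1 : ℝ) / (1 - x) = - (1 / (1 - x)) := by ring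
      simp only [h5]
      linarith
  have hlog : Tendsto (fun x : ℝ => Real.log (1 - x)) (𝓝[<] (1:ℝ)) atBot := by
    apply Real.tendsto_log_nhdsGT_zero.comp
    apply tendsto_nhdsWithin_of_tendsto_nhds_of_eventually_within
    · have : Tendsto (fun x : ℝ => 1 - x) (𝓝 1) (𝓝 (1 - 1)) :=
        (continuous_const.sub continuous_id).tendsto 1
      rw [sub_self] at this
      exact this.mono_left nhdsWithin_le_nhds
    · filter_upwards [self_mem_nhdsWithin] with x hx
      simp only [mem_Iio] at hx
      simp only [mem_Ioi]; linarith
  have hat : Tendsto (fun x : ℝ => (g a + δ / 2 * Real.log (1 - a)) + -(δ / 2) * Real.log (1 - x))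
      (𝓝[<] (1:ℝ)) atTop :=
    tendsto_atTop_add_const_left _ _ (hlog.const_mul_atBot_of_neg (by linarith))
  refine not_tendsto_nhds_of_tendsto_atTop (tendsto_atTop_mono' _ ?_ hat) l hl
  filter_upwards [aux_ev ha1] with x hx
  have := hm ⟨le_rfl, ha1⟩ ⟨hx.1.le, hx.2⟩ hx.1.le
  try simp only at this
  linarith

lemma aux_log_ineq {w : ℝ} (h1 : 1 ≤ w) (h2 : w ≤ 2) : Real.log w ≤ 3 * (w - 1) / (2 * w) := by
  set r := Real.sqrt w with hr
  have hw : w = r ^ 2 := (Real.sq_sqrt (by linarith)).symm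
  have hr1 : 1 ≤ r := by rw [hr]; exact Real.one_le_sqrt.mpr h1
  have hr2 : r ≤ 3 / 2 := by nlinarith
  have hlog : Real.log w = 2 * Real.log r := by rw [hw, Real.log_pow]; norm_num
  have hs : Real.log r ≤ (r - r⁻¹) / 2 := by
    rw [← Real.sinh_log (by linarith)]
    exact Real.self_le_sinh_iff.mpr (Real.log_nonneg hr1)
  rw [hlog, hw, le_div_iff₀ (by positivity)]
  have h3 : r⁻¹ * r = 1 := inv_mul_cancel₀ (by linarith)
  have h4 : (r - r⁻¹) * (2 * r ^ 2) = 2 * r * (r ^ 2 - 1) := by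
    linear_combination (-2 * r) * h3
  have h5 : 2 * Real.log r * (2 * r ^ 2) ≤ (r - r⁻¹) * (2 * r ^ 2) := by
    apply mul_le_mul_of_nonneg_right _ (by positivity)
    linarith
  have h6 : 0 ≤ (r ^ 2 - 1) := by nlinarith
  nlinarith

lemma aux_psi {p : ℝ} (hp : 2 ≤ p) : (p - 1) * Real.log (p + 2) ≤ p * Real.log p := by
  have hm : MonotoneOn (fun x => x * Real.log x - (x - 1) * Real.log (x + 2)) (Ico 2 (p + 1)) := by
    refine aux_mono (g' := fun x => (1 * Real.log x + x * (1 / x)) -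
        (1 * Real.log (x + 2) + (x - 1) * (1 / (x + 2)))) ?_ ?_
    · intro x hx
      have hx0 : 0 < x := by linarith [hx.1]
      have e1 := (hasDerivAt_id x).mul ((hasDerivAt_id x).log (by simp; linarith))
      have e2 := ((hasDerivAt_id x).sub_const 1).mul
        (((hasDerivAt_id x).add_const 2).log (by simp; linarith))
      exact e1.sub e2
    · intro x hx
      have hx0 : 2 < x := hx.1
      have hl := aux_log_ineq (w := (x + 2) / x)
        (by rw [le_div_iff₀ (by linarith)]; linarith) (by rw [div_le_iff₀ (by linarith)]; linarith)
      rw [Real.log_div (by linarith) (by linarith)] at hl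
      have e : 3 * ((x + 2) / x - 1) / (2 * ((x + 2) / x)) = 3 / (x + 2) := by
        field_simp; ring
      rw [e] at hl
      have e2 : (x - 1) * (1 / (x + 2)) = 1 - 3 / (x + 2) := by field_simp; ring
      have e3 : x * (1 / x) = 1 := by field_simp
      simp only [e2, e3]
      linarith
  have := hm (a := 2) (b := p) ⟨le_rfl, by linarith⟩ ⟨hp, by linarith⟩ hp
  try simp only at this
  have h4 : Real.log (2 + 2) = 2 * Real.log 2 := by
    rw [show (2:ℝ) + 2 = 2 ^ 2 by norm_num, Real.log_pow]; norm_num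
  rw [h4] at this
  linarith

lemma aux_pow {p u : ℝ} (hp : 2 ≤ p) (hu : p / (p + 2) ≤ u) : 1 ≤ p * u ^ (p - 1) := by
  have h0 : 0 < p / (p + 2) := by positivity
  have h1 : (p / (p + 2)) ^ (p - 1) ≤ u ^ (p - 1) :=
    Real.rpow_le_rpow h0.le hu (by linarith)
  have h2 : 1 ≤ p * (p / (p + 2)) ^ (p - 1) := by
    rw [← Real.log_nonneg_iff (by positivity), Real.log_mul (by positivity) (by positivity),
      Real.log_rpow h0, Real.log_div (by positivity) (by positivity)]
    have := aux_psi hp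
    nlinarith
  nlinarith

lemma aux_conv {G G' G'' : ℝ → ℝ} {a b : ℝ}
    (h1 : ∀ x ∈ Icc a b, HasDerivAt G (G' x) x)
    (h2 : ∀ x ∈ Icc a b, HasDerivAt G' (G'' x) x)
    (h3 : AntitoneOn G'' (Icc a b)) (ha : G a = 0) (ha' : G' a = 0) (hb : 0 ≤ G b) :
    ∀ s ∈ Ioo a b, 0 ≤ G s := by
  intro s hs
  by_contra! hneg
  obtain ⟨ξ, hξ, e1⟩ := exists_hasDerivAt_eq_slope G G' hs.1
    (fun x hx => (h1 x ⟨hx.1, hx.2.trans hs.2.le⟩).continuousAt.continuousWithinAt)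
    (fun x hx => h1 x ⟨hx.1.le, hx.2.le.trans hs.2.le⟩)
  have e1' : G' ξ < 0 := by
    rw [e1, ha]; exact div_neg_of_neg_of_pos (by linarith) (by linarith [hs.1])
  obtain ⟨η, hη, e2⟩ := exists_hasDerivAt_eq_slope G' G'' hξ.1
    (fun x hx => (h2 x ⟨hx.1, by linarith [hx.2, hξ.2, hs.2]⟩).continuousAt.continuousWithinAt)
    (fun x hx => h2 x ⟨hx.1.le, by linarith [hx.2, hξ.2, hs.2]⟩)
  have e2' : G'' η < 0 := by
    rw [e2, ha']; exact div_neg_of_neg_of_pos (by linarith) (by linarith [hξ.1])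
  obtain ⟨ζ, hζ, e3⟩ := exists_hasDerivAt_eq_slope G G' hs.2
    (fun x hx => (h1 x ⟨by linarith [hx.1, hs.1], hx.2⟩).continuousAt.continuousWithinAt)
    (fun x hx => h1 x ⟨by linarith [hx.1, hs.1], hx.2.le⟩)
  have e3' : 0 < G' ζ := by
    rw [e3]; exact div_pos (by linarith) (by linarith [hs.2])
  have hξζ : ξ < ζ := hξ.2.trans hζ.1
  obtain ⟨θ, hθ, e4⟩ := exists_hasDerivAt_eq_slope G' G'' hξζ
    (fun x hx => (h2 x ⟨by linarith [hx.1, hξ.1], by linarith [hx.2, hζ.2]⟩).continuousAt.continuousWithinAt)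
    (fun x hx => h2 x ⟨by linarith [hx.1, hξ.1], by linarith [hx.2, hζ.2]⟩)
  have e4' : 0 < G'' θ := by
    rw [e4]; exact div_pos (by linarith) (by linarith)
  have := h3 (a := η) (b := θ) ⟨hη.1.le, by linarith [hη.2, hξ.2, hs.2]⟩
    ⟨by linarith [hθ.1, hξ.1], by linarith [hθ.2, hζ.2]⟩ (by linarith [hη.2, hθ.1])
  linarith

lemma aux_d1 {q x : ℝ} (hq : 1 ≤ q) :
    HasDerivAt (fun s : ℝ => ((1 + s) / 2) ^ q) (q / 2 * ((1 + x) / 2) ^ (q - 1)) x := by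
  have h : HasDerivAt (fun s : ℝ => (1 + s) / 2) (1 / 2) x :=
    ((hasDerivAt_id x).const_add 1).div_const 2
  convert h.rpow_const (p := q) (Or.inr hq) using 1
  ring

lemma aux_d2 {q x : ℝ} (hq : 1 ≤ q) :
    HasDerivAt (fun s : ℝ => ((1 - s) / 2) ^ q) (-(q / 2 * ((1 - x) / 2) ^ (q - 1))) x := by
  have h : HasDerivAt (fun s : ℝ => (1 - s) / 2) (-1 / 2) x :=
    ((hasDerivAt_id x).const_sub 1).div_const 2
  convert h.rpow_const (p := q) (Or.inr hq) using 1
  ring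

lemma aux_hc_deriv {p c x : ℝ} (hp : 2 < p) : HasDerivAt (hc p c)
    (p / 2 * ((1 + x) / 2) ^ (p - 1) + c ^ p * (p / 2 * ((1 - x) / 2) ^ (p - 1))) x := by
  have := (aux_d1 (q := p) (x := x) (by linarith)).sub
    ((aux_d2 (q := p) (x := x) (by linarith)).const_mul (c ^ p))
  refine HasDerivAt.congr_deriv (this) ?_
  ring

lemma aux_hc_z {p z : ℝ} (hp : 2 < p) (hz : z ∈ Ioo (-1:ℝ) 1) :
    deriv (hc p ((1 + z) / (1 - z))) z * (1 - z) = p * ((1 + z) / 2) ^ (p - 1) := by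
  have hu : 0 < (1 + z) / 2 := by linarith [hz.1]
  have hv : 0 < (1 - z) / 2 := by linarith [hz.2]
  have hv' : 0 < 1 - z := by linarith [hz.2]
  rw [(aux_hc_deriv hp).deriv]
  have hc : (1 + z) / (1 - z) = ((1 + z) / 2) / ((1 - z) / 2) := by field_simp
  rw [hc, Real.div_rpow hu.le hv.le, Real.rpow_sub_one hu.ne', Real.rpow_sub_one hv.ne']
  have := (Real.rpow_pos_of_pos hv p).ne'
  have h1 : 1 + z ≠ 0 := by linarith
  field_simp
  ring

lemma aux_hc_le {p z : ℝ} (hp : 2 < p) (hz : z ∈ Ioo (-1:ℝ) 1)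
    (hz0 : (p - 2) / (p + 2) ≤ z) : ∀ s ∈ Ioo z (1 : ℝ),
      hc p ((1 + z) / (1 - z)) s ≤ deriv (hc p ((1 + z) / (1 - z))) z * (s - z) := by
  have hkey := aux_hc_z hp hz
  have hu : 0 < (1 + z) / 2 := by linarith [hz.1]
  have hv : 0 < (1 - z) / 2 := by linarith [hz.2]
  have hv' : 0 < 1 - z := by linarith [hz.2]
  have hu' : 0 < 1 + z := by linarith [hz.1]
  set c := (1 + z) / (1 - z) with hcdef
  have hcp : 0 < c := by positivity
  set m := deriv (hc p c) z with hm
  intro s hs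
  have := aux_conv (a := z) (b := 1) (G := fun s => m * (s - z) - hc p c s)
    (G' := fun x => m - (p / 2 * ((1 + x) / 2) ^ (p - 1) + c ^ p * (p / 2 * ((1 - x) / 2) ^ (p - 1))))
    (G'' := fun x => -(p / 2 * ((p - 1) / 2 * ((1 + x) / 2) ^ (p - 1 - 1)) +
      c ^ p * (p / 2 * -((p - 1) / 2 * ((1 - x) / 2) ^ (p - 1 - 1)))))
    ?_ ?_ ?_ ?_ ?_ ?_ s hs
  · linarith
  · intro x _
    have h := (((hasDerivAt_id x).sub_const z).const_mul m).sub (aux_hc_deriv (p := p) (c := c) (x := x) hp)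
    rw [mul_one] at h
    exact h
  · intro x _
    have a1 := (aux_d1 (q := p - 1) (x := x) (by linarith)).const_mul (p / 2)
    have a2 := ((aux_d2 (q := p - 1) (x := x) (by linarith)).const_mul (p / 2)).const_mul (c ^ p)
    exact (a1.add a2).const_sub m
  · intro x hx y hy hxy
    have b1 : ((1 + x) / 2) ^ (p - 1 - 1) ≤ ((1 + y) / 2) ^ (p - 1 - 1) :=
      Real.rpow_le_rpow (by linarith [hx.1]) (by linarith) (by linarith)
    have b2 : ((1 - y) / 2) ^ (p - 1 - 1) ≤ ((1 - x) / 2) ^ (p - 1 - 1) :=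
      Real.rpow_le_rpow (by linarith [hy.2]) (by linarith) (by linarith)
    have k1 : 0 ≤ p / 2 * ((p - 1) / 2) := by nlinarith
    have k2 : 0 ≤ c ^ p * (p / 2 * ((p - 1) / 2)) := mul_nonneg (Real.rpow_nonneg hcp.le _) k1
    have c1 := mul_le_mul_of_nonneg_left b1 k1
    have c2 := mul_le_mul_of_nonneg_left b2 k2
    try simp only
    linarith
  · simp only [hc, sub_self, mul_zero]
    have e : c * ((1 - z) / 2) = (1 + z) / 2 := by rw [hcdef]; field_simp
    rw [← Real.mul_rpow hcp.le hv.le, e]; ring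
  · try simp only
    rw [hm, (aux_hc_deriv hp).deriv]; ring
  · have e : hc p c 1 = 1 := by
      simp only [hc]; norm_num
      right; exact Real.zero_rpow (by linarith)
    try simp only
    rw [e, hkey]
    have : p / (p + 2) ≤ (1 + z) / 2 := by
      have : p / (p + 2) = (1 + (p - 2) / (p + 2)) / 2 := by field_simp; ring
      rw [this]; linarith
    linarith [aux_pow hp.le this]

/-- The common tangent line `ℓ(s) = h_c'(z)(s−z)` at the largest zero `z` separates the
graph of the obstacle `h_c` (with `c = (1+z)/(1−z)`) from the graph of `a·f` on `(z,1)`,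
where `a = h_c'(z)/f'(z)`. -/
theorem tangent_separates (p : ℝ) (hp : 2 < p) (f : ℝ → ℝ) (z : ℝ)
    (hf : IsBddLegendreSol p f) (hz : IsLargestZero f z) :
    ∀ s ∈ Set.Ioo z (1 : ℝ),
      hc p ((1 + z) / (1 - z)) s ≤ deriv (hc p ((1 + z) / (1 - z))) z * (s - z) ∧
      deriv (hc p ((1 + z) / (1 - z))) z * (s - z) ≤
        (deriv (hc p ((1 + z) / (1 - z))) z / deriv f z) * f s := by
  obtain ⟨hC, hode, hlim⟩ := hf
  obtain ⟨hzI, hfz, hpos⟩ := hz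
  have hz1 := hzI.1
  have hz2 := hzI.2
  have hd1 : ∀ x ∈ Ioo (-1:ℝ) 1, HasDerivAt f (deriv f x) x := fun x hx =>
    ((hC.differentiableOn (by norm_num)).differentiableAt (isOpen_Ioo.mem_nhds hx)).hasDerivAt
  have hd2 : ∀ x ∈ Ioo (-1:ℝ) 1, HasDerivAt (deriv f) (deriv (deriv f) x) x := by
    intro x hx
    have h := ((contDiffOn_succ_iff_deriv_of_isOpen (n := 1) isOpen_Ioo).1
      (by simpa [one_add_one_eq_two] using hC)).2.2
    exact ((h.differentiableOn (by norm_num)).differentiableAt (isOpen_Ioo.mem_nhds hx)).hasDerivAt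
  set F : ℝ → ℝ := fun x => (1 - x ^ 2) * deriv f x with hF
  have hdq : ∀ x : ℝ, HasDerivAt (fun x : ℝ => 1 - x ^ 2) (-(2 * x)) x := by
    intro x
    simpa using ((hasDerivAt_id x).pow 2).const_sub 1
  have hFd : ∀ x ∈ Ioo (-1:ℝ) 1, HasDerivAt F (-(p * f x)) x := by
    intro x hx
    refine HasDerivAt.congr_deriv ((hdq x).mul (hd2 x hx)) ?_
    linarith [hode x hx]
  have hsub : ∀ x ∈ Ico z 1, x ∈ Ioo (-1:ℝ) 1 := fun x hx => ⟨by linarith [hx.1], hx.2⟩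
  have hFanti : AntitoneOn F (Ico z 1) := by
    refine aux_anti (fun x hx => hFd x (hsub x hx)) ?_
    intro x hx
    have := hpos x hx
    nlinarith
  have hFnn : ∀ x ∈ Ico z 1, 0 ≤ F x := by
    intro x hx
    by_contra! hneg
    refine aux_blow (g := fun y => - f y) (g' := fun y => - deriv f y) (a := x) (δ := - F x)
      (l := -1) (hsub x hx).1 hx.2 (by linarith) ?_ ?_ hlim.neg
    · intro y hy
      exact (hd1 y (hsub y ⟨hx.1.trans hy.1, hy.2⟩)).neg
    · intro y hy
      have := hFanti hx ⟨hx.1.trans hy.1.le, hy.2⟩ hy.1.le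
      simp only [hF] at this ⊢
      linarith
  have hev2 : ∀ᶠ x in 𝓝[<] (1:ℝ), f x < 2 := hlim.eventually_lt_const (by norm_num)
  obtain ⟨x1, hx1, hx1f⟩ : ∃ x1 ∈ Ico z 1, ∀ x ∈ Ioo x1 1, f x < 2 := by
    obtain ⟨l, hl, hl'⟩ := (mem_nhdsLT_iff_exists_Ioo_subset' (show z < 1 from hz2)).1 hev2
    refine ⟨max l z, ⟨le_max_right _ _, max_lt hl hz2⟩, ?_⟩
    intro x hx
    exact hl' ⟨(le_max_left _ _).trans_lt hx.1, hx.2⟩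
  have hFmono : MonotoneOn (fun x => F x + 2 * p * x) (Ico x1 1) := by
    refine aux_mono (g' := fun x => -(p * f x) + 2 * p * 1) ?_ ?_
    · intro x hx
      exact (hFd x (hsub x ⟨hx1.1.trans hx.1, hx.2⟩)).add ((hasDerivAt_id x).const_mul (2 * p))
    · intro x hx
      have := hx1f x hx
      nlinarith
  have hFub : ∀ x ∈ Ioo x1 1, F x ≤ 2 * p * (1 - x) := by
    intro x hx
    by_contra! hneg
    have hxI : x ∈ Ico z 1 := ⟨hx1.1.trans hx.1.le, hx.2⟩
    refine aux_blow (g := f) (g' := deriv f) (a := x) (δ := F x - 2 * p * (1 - x))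
      (l := 1) (hsub x hxI).1 hx.2 (by linarith) ?_ ?_ hlim
    · intro y hy
      exact hd1 y (hsub y ⟨hxI.1.trans hy.1, hy.2⟩)
    · intro y hy
      have := hFmono ⟨hx.1.le, hx.2⟩ ⟨hx.1.le.trans hy.1.le, hy.2⟩ hy.1.le
      try simp only at this
      have h2 : F y = (1 - y ^ 2) * deriv f y := rfl
      rw [← h2]
      have : 0 ≤ p * (1 - y) := mul_nonneg (by linarith) (by linarith [hy.2])
      linarith
  have hid : Tendsto (fun x : ℝ => x) (𝓝[<] (1:ℝ)) (𝓝 1) := tendsto_id.mono_left nhdsWithin_le_nhds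
  have hF0 : Tendsto F (𝓝[<] (1:ℝ)) (𝓝 0) := by
    have hup : Tendsto (fun x : ℝ => 2 * p * (1 - x)) (𝓝[<] (1:ℝ)) (𝓝 0) := by
      simpa using (hid.const_sub 1).const_mul (2 * p)
    refine tendsto_of_tendsto_of_tendsto_of_le_of_le' tendsto_const_nhds hup ?_ ?_
    · filter_upwards [aux_ev hz2] with x hx using hFnn x ⟨hx.1.le, hx.2⟩
    · filter_upwards [aux_ev hx1.2] with x hx using hFub x hx
  have hq0 : Tendsto (fun x : ℝ => 1 - x ^ 2) (𝓝[<] (1:ℝ)) (𝓝 0) := by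
    simpa using (hid.pow 2).const_sub 1
  -- strict positivity of f'(z)
  have hFz : 0 < F z := by
    by_contra! hneg
    have h0 : ∀ x ∈ Ico z 1, F x = 0 := fun x hx =>
      le_antisymm ((hFanti ⟨le_rfl, hz2⟩ hx hx.1).trans hneg) (hFnn x hx)
    set y := (z + 1) / 2 with hy
    have hyI : y ∈ Ioo z 1 := ⟨by linarith, by linarith⟩
    have e1 : HasDerivAt F 0 y := by
      refine (hasDerivAt_const y (0:ℝ)).congr_of_eventuallyEq ?_
      filter_upwards [isOpen_Ioo.mem_nhds hyI] with x hx using h0 x ⟨hx.1.le, hx.2⟩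
    have e2 := e1.unique (hFd y (hsub y ⟨hyI.1.le, hyI.2⟩))
    have := hpos y hyI
    nlinarith
  have hqz : 0 < 1 - z ^ 2 := by nlinarith
  have hfz' : 0 < deriv f z := by
    have : 0 < (1 - z ^ 2) * deriv f z := hFz
    exact (pos_iff_pos_of_mul_pos this).1 hqz
  -- second derivative
  have hw : AntitoneOn (fun x => 2 * x * F x - p * ((1 - x ^ 2) * f x)) (Ico z 1) := by
    refine aux_anti (g' := fun x => -((p - 2) * F x)) ?_ ?_
    · intro x hx
      have a1 := ((hasDerivAt_id x).const_mul 2).mul (hFd x (hsub x hx))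
      have a2 := ((hdq x).mul (hd1 x (hsub x hx))).const_mul p
      refine HasDerivAt.congr_deriv (a1.sub a2) ?_
      simp only [hF, id]
      ring
    · intro x hx
      have := hFnn x ⟨hx.1.le, hx.2⟩
      nlinarith
  have hw0 : Tendsto (fun x => 2 * x * F x - p * ((1 - x ^ 2) * f x)) (𝓝[<] (1:ℝ)) (𝓝 0) := by
    simpa using ((hid.const_mul 2).mul hF0).sub ((hq0.mul hlim).const_mul p)
  have hf2 : ∀ x ∈ Ico z 1, 0 ≤ deriv (deriv f) x := by
    intro x hx
    have h1 := aux_lim_anti hx.2 (hw.mono (Ico_subset_Ico_left hx.1)) hw0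
    have hxI := hsub x hx
    have hq : 0 < 1 - x ^ 2 := by nlinarith [hxI.1, hxI.2]
    have h2 : 2 * x * F x - p * ((1 - x ^ 2) * f x) = (1 - x ^ 2) * ((1 - x ^ 2) * deriv (deriv f) x) := by
      simp only [hF]
      linear_combination (-(1 - x ^ 2)) * hode x hxI
    try simp only at h1
    rw [h2] at h1
    exact nonneg_of_mul_nonneg_right (nonneg_of_mul_nonneg_right h1 hq) hq
  have hf'm : MonotoneOn (deriv f) (Ico z 1) :=
    aux_mono (fun x hx => hd2 x (hsub x hx)) (fun x hx => hf2 x ⟨hx.1.le, hx.2⟩)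
  have htan : ∀ s ∈ Ioo z 1, deriv f z * (s - z) ≤ f s := by
    intro s hs
    obtain ⟨ξ, hξ, e⟩ := exists_hasDerivAt_eq_slope f (deriv f) hs.1
      (fun x hx => (hd1 x (hsub x ⟨hx.1, hx.2.trans_lt hs.2⟩)).continuousAt.continuousWithinAt)
      (fun x hx => hd1 x (hsub x ⟨hx.1.le, hx.2.trans hs.2⟩))
    have h1 := hf'm ⟨le_rfl, hz2⟩ ⟨hξ.1.le, hξ.2.trans hs.2⟩ hξ.1.le
    rw [e, hfz, sub_zero, le_div_iff₀ (by linarith [hs.1])] at h1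
    exact h1
  -- lower bound for the zero
  have hzlow : (p - 2) / (p + 2) ≤ z := by
    by_contra! hlt
    set y := (p - 2) / (p + 2) with hy
    have hy0 : 0 < y := div_pos (by linarith) (by linarith)
    have hy1 : y < 1 := by rw [hy, div_lt_one (by linarith)]; linarith
    have hyp : y * (p + 2) = p - 2 := by rw [hy]; field_simp
    set q := (p ^ 2 - 4) / 4 with hq
    have hyz : Ico y 1 ⊆ Ico z 1 := Ico_subset_Ico_left hlt.le
    have hW : MonotoneOn (fun x => (1 - x ^ 2) * (p / 2 - q * ((1 - x) / 2)) * f x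
        - (1 - p * ((1 - x) / 2) + q * ((1 - x) / 2) ^ 2) * F x) (Ico y 1) := by
      refine aux_mono (g' := fun x => ((1 - x) / 2 * (p - 2) *
        (2 + (p - 6) * (p + 2) * ((1 - x) / 2) / 4)) * f x) ?_ ?_
      · intro x hx
        have ht : HasDerivAt (fun x : ℝ => (1 - x) / 2) (-1 / 2) x :=
          ((hasDerivAt_id x).const_sub 1).div_const 2
        have hxI := hsub x (hyz hx)
        have a1 := ((hdq x).mul ((ht.const_mul q).const_sub (p / 2))).mul (hd1 x hxI)
        have a2 := (((ht.const_mul p).const_sub 1).add ((ht.pow 2).const_mul q)).mul (hFd x hxI)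
        refine HasDerivAt.congr_deriv (a1.sub a2) ?_
        simp [hF, hq]
        ring
      · intro x hx
        have h1 := hpos x ⟨hlt.trans hx.1, hx.2⟩
        have h2 : 0 < 1 - x := by linarith [hx.2]
        have h3 : (p + 2) * (1 - x) ≤ 4 := by nlinarith [hx.1]
        have h4 : 0 ≤ 2 + (p - 6) * (p + 2) * ((1 - x) / 2) / 4 := by
          have h5 : 0 ≤ (p + 2) * (1 - x) := mul_nonneg (by linarith) h2.le
          nlinarith
        have h6 : 0 < p - 2 := by linarith
        positivity
    have hcont : Tendsto (fun x => (1 - x ^ 2) * (p / 2 - q * ((1 - x) / 2)) * f x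
        - (1 - p * ((1 - x) / 2) + q * ((1 - x) / 2) ^ 2) * F x) (𝓝[<] (1:ℝ)) (𝓝 0) := by
      have ht : Tendsto (fun x : ℝ => (1 - x) / 2) (𝓝[<] (1:ℝ)) (𝓝 0) := by
        simpa using (hid.const_sub 1).div_const 2
      have := ((hq0.mul ((ht.const_mul q).const_sub (p / 2))).mul hlim).sub
        ((((ht.const_mul p).const_sub 1).add ((ht.pow 2).const_mul q)).mul hF0)
      simpa using this
    have h := aux_lim_mono hy1 hW hcont
    try simp only at h
    have ht : (1 - y) / 2 = 2 / (p + 2) := by rw [hy]; field_simp; ring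
    have hphi : 1 - p * ((1 - y) / 2) + q * ((1 - y) / 2) ^ 2 = 0 := by
      rw [ht, hq]; field_simp; ring
    have hphi' : p / 2 - q * ((1 - y) / 2) = 1 := by
      rw [ht, hq]; field_simp; ring
    rw [hphi, hphi'] at h
    have := hpos y ⟨hlt, hy1⟩
    have h7 : 0 < 1 - y ^ 2 := by nlinarith
    nlinarith [mul_pos h7 this]
  intro s hs
  refine ⟨aux_hc_le hp hzI hzlow s hs, ?_⟩
  have hm : 0 ≤ deriv (hc p ((1 + z) / (1 - z))) z := by
    have h1 := aux_hc_z hp hzI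
    have h2 : 0 ≤ p * ((1 + z) / 2) ^ (p - 1) :=
      mul_nonneg (by linarith) (Real.rpow_nonneg (by linarith) _)
    rw [← h1] at h2
    exact nonneg_of_mul_nonneg_left h2 (by linarith)
  rw [div_mul_eq_mul_div, le_div_iff₀ hfz', mul_assoc]
  apply mul_le_mul_of_nonneg_left _ hm
  linarith [htan s hs]
end

section
/- Let p > 2 be a real number, let f be a bounded Legendre solution of parameter p with largest zero z ∈ (−1,1). Suppose c > 0, and suppose g is twice continuously differentiable on (−1,1), satisfies (1−x²)g''(x) − 2x·g'(x) + p·g(x) = 0 on (−1,1), and g(s) tends to a limit A > 1 as s → 1⁻. Suppose there exists x₀ ∈ (−1,1) such that g(s) > h_c(s) for all s ∈ (x₀, 1), g(x₀) = h_c(x₀), and g'(x₀) = h_c'(x₀). Then c ≥ (1+z)/(1−z). -/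
open Set Filter Topology

lemma tlb_reg (f : ℝ → ℝ) (hf : ContDiffOn ℝ 2 f (Ioo (-1 : ℝ) 1)) (x : ℝ)
    (hx : x ∈ Ioo (-1 : ℝ) 1) :
    HasDerivAt f (deriv f x) x ∧ HasDerivAt (deriv f) (deriv (deriv f) x) x := by
  have hm : Ioo (-1 : ℝ) 1 ∈ 𝓝 x := isOpen_Ioo.mem_nhds hx
  have h2 : ContDiffOn ℝ (1 + 1) f (Ioo (-1 : ℝ) 1) := by
    convert hf using 1; norm_num
  rw [contDiffOn_succ_iff_deriv_of_isOpen isOpen_Ioo] at h2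
  refine ⟨(h2.1.differentiableAt hm).hasDerivAt, ?_⟩
  exact ((h2.2.2.differentiableOn (by norm_num)).differentiableAt hm).hasDerivAt

lemma tlb_flux (p : ℝ) (u : ℝ → ℝ) (hu : ContDiffOn ℝ 2 u (Ioo (-1 : ℝ) 1))
    (hode : ∀ x ∈ Ioo (-1 : ℝ) 1,
      (1 - x ^ 2) * deriv (deriv u) x - 2 * x * deriv u x + p * u x = 0) (x : ℝ)
    (hx : x ∈ Ioo (-1 : ℝ) 1) :
    HasDerivAt (fun y => (1 - y ^ 2) * deriv u y) (-(p * u x)) x := by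
  have h1 : HasDerivAt (fun y : ℝ => 1 - y ^ 2) (-(2 * x)) x := by
    simpa using (hasDerivAt_pow 2 x).const_sub 1
  refine (h1.mul (tlb_reg u hu x hx).2).congr_deriv ?_
  linarith [hode x hx]

lemma tlb_mono (F G : ℝ → ℝ) (a b : ℝ) (hF : ∀ x ∈ Ico a b, HasDerivAt F (G x) x)
    (hG : ∀ x ∈ Ioo a b, 0 ≤ G x) : MonotoneOn F (Ico a b) := by
  refine monotoneOn_of_deriv_nonneg (convex_Ico a b)
    (fun x hx => (hF x hx).continuousAt.continuousWithinAt) ?_ ?_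
  · intro x hx
    rw [interior_Ico] at hx
    exact (hF x ⟨hx.1.le, hx.2⟩).differentiableAt.differentiableWithinAt
  · intro x hx
    rw [interior_Ico] at hx
    rw [(hF x ⟨hx.1.le, hx.2⟩).deriv]
    exact hG x hx

lemma tlb_smono (F G : ℝ → ℝ) (a b : ℝ) (hF : ∀ x ∈ Ico a b, HasDerivAt F (G x) x)
    (hG : ∀ x ∈ Ioo a b, 0 < G x) : StrictMonoOn F (Ico a b) := by
  refine strictMonoOn_of_deriv_pos (convex_Ico a b)
    (fun x hx => (hF x hx).continuousAt.continuousWithinAt) ?_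
  · intro x hx
    rw [interior_Ico] at hx
    rw [(hF x ⟨hx.1.le, hx.2⟩).deriv]
    exact hG x hx

lemma tlb_ev (x : ℝ) (hx : x < 1) : ∀ᶠ y in 𝓝[<] (1 : ℝ), y ∈ Ioo x 1 := Ioo_mem_nhdsLT hx

lemma tlb_half (p : ℝ) (hp : 0 < p) (u : ℝ → ℝ) (l : ℝ)
    (hu : ContDiffOn ℝ 2 u (Ioo (-1 : ℝ) 1))
    (hode : ∀ x ∈ Ioo (-1 : ℝ) 1,
      (1 - x ^ 2) * deriv (deriv u) x - 2 * x * deriv u x + p * u x = 0)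
    (hl : Tendsto u (𝓝[<] 1) (𝓝 l)) (ε : ℝ) (hε : 0 < ε) :
    ∀ᶠ x in 𝓝[<] (1 : ℝ), (1 - x ^ 2) * deriv u x < ε := by
  set M : ℝ := |l| + 1 with hM
  have hMpos : 0 < M := by positivity
  have hub : ∀ᶠ x in 𝓝[<] (1 : ℝ), u x < M :=
    hl.eventually_lt_const (by linarith [le_abs_self l])
  obtain ⟨b, hb1, hb⟩ := (mem_nhdsLT_iff_exists_Ioo_subset).1 hub
  have hb1 : b < 1 := hb1
  set δ := ε / (2 * p * M) with hδ
  have hδ0 : 0 < δ := by positivity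
  filter_upwards [tlb_ev b hb1, tlb_ev 0 one_pos, tlb_ev (1 - δ) (by linarith)] with x hx hx0 hxd
  by_contra hcon
  push Not at hcon
  -- flux stays above ε/2
  have m1 : MonotoneOn (fun y => (1 - y ^ 2) * deriv u y + p * M * y) (Ico x 1) := by
    refine tlb_mono _ (fun y => -(p * u y) + p * M) x 1 ?_ ?_
    · intro y hy
      have := (tlb_flux p u hu hode y ⟨by linarith [hx0.1, hy.1], hy.2⟩).add
        ((hasDerivAt_id y).const_mul (p * M))
      exact this.congr_deriv (by ring)
    · intro y hy
      have : u y < M := hb ⟨by linarith [hx.1, hy.1], hy.2⟩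
      nlinarith
  have hpm : p * M * δ = ε / 2 := by rw [hδ]; field_simp
  have m2 : ∀ y ∈ Ico x 1, ε / 2 ≤ (1 - y ^ 2) * deriv u y := by
    intro y hy
    have h := m1 ⟨le_refl x, hx.2⟩ hy hy.1
    simp only at h
    have : p * M * (y - x) ≤ p * M * δ := by
      apply mul_le_mul_of_nonneg_left _ (by positivity)
      linarith [hy.2, hxd.1]
    nlinarith
  have m3 : MonotoneOn (fun y => u y + ε / 4 * Real.log (1 - y)) (Ico x 1) := by
    refine tlb_mono _ (fun y => deriv u y + ε / 4 * (-1 / (1 - y))) x 1 ?_ ?_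
    · intro y hy
      have h1 : HasDerivAt (fun y : ℝ => 1 - y) (-1) y := by
        simpa using (hasDerivAt_id y).const_sub 1
      exact (tlb_reg u hu y ⟨by linarith [hx0.1, hy.1], hy.2⟩).1.add
        ((h1.log (by linarith [hy.2])).const_mul (ε / 4))
    · intro y hy
      have h := m2 y ⟨hy.1.le, hy.2⟩
      have hy1 : 0 < 1 - y := by linarith [hy.2]
      have hy0 : 0 < y := by linarith [hx0.1, hy.1]
      have e : deriv u y + ε / 4 * (-1 / (1 - y)) =
        ((1 - y ^ 2) * deriv u y - ε / 4 * (1 + y)) / (1 - y ^ 2) := by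
        have : 1 - y ^ 2 ≠ 0 := by nlinarith
        field_simp
        ring
      rw [e]
      apply div_nonneg <;> nlinarith
  have hlog : Tendsto (fun y : ℝ => Real.log (1 - y)) (𝓝[<] 1) atBot := by
    refine Real.tendsto_log_nhdsGT_zero.comp ?_
    refine tendsto_nhdsWithin_iff.2 ⟨?_, ?_⟩
    · have : Tendsto (fun y : ℝ => 1 - y) (𝓝 1) (𝓝 (1 - 1)) := 
        tendsto_const_nhds.sub tendsto_id
      rw [sub_self] at this
      exact this.mono_left nhdsWithin_le_nhds
    · filter_upwards [self_mem_nhdsWithin] with y hy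
      have : y < 1 := hy
      simpa using this
  have hbot : Tendsto (fun y => u y + ε / 4 * Real.log (1 - y)) (𝓝[<] 1) atBot :=
    hl.add_atBot (hlog.const_mul_atBot (by positivity))
  obtain ⟨y, hy1, hy2⟩ := ((hbot.eventually_lt_atBot (u x + ε / 4 * Real.log (1 - x))).and
    (tlb_ev x hx.2)).exists
  have := m3 ⟨le_refl x, hx.2⟩ ⟨hy2.1.le, hy2.2⟩ hy2.1.le
  simp only at this
  linarith

lemma tlb_flux_lim (p : ℝ) (hp : 0 < p) (u : ℝ → ℝ) (l : ℝ)
    (hu : ContDiffOn ℝ 2 u (Ioo (-1 : ℝ) 1))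
    (hode : ∀ x ∈ Ioo (-1 : ℝ) 1,
      (1 - x ^ 2) * deriv (deriv u) x - 2 * x * deriv u x + p * u x = 0)
    (hl : Tendsto u (𝓝[<] 1) (𝓝 l)) :
    Tendsto (fun x => (1 - x ^ 2) * deriv u x) (𝓝[<] 1) (𝓝 0) := by
  rw [Metric.tendsto_nhds]
  intro ε hε
  have d1 : deriv (fun x => - u x) = fun x => - deriv u x := by
    ext x; exact deriv.fun_neg
  have d2 : deriv (fun x => - deriv u x) = fun x => - deriv (deriv u) x := by
    ext x; exact deriv.fun_neg
  have h2 := tlb_half p hp (fun x => - u x) (-l) hu.neg (by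
    intro x hx
    rw [d1, d2]
    linarith [hode x hx]) hl.neg ε hε
  rw [d1] at h2
  filter_upwards [tlb_half p hp u l hu hode hl ε hε, h2] with x h1 h2
  rw [Real.dist_eq, sub_zero, abs_lt]
  constructor <;> linarith

lemma tlb_wronsk (p : ℝ) (hp : 0 < p) (f g : ℝ → ℝ) (l m : ℝ)
    (hf : ContDiffOn ℝ 2 f (Ioo (-1 : ℝ) 1))
    (hof : ∀ x ∈ Ioo (-1 : ℝ) 1,
      (1 - x ^ 2) * deriv (deriv f) x - 2 * x * deriv f x + p * f x = 0)
    (hlf : Tendsto f (𝓝[<] 1) (𝓝 l))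
    (hg : ContDiffOn ℝ 2 g (Ioo (-1 : ℝ) 1))
    (hog : ∀ x ∈ Ioo (-1 : ℝ) 1,
      (1 - x ^ 2) * deriv (deriv g) x - 2 * x * deriv g x + p * g x = 0)
    (hlg : Tendsto g (𝓝[<] 1) (𝓝 m)) (x : ℝ) (hx : x ∈ Ioo (-1 : ℝ) 1) :
    f x * deriv g x - deriv f x * g x = 0 := by
  set W : ℝ → ℝ := fun y => f y * ((1 - y ^ 2) * deriv g y) - ((1 - y ^ 2) * deriv f y) * g y
    with hW
  have hd : ∀ y ∈ Ioo (-1 : ℝ) 1, HasDerivAt W 0 y := by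
    intro y hy
    refine (((tlb_reg f hf y hy).1.mul (tlb_flux p g hg hog y hy)).sub
      ((tlb_flux p f hf hof y hy).mul (tlb_reg g hg y hy).1)).congr_deriv ?_
    ring
  have hlim : Tendsto W (𝓝[<] 1) (𝓝 0) := by
    have := (hlf.mul (tlb_flux_lim p hp g m hg hog hlg)).sub
      ((tlb_flux_lim p hp f l hf hof hlf).mul hlg)
    simpa using this
  have hc : ∀ y ∈ Ioo x 1, W y = W x := by
    intro y hy
    have hs : ∀ t ∈ Ico x 1, t ∈ Ioo (-1 : ℝ) 1 := fun t ht => ⟨by linarith [ht.1, hx.1], ht.2⟩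
    have h1 := tlb_mono W (fun _ => 0) x 1 (fun t ht => hd t (hs t ht)) (fun _ _ => le_rfl)
      ⟨le_refl x, hx.2⟩ ⟨hy.1.le, hy.2⟩ hy.1.le
    have h2 := tlb_mono (fun t => - W t) (fun _ => 0) x 1
      (fun t ht => by simpa using (hd t (hs t ht)).fun_neg) (fun _ _ => le_rfl)
      ⟨le_refl x, hx.2⟩ ⟨hy.1.le, hy.2⟩ hy.1.le
    simp only at h2
    linarith
  have hc2 : Tendsto W (𝓝[<] 1) (𝓝 (W x)) := by
    refine tendsto_const_nhds.congr' ?_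
    filter_upwards [tlb_ev x hx.2] with y hy
    exact (hc y hy).symm
  have h0 : W x = 0 := tendsto_nhds_unique hc2 hlim
  have h1 : (1 - x ^ 2) * (f x * deriv g x - deriv f x * g x) = 0 := by
    rw [← h0, hW]; ring
  have h2 : 1 - x ^ 2 ≠ 0 := by nlinarith [hx.1, hx.2]
  exact (mul_eq_zero.1 h1).resolve_left h2

lemma tlb_pw (p : ℝ) (x : ℝ) (hx : x ∈ Ioo (-1 : ℝ) 1) :
    HasDerivAt (fun s : ℝ => ((1 + s) / 2) ^ p) (p / 2 * ((1 + x) / 2) ^ (p - 1)) x ∧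
    HasDerivAt (fun s : ℝ => ((1 - s) / 2) ^ p) (-(p / 2 * ((1 - x) / 2) ^ (p - 1))) x := by
  have h1 : HasDerivAt (fun s : ℝ => (1 + s) / 2) (1 / 2) x :=
    ((hasDerivAt_id x).const_add 1).div_const 2
  have h2 : HasDerivAt (fun s : ℝ => (1 - s) / 2) (-1 / 2) x :=
    ((hasDerivAt_id x).const_sub 1).div_const 2
  constructor
  · refine (h1.rpow_const (p := p) (Or.inl ?_)).congr_deriv (by ring)
    linarith [hx.1]
  · refine (h2.rpow_const (p := p) (Or.inl ?_)).congr_deriv (by ring)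
    linarith [hx.2]

noncomputable def tlbH (p c s : ℝ) : ℝ :=
  p / 2 * (((1 + s) / 2) ^ (p - 1) + c ^ p * ((1 - s) / 2) ^ (p - 1))

noncomputable def tlbQ (p c s : ℝ) : ℝ :=
  ((1 + s) / 2) ^ (p - 2) - c ^ p * ((1 - s) / 2) ^ (p - 2)

lemma tlb_hc (p c : ℝ) (x : ℝ) (hx : x ∈ Ioo (-1 : ℝ) 1) :
    HasDerivAt (hc p c) (tlbH p c x) x := by
  refine ((tlb_pw p x hx).1.sub ((tlb_pw p x hx).2.const_mul (c ^ p))).congr_deriv ?_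
  unfold tlbH; ring

lemma tlb_hflux (p c : ℝ) (x : ℝ) (hx : x ∈ Ioo (-1 : ℝ) 1) :
    HasDerivAt (fun y => (1 - y ^ 2) * tlbH p c y)
      (p ^ 2 * ((1 + x) / 2 * ((1 - x) / 2)) * tlbQ p c x - p * hc p c x) x := by
  have h1 : HasDerivAt (fun y : ℝ => 1 - y ^ 2) (-(2 * x)) x := by
    simpa using (hasDerivAt_pow 2 x).const_sub 1
  have h2 := ((tlb_pw (p - 1) x hx).1.add
    ((tlb_pw (p - 1) x hx).2.const_mul (c ^ p))).const_mul (p / 2)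
  refine (h1.mul h2).congr_deriv ?_
  have ha : 0 < (1 + x) / 2 := by linarith [hx.1]
  have hb : 0 < (1 - x) / 2 := by linarith [hx.2]
  have e2 : ∀ a : ℝ, 0 < a → a ^ (p - 1) = a ^ (p - 2) * a := fun a ha => by
    rw [← Real.rpow_add_one ha.ne']; congr 1; ring
  have e3 : ∀ a : ℝ, 0 < a → a ^ p = a ^ (p - 2) * a * a := fun a ha => by
    rw [← e2 a ha, ← Real.rpow_add_one ha.ne']; congr 1; ring
  have e4 : p - 1 - 1 = p - 2 := by ring
  unfold tlbQ hc
  simp only [Pi.add_apply, e4]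
  rw [e2 _ ha, e2 _ hb, e3 _ ha, e3 _ hb]
  ring

lemma tlbQ_mono (p c : ℝ) (hp : 2 < p) (hc : 0 < c) (x y : ℝ) (hx : -1 ≤ x) (hxy : x < y)
    (hy : y ≤ 1) : tlbQ p c x < tlbQ p c y := by
  unfold tlbQ
  have h1 : ((1 + x) / 2) ^ (p - 2) < ((1 + y) / 2) ^ (p - 2) :=
    Real.rpow_lt_rpow (by linarith) (by linarith) (by linarith)
  have h2 : ((1 - y) / 2) ^ (p - 2) ≤ ((1 - x) / 2) ^ (p - 2) :=
    Real.rpow_le_rpow (by linarith) (by linarith) (by linarith)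
  have h3 : 0 < c ^ p := Real.rpow_pos_of_pos hc p
  nlinarith

lemma tlb_pos (p c s : ℝ) (hp : 2 < p) (hc0 : 0 < c) (hs : s < 1)
    (h : c * (1 - s) < 1 + s) : 0 < hc p c s := by
  unfold hc
  have hb : 0 < (1 - s) / 2 := by linarith
  rw [← Real.mul_rpow hc0.le hb.le, sub_pos]
  exact Real.rpow_lt_rpow (by positivity) (by linarith) (by linarith)

/-- Lower bound in the touching problem: if a Legendre solution `g` with limit `A > 1`
at `1⁻` majorizes the obstacle `h_c` near `1` and touches it at a point `x₀`, then
`c ≥ (1+z)/(1−z)`, where `z` is the largest zero of the bounded solution. -/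
theorem touching_lower_bound (p : ℝ) (hp : 2 < p) (f : ℝ → ℝ) (z : ℝ)
    (hf : IsBddLegendreSol p f) (hz : IsLargestZero f z)
    (c : ℝ) (hcpos : 0 < c) (g : ℝ → ℝ) (A : ℝ) (hA : 1 < A)
    (hg : ContDiffOn ℝ 2 g (Set.Ioo (-1 : ℝ) 1))
    (hode : ∀ x ∈ Set.Ioo (-1 : ℝ) 1,
      (1 - x ^ 2) * deriv (deriv g) x - 2 * x * deriv g x + p * g x = 0)
    (hlim : Filter.Tendsto g (nhdsWithin 1 (Set.Iio 1)) (nhds A))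
    (x₀ : ℝ) (hx₀ : x₀ ∈ Set.Ioo (-1 : ℝ) 1)
    (hmaj : ∀ s ∈ Set.Ioo x₀ (1 : ℝ), hc p c s < g s)
    (htouch : g x₀ = hc p c x₀) (htouch' : deriv g x₀ = deriv (hc p c) x₀) :
    (1 + z) / (1 - z) ≤ c := by
  obtain ⟨hf1, hof, hlf⟩ := hf
  obtain ⟨hz1, hz0, hzp⟩ := hz
  have hp0 : 0 < p := by linarith
  by_contra hcon
  push Not at hcon
  rw [lt_div_iff₀ (by linarith [hz1.2])] at hcon
  have hpos : ∀ s ∈ Ico z 1, 0 < hc p c s := by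
    intro s hs
    apply tlb_pos p c s hp hcpos hs.2
    nlinarith [hs.1]
  have hin : ∀ s ∈ Ico z 1, s ∈ Ioo (-1 : ℝ) 1 := fun s hs => ⟨by linarith [hs.1, hz1.1], hs.2⟩
  have hwr := tlb_wronsk p hp0 f g 1 A hf1 hof hlf hg hode hlim
  have hzx : z < x₀ := by
    by_contra hle
    push Not at hle
    have hgp : ∀ s ∈ Ico z 1, 0 < g s := by
      intro s hs
      rcases eq_or_lt_of_le (hle.trans hs.1) with h | h
      · rw [← h, htouch, h]; exact hpos s hs
      · exact (hpos s hs).trans (hmaj s ⟨h, hs.2⟩)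
    have hm := tlb_mono (fun y => -(f y / g y)) (fun _ => 0) z 1 (by
      intro y hy
      refine ((tlb_reg f hf1 y (hin y hy)).1.div (tlb_reg g hg y (hin y hy)).1
        (hgp y hy).ne').fun_neg.congr_deriv ?_
      have := hwr y (hin y hy)
      rw [show deriv f y * g y - f y * deriv g y = 0 by linarith]
      simp) (fun _ _ => le_rfl)
    have hmid : (z + 1) / 2 ∈ Ioo z 1 := ⟨by linarith [hz1.2], by linarith [hz1.2]⟩
    have h := hm ⟨le_refl z, hz1.2⟩ ⟨hmid.1.le, hmid.2⟩ hmid.1.le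
    simp only [hz0] at h
    have := div_pos (hzp _ hmid) (hgp _ ⟨hmid.1.le, hmid.2⟩)
    simp only [zero_div, neg_zero] at h
    linarith
  have hfz : 0 ≤ deriv f z := by
    have hd := (tlb_reg f hf1 z hz1).1
    have ht := hd.tendsto_slope.mono_left
      (nhdsWithin_mono z (fun y (hy : z < y) => hy.ne') : 𝓝[>] z ≤ 𝓝[≠] z)
    refine ge_of_tendsto ht ?_
    filter_upwards [Ioo_mem_nhdsGT hz1.2] with y hy
    rw [slope_def_field, hz0]
    exact div_nonneg (by linarith [hzp y hy]) (by linarith [hy.1])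
  set W : ℝ → ℝ := fun y => f y * ((1 - y ^ 2) * tlbH p c y)
    - ((1 - y ^ 2) * deriv f y) * hc p c y with hW
  set D : ℝ → ℝ := fun y => f y * (p ^ 2 * ((1 + y) / 2 * ((1 - y) / 2)) * tlbQ p c y) with hD
  have hWd : ∀ y ∈ Ioo (-1 : ℝ) 1, HasDerivAt W (D y) y := by
    intro y hy
    refine (((tlb_reg f hf1 y hy).1.mul (tlb_hflux p c y hy)).sub
      ((tlb_flux p f hf1 hof y hy).mul (tlb_hc p c y hy))).congr_deriv ?_
    simp only [hD]
    ring
  have hW0 : W x₀ = 0 := by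
    have h := hwr x₀ hx₀
    rw [htouch, htouch', (tlb_hc p c x₀ hx₀).deriv] at h
    simp only [hW]
    linear_combination (1 - x₀ ^ 2) * h
  have hcoef : ∀ y ∈ Ioo z 1, 0 < f y * (p ^ 2 * ((1 + y) / 2 * ((1 - y) / 2))) := by
    intro y hy
    have h1 := hzp y hy
    have h2 : 0 < 1 + y := by linarith [hy.1, hz1.1]
    have h3 : 0 < 1 - y := by linarith [hy.2]
    positivity
  have hD' : ∀ y, D y = f y * (p ^ 2 * ((1 + y) / 2 * ((1 - y) / 2))) * tlbQ p c y := by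
    intro y; simp only [hD]; ring
  rcases le_or_gt 0 (tlbQ p c x₀) with hq | hq
  · have hs := tlb_smono W D x₀ 1 (fun y hy => hWd y ⟨by linarith [hy.1, hx₀.1], hy.2⟩) (by
      intro y hy
      rw [hD']
      exact mul_pos (hcoef y ⟨by linarith [hy.1], hy.2⟩)
        (hq.trans_lt (tlbQ_mono p c hp hcpos x₀ y hx₀.1.le hy.1 hy.2.le)))
    have hWl : Tendsto W (𝓝[<] 1) (𝓝 0) := by
      have hcH : ContinuousAt (tlbH p c) 1 := by
        unfold tlbH
        have h1 : ContinuousAt (fun s : ℝ => ((1 + s) / 2) ^ (p - 1)) 1 :=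
          ContinuousAt.rpow_const (by fun_prop) (Or.inr (by linarith))
        have h2 : ContinuousAt (fun s : ℝ => ((1 - s) / 2) ^ (p - 1)) 1 :=
          ContinuousAt.rpow_const (by fun_prop) (Or.inr (by linarith))
        fun_prop
      have hch : ContinuousAt (hc p c) 1 := by
        unfold hc
        have h1 : ContinuousAt (fun s : ℝ => ((1 + s) / 2) ^ p) 1 :=
          ContinuousAt.rpow_const (by fun_prop) (Or.inr (by linarith))
        have h2 : ContinuousAt (fun s : ℝ => ((1 - s) / 2) ^ p) 1 :=
          ContinuousAt.rpow_const (by fun_prop) (Or.inr (by linarith))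
        fun_prop
      have h3 : ContinuousAt (fun y : ℝ => (1 - y ^ 2)) 1 := by fun_prop
      have hm := (h3.mul hcH).tendsto.mono_left (nhdsWithin_le_nhds (s := Iio 1))
      have := (hlf.mul hm).sub
        ((tlb_flux_lim p hp0 f 1 hf1 hof hlf).mul
          (hch.tendsto.mono_left (nhdsWithin_le_nhds (s := Iio 1))))
      simpa using this
    have hmid : (x₀ + 1) / 2 ∈ Ioo x₀ 1 := ⟨by linarith [hx₀.2], by linarith [hx₀.2]⟩
    have h1 := hs ⟨le_refl x₀, hx₀.2⟩ ⟨hmid.1.le, hmid.2⟩ hmid.1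
    have h2 : W ((x₀ + 1) / 2) ≤ 0 := by
      refine ge_of_tendsto hWl ?_
      filter_upwards [tlb_ev _ hmid.2] with y hy
      exact (hs ⟨hmid.1.le, hmid.2⟩ ⟨(hmid.1.trans hy.1).le, hy.2⟩ hy.1).le
    linarith
  · have hb : ∀ y ∈ Ico z 1, HasDerivAt W (D y) y := fun y hy => hWd y (hin y hy)
    have hWz : W z ≤ 0 := by
      simp only [hW, hz0]
      have h1 := hpos z ⟨le_refl z, hz1.2⟩
      have h2 : 0 ≤ 1 - z ^ 2 := by nlinarith [hz1.1, hz1.2]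
      have := mul_nonneg (mul_nonneg h2 hfz) h1.le
      linarith
    have hs : StrictAntiOn W (Icc z x₀) := by
      refine strictAntiOn_of_deriv_neg (convex_Icc z x₀)
        (fun y hy => (hb y ⟨hy.1, hy.2.trans_lt hx₀.2⟩).continuousAt.continuousWithinAt) ?_
      intro y hy
      rw [interior_Icc] at hy
      rw [(hb y ⟨hy.1.le, hy.2.trans hx₀.2⟩).deriv, hD']
      exact mul_neg_of_pos_of_neg (hcoef y ⟨hy.1, hy.2.trans hx₀.2⟩)
        ((tlbQ_mono p c hp hcpos y x₀ (by linarith [hy.1, hz1.1]) hy.2 hx₀.2.le).trans hq)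
    have := hs ⟨le_refl z, hzx.le⟩ ⟨hzx.le, le_refl x₀⟩ hzx
    linarith
end

section
/- Let p > 2 be a real number, let f be a bounded Legendre solution of parameter p with largest zero z ∈ (−1,1), let c = (1+z)/(1−z), and let a = h_c'(z)/f'(z). Then h_c(z) = 0 = a·f(z), h_c'(z) = a·f'(z), and h_c(s) ≤ a·f(s) for all s ∈ [z, 1): the function a·f majorizes the obstacle h_c on [z,1) and touches it exactly at z. Thus the value c = (1+z)/(1−z) in the touching problem is attained. -/
open Set Filter Topology

lemma hc_hasDeriv (p c s : ℝ) (hp : 2 < p) :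
    HasDerivAt (hc p c) (p / 2 * (((1 + s) / 2) ^ (p - 1) + c ^ p * ((1 - s) / 2) ^ (p - 1))) s := by
  have h1 : HasDerivAt (fun s : ℝ => (1 + s) / 2) (1 / 2) s :=
    ((hasDerivAt_id s).const_add 1).div_const 2
  have h2 : HasDerivAt (fun s : ℝ => (1 - s) / 2) (-1 / 2) s :=
    ((hasDerivAt_id s).const_sub 1).div_const 2
  have h3 := h1.rpow_const (p := p) (Or.inr (by linarith))
  have h4 := (h2.rpow_const (p := p) (Or.inr (by linarith))).const_mul (c ^ p)
  have := h3.sub h4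
  refine HasDerivAt.congr_deriv (this.congr_of_eventuallyEq ?_) (by ring)
  exact Eventually.of_forall fun x => rfl

lemma hc_hasDeriv2 (p c s : ℝ) (hp : 2 < p) :
    HasDerivAt (fun s => p / 2 * (((1 + s) / 2) ^ (p - 1) + c ^ p * ((1 - s) / 2) ^ (p - 1)))
      (p * (p - 1) / 4 * (((1 + s) / 2) ^ (p - 2) - c ^ p * ((1 - s) / 2) ^ (p - 2))) s := by
  have h1 : HasDerivAt (fun s : ℝ => (1 + s) / 2) (1 / 2) s :=
    ((hasDerivAt_id s).const_add 1).div_const 2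
  have h2 : HasDerivAt (fun s : ℝ => (1 - s) / 2) (-1 / 2) s :=
    ((hasDerivAt_id s).const_sub 1).div_const 2
  have h3 := h1.rpow_const (p := p - 1) (Or.inr (by linarith))
  have h4 := (h2.rpow_const (p := p - 1) (Or.inr (by linarith))).const_mul (c ^ p)
  have := (h3.add h4).const_mul (p / 2)
  refine HasDerivAt.congr_deriv (this.congr_of_eventuallyEq ?_) ?_
  · exact Eventually.of_forall fun x => rfl
  · rw [show p - 1 - 1 = p - 2 by ring]; ring

lemma hc_L (p c s : ℝ) (hs : s ∈ Ioo (-1 : ℝ) 1) :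
    (1 - s ^ 2) * (p * (p - 1) / 4 * (((1 + s) / 2) ^ (p - 2) - c ^ p * ((1 - s) / 2) ^ (p - 2)))
      - 2 * s * (p / 2 * (((1 + s) / 2) ^ (p - 1) + c ^ p * ((1 - s) / 2) ^ (p - 1)))
      + p * hc p c s
    = p ^ 2 * ((1 - s ^ 2) / 4) * (((1 + s) / 2) ^ (p - 2) - c ^ p * ((1 - s) / 2) ^ (p - 2)) := by
  have hA : 0 < (1 + s) / 2 := by linarith [hs.1]
  have hB : 0 < (1 - s) / 2 := by linarith [hs.2]
  have e1 : ∀ A : ℝ, 0 < A → A ^ (p - 1) = A ^ (p - 2) * A := by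
    intro A hA
    rw [← Real.rpow_add_one hA.ne']; congr 1; ring
  have e2 : ∀ A : ℝ, 0 < A → A ^ p = A ^ (p - 2) * A * A := by
    intro A hA
    rw [← Real.rpow_add_one hA.ne', ← Real.rpow_add_one hA.ne']; congr 1; ring
  unfold hc
  rw [e1 _ hA, e1 _ hB, e2 _ hA, e2 _ hB]
  ring

/-- Attainment in the touching problem: with `c = (1+z)/(1−z)` and
`a = h_c'(z)/f'(z)`, the function `a·f` majorizes `h_c` on `[z,1)` and touches it at `z`:
`h_c(z) = 0 = a f(z)`, `h_c'(z) = a f'(z)`, and `h_c ≤ a f` on `[z,1)`. -/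
theorem touching_attained (p : ℝ) (hp : 2 < p) (f : ℝ → ℝ) (z : ℝ)
    (hf : IsBddLegendreSol p f) (hz : IsLargestZero f z) :
    hc p ((1 + z) / (1 - z)) z = 0 ∧
    (deriv (hc p ((1 + z) / (1 - z))) z / deriv f z) * f z = 0 ∧
    deriv (hc p ((1 + z) / (1 - z))) z =
      (deriv (hc p ((1 + z) / (1 - z))) z / deriv f z) * deriv f z ∧
    ∀ s ∈ Set.Ico z (1 : ℝ),
      hc p ((1 + z) / (1 - z)) s ≤
        (deriv (hc p ((1 + z) / (1 - z))) z / deriv f z) * f s := by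
  obtain ⟨hC, hode, hlim⟩ := hf
  obtain ⟨hzI, hfz, hpos⟩ := hz
  have hz1 := hzI.1
  have hz2 := hzI.2
  have hd1 : ∀ x ∈ Ioo (-1 : ℝ) 1, HasDerivAt f (deriv f x) x := fun x hx =>
    ((hC.differentiableOn (by norm_num)).differentiableAt (isOpen_Ioo.mem_nhds hx)).hasDerivAt
  have hC1 : ContDiffOn ℝ 1 (deriv f) (Ioo (-1 : ℝ) 1) :=
    ((contDiffOn_succ_iff_deriv_of_isOpen (n := 1) isOpen_Ioo).1 (by simpa using! hC)).2.2
  have hd2 : ∀ x ∈ Ioo (-1 : ℝ) 1, HasDerivAt (deriv f) (deriv (deriv f) x) x := fun x hx =>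
    ((hC1.differentiableOn (by norm_num)).differentiableAt (isOpen_Ioo.mem_nhds hx)).hasDerivAt
  have hsub : ∀ x, z ≤ x → x < 1 → x ∈ Ioo (-1 : ℝ) 1 := fun x h1 h2 => ⟨by linarith, h2⟩
  -- f'(z) ≠ 0
  have hgd : ∀ x ∈ Ioo (-1 : ℝ) 1,
      HasDerivAt (fun x => (1 - x ^ 2) * deriv f x) (-(p * f x)) x := by
    intro x hx
    have h1 : HasDerivAt (fun x : ℝ => 1 - x ^ 2) (-(2 * x)) x := by
      simpa using! (hasDerivAt_pow 2 x).const_sub 1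
    refine (h1.mul (hd2 x hx)).congr_deriv ?_
    linarith [hode x hx]
  have hfz' : deriv f z ≠ 0 := by
    intro h0
    have hg : AntitoneOn (fun x => (1 - x ^ 2) * deriv f x) (Ico z 1) := by
      apply antitoneOn_of_deriv_nonpos (convex_Ico z 1)
      · exact fun x hx => (hgd x (hsub x hx.1 hx.2)).continuousAt.continuousWithinAt
      · rw [interior_Ico]
        exact fun x hx => (hgd x (hsub x hx.1.le hx.2)).differentiableAt.differentiableWithinAt
      · rw [interior_Ico]
        intro x hx
        rw [(hgd x (hsub x hx.1.le hx.2)).deriv]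
        have := hpos x hx
        have : 0 < p * f x := by positivity
        linarith
    have hfa : AntitoneOn f (Ico z 1) := by
      apply antitoneOn_of_deriv_nonpos (convex_Ico z 1)
      · exact fun x hx => (hd1 x (hsub x hx.1 hx.2)).continuousAt.continuousWithinAt
      · rw [interior_Ico]
        exact fun x hx => (hd1 x (hsub x hx.1.le hx.2)).differentiableAt.differentiableWithinAt
      · rw [interior_Ico]
        intro x hx
        have := hg ⟨le_rfl, hz2⟩ ⟨hx.1.le, hx.2⟩ hx.1.le
        simp only [h0, mul_zero] at this
        have h3 : 0 < 1 - x ^ 2 := by nlinarith [hx.1, hx.2]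
        by_contra hcon
        push Not at hcon
        have := mul_pos h3 hcon
        linarith
    have hm : (z + 1) / 2 ∈ Ioo z 1 := ⟨by linarith, by linarith⟩
    have := hfa ⟨le_rfl, hz2⟩ ⟨hm.1.le, hm.2⟩ hm.1.le
    linarith [hpos _ hm]
  have hc0 : 0 < (1 + z) / (1 - z) := div_pos (by linarith) (by linarith)
  have hhz : hc p ((1 + z) / (1 - z)) z = 0 := by
    unfold hc
    rw [← Real.mul_rpow hc0.le (by linarith)]
    have : (1 + z) / (1 - z) * ((1 - z) / 2) = (1 + z) / 2 := by
      have : 1 - z ≠ 0 := by linarith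
      field_simp
    rw [this, sub_self]
  refine ⟨hhz, by rw [hfz, mul_zero], by field_simp, ?_⟩
  generalize (1 + z) / (1 - z) = c at hc0 hhz ⊢
  set h : ℝ → ℝ := hc p c with hh
  set h1 : ℝ → ℝ := fun s => p / 2 * (((1 + s) / 2) ^ (p - 1) + c ^ p * ((1 - s) / 2) ^ (p - 1))
    with hh1
  set K : ℝ → ℝ := fun s => ((1 + s) / 2) ^ (p - 2) - c ^ p * ((1 - s) / 2) ^ (p - 2) with hK
  have hD1 : ∀ s, HasDerivAt h (h1 s) s := fun s => hc_hasDeriv p c s hp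
  have hD2 : ∀ s, HasDerivAt h1 (p * (p - 1) / 4 * K s) s := fun s => hc_hasDeriv2 p c s hp
  have hL : ∀ s ∈ Ioo (-1 : ℝ) 1, (1 - s ^ 2) * (p * (p - 1) / 4 * K s) - 2 * s * h1 s + p * h s
      = p ^ 2 * ((1 - s ^ 2) / 4) * K s := fun s hs => hc_L p c s hs
  have hcp : 0 < c ^ p := Real.rpow_pos_of_pos hc0 p
  have hKm : ∀ x y, z ≤ x → x ≤ y → y < 1 → K x ≤ K y := by
    intro x y hx hxy hy
    have e1 : ((1 + x) / 2) ^ (p - 2) ≤ ((1 + y) / 2) ^ (p - 2) :=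
      Real.rpow_le_rpow (by linarith) (by linarith) (by linarith)
    have e2 : ((1 - y) / 2) ^ (p - 2) ≤ ((1 - x) / 2) ^ (p - 2) :=
      Real.rpow_le_rpow (by linarith) (by linarith) (by linarith)
    have := mul_le_mul_of_nonneg_left e2 hcp.le
    simp only [hK]; linarith
  clear_value h h1 K
  set W : ℝ → ℝ := fun s => (1 - s ^ 2) * (h1 s * f s - h s * deriv f s) with hW
  have hWd : ∀ x ∈ Ioo (-1 : ℝ) 1,
      HasDerivAt W (p ^ 2 * ((1 - x ^ 2) / 4) * K x * f x) x := by
    intro x hx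
    have e1 : HasDerivAt (fun x : ℝ => 1 - x ^ 2) (-(2 * x)) x := by
      simpa using! (hasDerivAt_pow 2 x).const_sub 1
    refine (e1.mul (((hD2 x).mul (hd1 x hx)).sub ((hD1 x).mul (hd2 x hx)))).congr_deriv ?_
    simp only [Pi.mul_apply, Pi.sub_apply]
    linear_combination f x * hL x hx - h x * hode x hx
  have hsq : ∀ x ∈ Ioo (-1 : ℝ) 1, 0 < 1 - x ^ 2 := fun x hx => by nlinarith [hx.1, hx.2]
  have hfnn : ∀ x, z ≤ x → x < 1 → 0 ≤ f x := by
    intro x h1 h2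
    rcases h1.eq_or_lt with rfl | h1
    · exact hfz.ge
    · exact (hpos x ⟨h1, h2⟩).le
  have hqd : ∀ x ∈ Ioo z 1, HasDerivAt (fun x => h x / f x) (W x / ((1 - x ^ 2) * f x ^ 2)) x := by
    intro x hx
    have hxI := hsub x hx.1.le hx.2
    refine ((hD1 x).div (hd1 x hxI) (hpos x hx).ne').congr_deriv ?_
    have := (hsq x hxI).ne'
    have := (hpos x hx).ne'
    simp only [hW]
    field_simp
  have hWneg : ∀ x ∈ Ioo z 1, W x ≤ 0 := by
    intro s hs
    rcases le_or_gt 0 (K s) with hk | hk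
    · by_contra hcon
      push Not at hcon
      have hmono : MonotoneOn W (Ico s 1) := by
        apply monotoneOn_of_deriv_nonneg (convex_Ico s 1)
        · exact fun x hx =>
            (hWd x (hsub x (hs.1.le.trans hx.1) hx.2)).continuousAt.continuousWithinAt
        · rw [interior_Ico]
          exact fun x hx =>
            (hWd x (hsub x (hs.1.trans hx.1).le hx.2)).differentiableAt.differentiableWithinAt
        · rw [interior_Ico]
          intro x hx
          have hxI := hsub x (hs.1.trans hx.1).le hx.2
          rw [(hWd x hxI).deriv]
          have := hKm s x hs.1.le hx.1.le hx.2
          have := hsq x hxI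
          have := hfnn x (hs.1.trans hx.1).le hx.2
          have : 0 ≤ K x := by linarith
          positivity
      have hev : ∀ᶠ x in 𝓝[<] (1 : ℝ), f x < 2 := hlim.eventually (gt_mem_nhds (by norm_num))
      obtain ⟨l, hl, hl2⟩ := (mem_nhdsLT_iff_exists_Ioo_subset).1 hev
      set m := max s ((l + 1) / 2) with hm
      have hl' : l < 1 := hl
      have hms : s ≤ m := le_max_left _ _
      have hml : l < m := lt_of_lt_of_le (by linarith) (le_max_right s ((l + 1) / 2))
      have hm1 : m < 1 := max_lt hs.2 (by linarith)
      set k := W s / 8 with hk8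
      have hk0 : 0 < k := by positivity
      have hqd' : ∀ x ∈ Ico m 1, HasDerivAt (fun x => h x / f x + k * Real.log (1 - x))
          (W x / ((1 - x ^ 2) * f x ^ 2) + k * (-1 / (1 - x))) x := by
        intro x hx
        have e1 : HasDerivAt (fun x : ℝ => 1 - x) (-1) x := (hasDerivAt_id x).const_sub 1
        have e2 := (e1.log (by linarith [hx.2])).const_mul k
        exact (hqd x ⟨by linarith [hs.1, hx.1], hx.2⟩).add e2
      have hmono2 : MonotoneOn (fun x => h x / f x + k * Real.log (1 - x)) (Ico m 1) := by
        apply monotoneOn_of_deriv_nonneg (convex_Ico m 1)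
        · exact fun x hx => (hqd' x hx).continuousAt.continuousWithinAt
        · rw [interior_Ico]
          exact fun x hx =>
            (hqd' x ⟨hx.1.le, hx.2⟩).differentiableAt.differentiableWithinAt
        · rw [interior_Ico]
          intro x hx
          rw [(hqd' x ⟨hx.1.le, hx.2⟩).deriv]
          have hxz : x ∈ Ioo z 1 := ⟨by linarith [hs.1, hx.1], hx.2⟩
          have hxI := hsub x hxz.1.le hx.2
          have hWx : W s ≤ W x := hmono ⟨le_rfl, hs.2⟩ ⟨by linarith [hx.1], hx.2⟩
            (by linarith [hx.1])
          have hf0 := hpos x hxz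
          have hf2 : f x < 2 := hl2 ⟨by linarith [hx.1], hx.2⟩
          have hx1 : 0 < 1 - x := by linarith [hx.2]
          have hsx := hsq x hxI
          have hden : (1 - x ^ 2) * f x ^ 2 ≤ 8 * (1 - x) := by
            have a1 : 1 - x ^ 2 ≤ 2 * (1 - x) := by nlinarith
            have a2 : f x ^ 2 ≤ 4 := by nlinarith
            calc (1 - x ^ 2) * f x ^ 2 ≤ (2 * (1 - x)) * 4 := by gcongr
              _ = _ := by ring
          have : W s / (8 * (1 - x)) ≤ W x / ((1 - x ^ 2) * f x ^ 2) := by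
            apply div_le_div₀ (by linarith) hWx (by positivity) hden
          have e3 : k * (-1 / (1 - x)) = - (W s / (8 * (1 - x))) := by
            rw [hk8]; field_simp
          rw [e3]; linarith
      -- contradiction at 1
      have hq1 : Tendsto (fun x => h x / f x) (𝓝[<] 1) (𝓝 (h 1 / 1)) :=
        ((hD1 1).continuousAt.continuousWithinAt.tendsto).div hlim (by norm_num)
      have hlog : Tendsto (fun x : ℝ => Real.log (1 - x)) (𝓝[<] 1) atBot := by
        refine Real.tendsto_log_nhdsGT_zero.comp ?_
        refine tendsto_nhdsWithin_iff.2 ⟨?_, ?_⟩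
        · have : Tendsto (fun x : ℝ => 1 - x) (𝓝 1) (𝓝 (1 - 1)) :=
            tendsto_const_nhds.sub tendsto_id
          rw [sub_self] at this
          exact this.mono_left nhdsWithin_le_nhds
        · filter_upwards [self_mem_nhdsWithin] with x hx
          have : x < 1 := hx
          exact sub_pos.2 this
      have hbot := hq1.add_atBot (hlog.const_mul_atBot hk0)
      have hev1 := hbot.eventually (eventually_lt_atBot (h m / f m + k * Real.log (1 - m)))
      obtain ⟨x, hx1, hx2⟩ := (hev1.and (Ioo_mem_nhdsLT hm1)).exists
      have := hmono2 ⟨le_rfl, hm1⟩ ⟨hx2.1.le, hx2.2⟩ hx2.1.le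
      simp only at this
      linarith
    · have hanti : AntitoneOn W (Icc z s) := by
        apply antitoneOn_of_deriv_nonpos (convex_Icc z s)
        · exact fun x hx =>
            (hWd x (hsub x hx.1 (hx.2.trans_lt hs.2))).continuousAt.continuousWithinAt
        · rw [interior_Icc]
          exact fun x hx =>
            (hWd x (hsub x hx.1.le (hx.2.trans hs.2))).differentiableAt.differentiableWithinAt
        · rw [interior_Icc]
          intro x hx
          have hxI := hsub x hx.1.le (hx.2.trans hs.2)
          rw [(hWd x hxI).deriv]
          have := hKm x s hx.1.le hx.2.le hs.2
          have := hsq x hxI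
          have := hfnn x hx.1.le hxI.2
          have h0 : 0 ≤ -K x := by linarith
          have : 0 ≤ p ^ 2 * ((1 - x ^ 2) / 4) * (-K x) * f x := by positivity
          linarith
      have := hanti ⟨le_rfl, hs.1.le⟩ ⟨hs.1.le, le_rfl⟩ hs.1.le
      have hWz : W z = 0 := by simp [hW, hfz, hhz]
      linarith
  have hqa : AntitoneOn (fun x => h x / f x) (Ioo z 1) := by
    apply antitoneOn_of_deriv_nonpos (convex_Ioo z 1)
    · exact fun x hx => (hqd x hx).continuousAt.continuousWithinAt
    · rw [interior_Ioo]
      exact fun x hx => (hqd x hx).differentiableAt.differentiableWithinAt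
    · rw [interior_Ioo]
      intro x hx
      rw [(hqd x hx).deriv]
      have := hsq x (hsub x hx.1.le hx.2)
      exact div_nonpos_of_nonpos_of_nonneg (hWneg x hx) (by positivity)
  have hlimz : Tendsto (fun x => h x / f x) (𝓝[>] z) (𝓝 (deriv h z / deriv f z)) := by
    have t1 := (hD1 z).differentiableAt.hasDerivAt.hasDerivWithinAt (s := Ioi z)
    have t2 := (hd1 z hzI).hasDerivWithinAt (s := Ioi z)
    rw [hasDerivWithinAt_iff_tendsto_slope' (by simp)] at t1 t2
    refine (t1.div t2 hfz').congr' ?_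
    filter_upwards [self_mem_nhdsWithin] with x hx
    have hx' : z < x := hx
    have : x - z ≠ 0 := by linarith
    simp only [Pi.div_apply, slope_def_field, hfz, hhz, sub_zero]
    field_simp
  intro s hs
  rcases hs.1.eq_or_lt with rfl | hzs
  · rw [hhz, hfz, mul_zero]
  · have hfs := hpos s ⟨hzs, hs.2⟩
    rw [← div_le_iff₀ hfs]
    refine ge_of_tendsto hlimz ?_
    filter_upwards [Ioo_mem_nhdsGT hzs] with x hx
    exact hqa ⟨hx.1, hx.2.trans hs.2⟩ ⟨hzs, hs.2⟩ hx.2.le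
end

section
/- Let p > 2 be a real number, let f be a bounded Legendre solution of parameter p with largest zero z ∈ (−1,1). Then for every s ∈ [z, 1), (1−s²)·f''(s) + (2p−2)·s·f'(s) − p(p−1)·f(s) ≥ 0, i.e., −Kf ≥ 0 on [z, 1), where Kg(s) = p(p−1)g(s) − 2(p−1)s·g'(s) − (1−s²)g''(s). -/
theorem anti_aux (z : ℝ) (g g' : ℝ → ℝ)
    (hg : ∀ x ∈ Set.Ico z (1:ℝ), HasDerivAt g (g' x) x)
    (hn : ∀ x ∈ Set.Ico z (1:ℝ), g' x ≤ 0) : AntitoneOn g (Set.Ico z 1) := by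
  apply antitoneOn_of_deriv_nonpos (convex_Ico z 1)
  · exact fun x hx => (hg x hx).continuousAt.continuousWithinAt
  · exact fun x hx => (hg x (interior_subset hx)).differentiableAt.differentiableWithinAt
  · intro x hx
    rw [(hg x (interior_subset hx)).deriv]
    exact hn x (interior_subset hx)

/-- The key differential inequality `−Kf ≥ 0` on `[z,1)` for the bounded Legendre
solution `f` with largest zero `z`:
`(1−s²) f''(s) + (2p−2) s f'(s) − p(p−1) f(s) ≥ 0`. -/
theorem neg_K_nonneg (p : ℝ) (hp : 2 < p) (f : ℝ → ℝ) (z : ℝ)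
    (hf : IsBddLegendreSol p f) (hz : IsLargestZero f z) :
    ∀ s ∈ Set.Ico z (1 : ℝ),
      0 ≤ (1 - s ^ 2) * deriv (deriv f) s + (2 * p - 2) * s * deriv f s
            - p * (p - 1) * f s := by
  obtain ⟨hC, hode, hlim⟩ := hf
  obtain ⟨⟨hz1, hz2⟩, hfz, hpos⟩ := hz
  have hsub : ∀ x ∈ Set.Ico z (1:ℝ), x ∈ Set.Ioo (-1:ℝ) 1 := fun x hx => ⟨by linarith [hx.1], hx.2⟩
  have hd1 : ∀ x ∈ Set.Ico z (1:ℝ), HasDerivAt f (deriv f x) x := fun x hx =>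
    ((hC.differentiableOn (by norm_num)).differentiableAt
      (isOpen_Ioo.mem_nhds (hsub x hx))).hasDerivAt
  have hC1 : ContDiffOn ℝ 1 (deriv f) (Set.Ioo (-1:ℝ) 1) :=
    hC.deriv_of_isOpen isOpen_Ioo (by norm_num)
  have hd2 : ∀ x ∈ Set.Ico z (1:ℝ), HasDerivAt (deriv f) (deriv (deriv f) x) x := fun x hx =>
    ((hC1.differentiableOn (by norm_num)).differentiableAt
      (isOpen_Ioo.mem_nhds (hsub x hx))).hasDerivAt
  have hf0 : ∀ x ∈ Set.Ico z (1:ℝ), 0 ≤ f x := by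
    intro x hx
    rcases hx.1.eq_or_lt with h | h
    · rw [← h, hfz]
    · exact (hpos x ⟨h, hx.2⟩).le
  have hq : ∀ x : ℝ, HasDerivAt (fun y : ℝ => 1 - y ^ 2) (-(2 * x)) x := by
    intro x
    simpa using ((hasDerivAt_id x).pow 2).const_sub 1
  have hu : ∀ x ∈ Set.Ico z (1:ℝ),
      HasDerivAt (fun y => (1 - y ^ 2) * deriv f y) (-(p * f x)) x := by
    intro x hx
    refine ((hq x).mul (hd2 x hx)).congr_deriv ?_
    linarith [hode x (hsub x hx)]
  have huanti := anti_aux z _ _ hu (fun x hx => by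
    have := hf0 x hx
    have : 0 ≤ p * f x := by positivity
    linarith)
  have hu0 : ∀ x ∈ Set.Ico z (1:ℝ), 0 ≤ (1 - x ^ 2) * deriv f x := by
    intro x0 hx0
    by_contra! hneg
    obtain ⟨c, hc⟩ : ∃ c, c = -((1 - x0 ^ 2) * deriv f x0) := ⟨_, rfl⟩
    have hcpos : 0 < c := by linarith
    have hmem : ∀ x ∈ Set.Ico x0 (1:ℝ), x ∈ Set.Ico z (1:ℝ) := fun x hx =>
      ⟨hx0.1.trans hx.1, hx.2⟩
    have hanti := anti_aux x0 (fun y => f y - c / 2 * Real.log (1 - y))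
      (fun x => deriv f x - c / 2 * (-1 / (1 - x)))
      (by
        intro x hx
        have h1 : HasDerivAt (fun y : ℝ => 1 - y) (-1) x := by
          simpa using (hasDerivAt_id x).const_sub 1
        have h2 := h1.log (by linarith [hx.2])
        exact (hd1 x (hmem x hx)).sub (h2.const_mul (c / 2)))
      (by
        intro x hx
        have h1 : (1 - x ^ 2) * deriv f x ≤ -c := by
          have := huanti hx0 (hmem x hx) hx.1
          simp only at this
          linarith
        have hx1 : 0 < 1 - x := by linarith [hx.2]
        have hx2 : 0 < 1 + x := by linarith [(hsub x (hmem x hx)).1]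
        have h2 : deriv f x - c / 2 * (-1 / (1 - x)) = (deriv f x * (1 - x) + c / 2) / (1 - x) := by
          field_simp
          ring
        rw [h2]
        apply div_nonpos_of_nonpos_of_nonneg _ hx1.le
        by_contra! h3
        nlinarith [mul_pos h3 hx2, mul_pos hcpos hx1])
    obtain ⟨M, hM⟩ : ∃ M, M = f x0 - c / 2 * Real.log (1 - x0) := ⟨_, rfl⟩
    have h10 : 0 < 1 - x0 := by linarith [hx0.2]
    obtain ⟨d, hd⟩ : ∃ d, d = min ((1 - x0) / 2) (Real.exp (-(2 * M / c))) := ⟨_, rfl⟩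
    have hdpos : 0 < d := by rw [hd]; positivity
    have hd1' : d ≤ (1 - x0) / 2 := by rw [hd]; exact min_le_left _ _
    have hd2' : d ≤ Real.exp (-(2 * M / c)) := by rw [hd]; exact min_le_right _ _
    have hlog : Real.log d ≤ -(2 * M / c) := by
      rw [← Real.log_exp (-(2 * M / c))]
      exact Real.log_le_log hdpos hd2'
    have hle := hanti (a := x0) ⟨le_refl _, hx0.2⟩ (b := 1 - d) ⟨by linarith, by linarith⟩ (by linarith)
    simp only [sub_sub_cancel] at hle
    have hp1 := hpos (1 - d) ⟨by linarith [hx0.1], by linarith⟩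
    have h5 : c / 2 * Real.log d ≤ c / 2 * (-(2 * M / c)) :=
      mul_le_mul_of_nonneg_left hlog (by positivity)
    have h6 : c / 2 * (-(2 * M / c)) = -M := by field_simp
    linarith
  have hW := anti_aux z (fun y => 2 * y * ((1 - y ^ 2) * deriv f y) - p * ((1 - y ^ 2) * f y))
    (fun x => (2 - p) * ((1 - x ^ 2) * deriv f x))
    (by
      intro x hx
      have h1 : HasDerivAt (fun y : ℝ => 2 * y) 2 x := by
        simpa using (hasDerivAt_id x).const_mul 2
      refine ((h1.mul (hu x hx)).sub (((hq x).mul (hd1 x hx)).const_mul p)).congr_deriv ?_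
      ring)
    (fun x hx => mul_nonpos_of_nonpos_of_nonneg (by linarith) (hu0 x hx))
  intro s hs
  have hWs : 0 ≤ 2 * s * ((1 - s ^ 2) * deriv f s) - p * ((1 - s ^ 2) * f s) := by
    have ht : Filter.Tendsto (fun y => -(p * ((1 - y ^ 2) * f y))) (nhdsWithin 1 (Set.Iio 1))
        (nhds (-(p * ((1 - 1 ^ 2) * 1)))) := by
      refine (((((hq 1).continuousAt.tendsto).mono_left nhdsWithin_le_nhds).mul hlim).const_mul p).neg
    have h0 : -(p * ((1 - (1:ℝ) ^ 2) * 1)) = 0 := by ring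
    rw [h0] at ht
    refine le_of_tendsto ht ?_
    have hm : max s 0 < 1 := max_lt hs.2 one_pos
    filter_upwards [Ioo_mem_nhdsLT hm] with y hy
    have hsy : s ≤ y := (le_max_left _ _).trans hy.1.le
    have hy0 : 0 ≤ y := (le_max_right _ _).trans hy.1.le
    have hym : y ∈ Set.Ico z (1:ℝ) := ⟨hs.1.trans hsy, hy.2⟩
    have h1 := hW hs hym hsy
    simp only at h1
    have h2 := mul_nonneg hy0 (hu0 y hym)
    linarith
  have hs1 : 0 < 1 - s ^ 2 := by
    have := hsub s hs
    nlinarith [this.1, this.2]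
  have h3 : 0 ≤ 2 * s * deriv f s - p * f s := by
    by_contra! h
    nlinarith [mul_neg_of_pos_of_neg hs1 h]
  have h4 : 0 ≤ p * (2 * s * deriv f s - p * f s) := mul_nonneg (by linarith) h3
  linarith [hode s (hsub s hs)]
end

section
/- Let J₀(x) = Σ_{n≥0} (−1)^n·x^{2n}/(2^{2n}·(n!)²) be the Bessel function of order zero, and let j₀ be its first positive zero, i.e., j₀ > 0, J₀(j₀) = 0, and J₀(x) ≠ 0 for 0 < x < j₀. Then p·(1 − z_p) → j₀²/2 as p → ∞: for every ε > 0 there exists P such that for all real p > P, for every bounded Legendre solution f of parameter p with largest zero z_p ∈ (−1,1), one has |p·(1−z_p) − j₀²/2| < ε. In particular, (1+z_p)/(1−z_p) = (4/j₀² + o(1))·p as p → ∞. -/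
/-- The Bessel function of order zero, `J₀(x) = Σ (−1)^n x^{2n} / (2^{2n} (n!)²)`. -/
noncomputable def besselJ0 (x : ℝ) : ℝ :=
  ∑' n : ℕ, (-1 : ℝ) ^ n * x ^ (2 * n) / (2 ^ (2 * n) * ((Nat.factorial n : ℝ)) ^ 2)

open Set Filter Topology

lemma aux_sturm (p b : ℝ) (hp : 0 < p) (hb : 0 < b) (F G A B P1 P2 : ℝ → ℝ)
    (hP : ∀ u ∈ Ioc 0 b, 0 < P1 u ∧ P1 u ≤ P2 u)
    (hF : ∀ u ∈ Ioc 0 b, HasDerivAt F (A u / P1 u) u)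
    (hG : ∀ u ∈ Ioc 0 b, HasDerivAt G (B u / P2 u) u)
    (hA : ∀ u ∈ Ioc 0 b, HasDerivAt A (-(p * F u)) u)
    (hB : ∀ u ∈ Ioc 0 b, HasDerivAt B (-(p * G u)) u)
    (lF : Tendsto F (𝓝[>] 0) (𝓝 1)) (lG : Tendsto G (𝓝[>] 0) (𝓝 1))
    (lA : Tendsto A (𝓝[>] 0) (𝓝 0)) (lB : Tendsto B (𝓝[>] 0) (𝓝 0))
    (pF : ∀ u ∈ Ioc 0 b, 0 < F u) (pG : ∀ u ∈ Ioo 0 b, 0 < G u) (zG : G b = 0) : False := by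
  have anti : ∀ (H H' : ℝ → ℝ), (∀ u ∈ Ioc 0 b, HasDerivAt H (H' u) u) →
      (∀ u ∈ Ioo 0 b, H' u ≤ 0) → Tendsto H (𝓝[>] 0) (𝓝 0) → ∀ u ∈ Ioc 0 b, H u ≤ 0 := by
    intro H H' hd hn hl u hu
    have hanti : AntitoneOn H (Ioc 0 b) := by
      apply antitoneOn_of_hasDerivWithinAt_nonpos (f' := H') (convex_Ioc 0 b)
      · intro x hx; exact (hd x hx).continuousAt.continuousWithinAt
      · intro x hx; rw [interior_Ioc] at hx
        exact (hd x ⟨hx.1, hx.2.le⟩).hasDerivWithinAt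
      · intro x hx; rw [interior_Ioc] at hx
        exact hn x hx
    refine ge_of_tendsto hl ?_
    filter_upwards [Ioo_mem_nhdsGT hu.1] with v hv
    exact hanti ⟨hv.1, hv.2.le.trans hu.2⟩ hu hv.2.le
  have A0 := anti A _ hA (fun u hu => by
    have := mul_pos hp (pF u ⟨hu.1, hu.2.le⟩); linarith) lA
  have B0 := anti B _ hB (fun u hu => by
    have := mul_pos hp (pG u hu); linarith) lB
  have Bb : B b < 0 := by
    have hs : StrictAntiOn B (Icc (b/2) b) := by
      apply strictAntiOn_of_deriv_neg (convex_Icc _ _)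
      · intro x hx; exact (hB x ⟨by linarith [hx.1], hx.2⟩).continuousAt.continuousWithinAt
      · intro x hx; rw [interior_Icc] at hx
        rw [(hB x ⟨by linarith [hx.1], hx.2.le⟩).deriv]
        have := mul_pos hp (pG x ⟨by linarith [hx.1], hx.2⟩); linarith
    have h1 := hs (a := b/2) (b := b) ⟨le_rfl, by linarith⟩ ⟨by linarith, le_rfl⟩ (by linarith)
    have h2 := B0 (b/2) ⟨by linarith, by linarith⟩
    linarith
  have W := anti (fun u => A u * G u - B u * F u)
    (fun u => A u * (B u / P2 u) - B u * (A u / P1 u))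
    (fun u hu => by
      have := ((hA u hu).mul (hG u hu)).sub ((hB u hu).mul (hF u hu))
      refine this.congr_deriv ?_
      ring)
    (fun u hu => by
      have hu' : u ∈ Ioc 0 b := ⟨hu.1, hu.2.le⟩
      have h1 := mul_nonneg_of_nonpos_of_nonpos (A0 u hu') (B0 u hu')
      obtain ⟨h2, h3⟩ := hP u hu'
      have h4 := div_le_div_of_nonneg_left h1 h2 h3
      have e1 : A u * (B u / P2 u) = A u * B u / P2 u := by ring
      have e2 : B u * (A u / P1 u) = A u * B u / P1 u := by ring
      rw [e1, e2]; linarith)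
    (by simpa using (lA.mul lG).sub (lB.mul lF)) b ⟨hb, le_rfl⟩
  simp only [zG, mul_zero, zero_sub] at W
  have := mul_neg_of_neg_of_pos Bb (pF b ⟨hb, le_rfl⟩)
  linarith

lemma aux_flux (η K M : ℝ) (F A P D : ℝ → ℝ) (hK : 0 ≤ K)
    (hP : ∀ u ∈ Ioo 0 η, 0 < P u ∧ P u ≤ 2 * u)
    (hF : ∀ u ∈ Ioo 0 η, HasDerivAt F (A u / P u) u)
    (hA : ∀ u ∈ Ioo 0 η, HasDerivAt A (D u) u)
    (hD : ∀ u ∈ Ioo 0 η, D u ≤ K) (hM : ∀ u ∈ Ioo 0 η, -M ≤ F u) :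
    ∀ u ∈ Ioo 0 η, A u ≤ K * u := by
  intro w hw
  by_contra! hc
  set c := A w - K * w with hcdef
  have cpos : 0 < c := by linarith
  have sub : ∀ v ∈ Ioc 0 w, v ∈ Ioo 0 η := fun v hv => ⟨hv.1, hv.2.trans_lt hw.2⟩
  have h1 : AntitoneOn (fun v => A v - K * v) (Ioc 0 w) := by
    have hd : ∀ v ∈ Ioc 0 w, HasDerivAt (fun v => A v - K * v) (D v - K) v := fun v hv => by
      exact ((hA v (sub v hv)).sub ((hasDerivAt_id v).const_mul K)).congr_deriv (by simp)
    apply antitoneOn_of_hasDerivWithinAt_nonpos (f' := fun v => D v - K) (convex_Ioc 0 w)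
    · intro x hx; exact (hd x hx).continuousAt.continuousWithinAt
    · intro x hx; rw [interior_Ioc] at hx
      exact (hd x ⟨hx.1, hx.2.le⟩).hasDerivWithinAt
    · intro x hx; rw [interior_Ioc] at hx
      have := hD x (sub x ⟨hx.1, hx.2.le⟩)
      linarith
  have h2 : ∀ v ∈ Ioc 0 w, c ≤ A v := fun v hv => by
    have := h1 hv ⟨hw.1, le_rfl⟩ hv.2
    simp only at this
    have := mul_nonneg hK hv.1.le
    linarith
  have h3 : MonotoneOn (fun v => F v - c / 2 * Real.log v) (Ioc 0 w) := by
    have hd : ∀ v ∈ Ioc 0 w, HasDerivAt (fun v => F v - c / 2 * Real.log v)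
        (A v / P v - c / 2 * v⁻¹) v := fun v hv =>
      (hF v (sub v hv)).sub ((Real.hasDerivAt_log hv.1.ne').const_mul (c/2))
    apply monotoneOn_of_hasDerivWithinAt_nonneg (f' := fun v => A v / P v - c / 2 * v⁻¹)
      (convex_Ioc 0 w)
    · intro x hx; exact (hd x hx).continuousAt.continuousWithinAt
    · intro x hx; rw [interior_Ioc] at hx
      exact (hd x ⟨hx.1, hx.2.le⟩).hasDerivWithinAt
    · intro x hx; rw [interior_Ioc] at hx
      have hx' : x ∈ Ioc 0 w := ⟨hx.1, hx.2.le⟩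
      obtain ⟨h4, h5⟩ := hP x (sub x hx')
      have h6 : c / (2 * x) ≤ A x / P x :=
        div_le_div₀ (cpos.le.trans (h2 x hx')) (h2 x hx') h4 h5
      have : c / 2 * x⁻¹ = c / (2 * x) := by
        have := hx.1.ne'
        field_simp
      simp only [this]; linarith
  have h4 : Tendsto (fun v => c / 2 * Real.log v) (𝓝[>] 0) atBot :=
    Real.tendsto_log_nhdsGT_zero.const_mul_atBot (by linarith)
  have h5 := h4.eventually (eventually_lt_atBot (-M - (F w - c / 2 * Real.log w)))
  obtain ⟨v, hv1, hv2⟩ := (h5.and (Ioo_mem_nhdsGT hw.1)).exists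
  have h6 := h3 (a := v) (b := w) ⟨hv2.1, hv2.2.le⟩ ⟨hw.1, le_rfl⟩ hv2.2.le
  have h7 := hM v (sub v ⟨hv2.1, hv2.2.le⟩)
  simp only at h6
  linarith

noncomputable def auxB (s : ℝ) : ℝ := ∑' n : ℕ, (-1 : ℝ) ^ n * s ^ n / ((n.factorial : ℝ)) ^ 2
noncomputable def auxC (s : ℝ) : ℝ :=
  ∑' n : ℕ, (-1 : ℝ) ^ n * s ^ n / ((n.factorial : ℝ) * ((n+1).factorial : ℝ))

lemma auxB_eq (x : ℝ) : besselJ0 x = auxB (x ^ 2 / 4) := by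
  unfold besselJ0 auxB
  congr 1; ext n
  rw [div_pow, ← pow_mul, pow_mul 2 2 n]
  norm_num
  field_simp

lemma aux_bound (R y c : ℝ) (n : ℕ) (hy : |y| ≤ R) (hc : (n.factorial : ℝ) ≤ c) :
    ‖(-1 : ℝ) ^ n * y ^ n / c‖ ≤ R ^ n / n.factorial := by
  have h0 : (0:ℝ) < n.factorial := by exact_mod_cast n.factorial_pos
  rw [Real.norm_eq_abs, abs_div, abs_mul, abs_pow, abs_pow, abs_neg, abs_one, one_pow, one_mul,
    abs_of_pos (h0.trans_le hc)]
  exact div_le_div₀ (pow_nonneg ((abs_nonneg y).trans hy) n)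
    (pow_le_pow_left₀ (abs_nonneg _) hy n) h0 hc

lemma aux_f1 (n : ℕ) : (n.factorial : ℝ) ≤ (n.factorial : ℝ) ^ 2 := by
  have : (1:ℝ) ≤ n.factorial := by exact_mod_cast n.factorial_pos
  nlinarith
lemma aux_f2 (n : ℕ) : (n.factorial : ℝ) ≤ (n.factorial : ℝ) * ((n+1).factorial : ℝ) := by
  have h : (1:ℝ) ≤ n.factorial := by exact_mod_cast n.factorial_pos
  have : (1:ℝ) ≤ (n+1).factorial := by exact_mod_cast (n+1).factorial_pos
  nlinarith

lemma aux_sB (s : ℝ) : Summable fun n : ℕ => (-1 : ℝ) ^ n * s ^ n / ((n.factorial : ℝ)) ^ 2 :=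
  Summable.of_norm_bounded (Real.summable_pow_div_factorial |s|)
    fun n => aux_bound _ _ _ n le_rfl (aux_f1 n)

lemma aux_sC (s : ℝ) : Summable fun n : ℕ =>
    (-1 : ℝ) ^ n * s ^ n / ((n.factorial : ℝ) * ((n+1).factorial : ℝ)) :=
  Summable.of_norm_bounded (Real.summable_pow_div_factorial |s|)
    fun n => aux_bound _ _ _ n le_rfl (aux_f2 n)

lemma auxSC_deriv (s : ℝ) : HasDerivAt (fun s => s * auxC s) (auxB s) s := by
  have e : (fun s => s * auxC s) = fun s => ∑' n : ℕ,
      s * ((-1 : ℝ) ^ n * s ^ n / ((n.factorial : ℝ) * ((n+1).factorial : ℝ))) := by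
    ext s; rw [auxC, tsum_mul_left]
  rw [e]
  unfold auxB
  refine hasDerivAt_tsum_of_isPreconnected (g := fun (n : ℕ) (s : ℝ) => s * ((-1 : ℝ) ^ n * s ^ n / ((n.factorial : ℝ) * ((n+1).factorial : ℝ))))
    (g' := fun (n : ℕ) (s : ℝ) => (-1 : ℝ) ^ n * s ^ n / ((n.factorial : ℝ)) ^ 2) (y := s)
    (t := Metric.ball 0 (|s| + 1)) (y₀ := s)
    (Real.summable_pow_div_factorial (|s| + 1)) Metric.isOpen_ball
    (convex_ball (E := ℝ) (0:ℝ) (|s|+1)).isPreconnected ?_ ?_ ?_ ?_ ?_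
  · intro n y hy
    have h := (((hasDerivAt_pow (n+1) y).const_mul ((-1:ℝ)^n)).div_const
      ((n.factorial : ℝ) * ((n+1).factorial : ℝ)))
    have e3 : (fun s : ℝ => s * ((-1 : ℝ) ^ n * s ^ n / ((n.factorial : ℝ) * ((n+1).factorial : ℝ))))
        = fun x => (-1) ^ n * x ^ (n + 1) / ((n.factorial : ℝ) * ((n+1).factorial : ℝ)) := by
      ext y; ring
    simp only [e3]
    refine h.congr_deriv ?_
    · have h0 : (n.factorial : ℝ) ≠ 0 := by exact_mod_cast n.factorial_ne_zero
      rw [Nat.factorial_succ]; push_cast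
      have : (n:ℝ) + 1 ≠ 0 := by positivity
      field_simp
  · intro n y hy
    rw [mem_ball_zero_iff] at hy
    exact aux_bound _ _ _ n hy.le (aux_f1 n)
  · rw [mem_ball_zero_iff, Real.norm_eq_abs]; linarith
  · exact (aux_sC s).mul_left s
  · rw [mem_ball_zero_iff, Real.norm_eq_abs]; linarith

lemma auxB_deriv (s : ℝ) : HasDerivAt auxB (-auxC s) s := by
  have e : auxB = fun s => 1 + ∑' n : ℕ, (-1 : ℝ) ^ (n+1) * s ^ (n+1) / (((n+1).factorial : ℝ)) ^ 2 := by
    ext s; rw [auxB, (aux_sB s).tsum_eq_zero_add]; simp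
  rw [e]
  apply HasDerivAt.const_add
  have e2 : -auxC s = ∑' n : ℕ,
    -((-1 : ℝ) ^ n * s ^ n / ((n.factorial : ℝ) * ((n+1).factorial : ℝ))) := by
    rw [tsum_neg, auxC]
  rw [e2]
  refine hasDerivAt_tsum_of_isPreconnected (g := fun (n : ℕ) (s : ℝ) => (-1 : ℝ) ^ (n+1) * s ^ (n+1) / (((n+1).factorial : ℝ)) ^ 2)
    (g' := fun (n : ℕ) (s : ℝ) => -((-1 : ℝ) ^ n * s ^ n / ((n.factorial : ℝ) * ((n+1).factorial : ℝ)))) (y := s)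
    (t := Metric.ball 0 (|s| + 1)) (y₀ := s)
    (Real.summable_pow_div_factorial (|s| + 1)) Metric.isOpen_ball
    (convex_ball (E := ℝ) (0:ℝ) (|s|+1)).isPreconnected ?_ ?_ ?_ ?_ ?_
  · intro n y hy
    have h := (((hasDerivAt_pow (n+1) y).const_mul ((-1:ℝ)^(n+1))).div_const
      (((n+1).factorial : ℝ)^2))
    refine h.congr_deriv ?_
    have h0 : (n.factorial : ℝ) ≠ 0 := by exact_mod_cast n.factorial_ne_zero
    rw [Nat.factorial_succ]; push_cast
    have : (n:ℝ) + 1 ≠ 0 := by positivity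
    field_simp
    ring
  · intro n y hy
    rw [mem_ball_zero_iff] at hy
    rw [norm_neg]
    exact aux_bound _ _ _ n hy.le (aux_f2 n)
  · rw [mem_ball_zero_iff, Real.norm_eq_abs]; linarith
  · exact (summable_nat_add_iff 1).2 (aux_sB s)
  · rw [mem_ball_zero_iff, Real.norm_eq_abs]; linarith

lemma auxB_zero : auxB 0 = 1 := by
  rw [auxB, (aux_sB 0).tsum_eq_zero_add]; simp

lemma auxB_pos (j : ℝ) (hj : 0 < j) (hfirst : ∀ x : ℝ, 0 < x → x < j → besselJ0 x ≠ 0)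
    (s : ℝ) (hs : 0 < s) (hsj : s < j ^ 2 / 4) : 0 < auxB s := by
  by_contra! hc
  have hcont : ContinuousOn auxB (Icc 0 s) := fun x _ =>
    (auxB_deriv x).continuousAt.continuousWithinAt
  have := intermediate_value_Icc' hs.le hcont (show (0:ℝ) ∈ Icc _ _ from ⟨hc, by
    rw [auxB_zero]; norm_num⟩)
  obtain ⟨t, ht, ht0⟩ := this
  have ht1 : 0 < t := by
    rcases ht.1.eq_or_lt with h | h
    · rw [← h, auxB_zero] at ht0; norm_num at ht0
    · exact h
  refine hfirst (2 * √t) (by positivity) ?_ ?_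
  · have := Real.sq_sqrt ht1.le
    have h2 : t < j ^ 2 / 4 := ht.2.trans_lt hsj
    nlinarith [Real.sqrt_nonneg t]
  · rw [auxB_eq, mul_pow, Real.sq_sqrt ht1.le]
    convert ht0 using 2; ring

/-- comparison function package -/
lemma aux_cmp (p a : ℝ) (hp : 0 < p) (ha : 0 < a) :
    (∀ u : ℝ, 0 < u → HasDerivAt (fun u => auxB (a * u))
      ((-(p/a) * ((a * u) * auxC (a * u))) / (p / a * u)) u) ∧
    (∀ u : ℝ, HasDerivAt (fun u => -(p/a) * ((a * u) * auxC (a * u))) (-(p * auxB (a * u))) u) ∧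
    Tendsto (fun u => auxB (a * u)) (𝓝[>] 0) (𝓝 1) ∧
    Tendsto (fun u => -(p/a) * ((a * u) * auxC (a * u))) (𝓝[>] 0) (𝓝 0) := by
  have hl : ∀ u : ℝ, HasDerivAt (fun u : ℝ => a * u) a u := fun u => by
    simpa using (hasDerivAt_id u).const_mul a
  have hB : ∀ u : ℝ, HasDerivAt (fun u => auxB (a * u)) (-auxC (a * u) * a) u := fun u =>
    (auxB_deriv (a * u)).comp u (hl u)
  have hA : ∀ u : ℝ, HasDerivAt (fun u => -(p/a) * ((a * u) * auxC (a * u)))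
      (-(p/a) * (auxB (a * u) * a)) u := fun u =>
    ((auxSC_deriv (a * u)).comp u (hl u)).const_mul _
  refine ⟨fun u hu => ?_, fun u => ?_, ?_, ?_⟩
  · convert hB u using 1
    field_simp
  · convert hA u using 1
    field_simp
  · have := (hB 0).continuousAt.tendsto
    simp only [mul_zero, auxB_zero] at this
    exact this.mono_left nhdsWithin_le_nhds
  · have := (hA 0).continuousAt.tendsto
    simp only [mul_zero, zero_mul] at this
    exact this.mono_left nhdsWithin_le_nhds

lemma aux_leg_s19 (p : ℝ) (hp : 0 < p) (f : ℝ → ℝ) (hf : IsBddLegendreSol p f) :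
    ∃ A : ℝ → ℝ, (∀ u ∈ Ioo (0:ℝ) 2, HasDerivAt (fun u => f (1 - u)) (A u / (u * (2 - u))) u) ∧
    (∀ u ∈ Ioo (0:ℝ) 2, HasDerivAt A (-(p * f (1 - u))) u) ∧
    Tendsto (fun u => f (1 - u)) (𝓝[>] 0) (𝓝 1) ∧ Tendsto A (𝓝[>] 0) (𝓝 0) := by
  obtain ⟨hc, hode, hlim⟩ := hf
  have hd1 : ∀ x ∈ Ioo (-1:ℝ) 1, HasDerivAt f (deriv f x) x := fun x hx =>
    ((hc.contDiffAt (isOpen_Ioo.mem_nhds hx)).differentiableAt (by norm_num)).hasDerivAt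
  have hc1 : ContDiffOn ℝ 1 (deriv f) (Ioo (-1:ℝ) 1) :=
    ((contDiffOn_succ_iff_deriv_of_isOpen (n := 1) isOpen_Ioo).1 (hc.of_le (by norm_num))).2.2
  have hd2 : ∀ x ∈ Ioo (-1:ℝ) 1, HasDerivAt (deriv f) (deriv (deriv f) x) x := fun x hx =>
    ((hc1.contDiffAt (isOpen_Ioo.mem_nhds hx)).differentiableAt (by norm_num)).hasDerivAt
  have hsub : ∀ u : ℝ, HasDerivAt (fun u : ℝ => 1 - u) (-1) u := fun u => by
    simpa using (hasDerivAt_id u).const_sub 1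
  have hmem : ∀ u ∈ Ioo (0:ℝ) 2, 1 - u ∈ Ioo (-1:ℝ) 1 := fun u hu =>
    ⟨by linarith [hu.2], by linarith [hu.1]⟩
  set A : ℝ → ℝ := fun u => -((u * (2 - u)) * deriv f (1 - u)) with hAdef
  have hF : ∀ u ∈ Ioo (0:ℝ) 2, HasDerivAt (fun u => f (1 - u)) (A u / (u * (2 - u))) u := by
    intro u hu
    refine ((hd1 _ (hmem u hu)).comp u (hsub u)).congr_deriv ?_
    have h1 := hu.1.ne'
    have h2 : 2 - u ≠ 0 := by linarith [hu.2]
    simp only [hAdef]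
    field_simp
  have hA : ∀ u ∈ Ioo (0:ℝ) 2, HasDerivAt A (-(p * f (1 - u))) u := by
    intro u hu
    have h1 : HasDerivAt (fun u : ℝ => u * (2 - u)) (1 * (2 - u) + u * (-1)) u :=
      (hasDerivAt_id u).mul (by simpa using (hasDerivAt_id u).const_sub 2)
    have h2 := (h1.mul ((hd2 _ (hmem u hu)).comp u (hsub u))).neg
    refine h2.congr_deriv ?_
    have := hode _ (hmem u hu)
    simp only [Function.comp]
    linear_combination this
  have lF : Tendsto (fun u => f (1 - u)) (𝓝[>] 0) (𝓝 1) := by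
    refine hlim.comp ?_
    rw [tendsto_nhdsWithin_iff]
    constructor
    · have := (hsub 0).continuousAt.tendsto
      simp only [sub_zero] at this
      exact this.mono_left nhdsWithin_le_nhds
    · filter_upwards [self_mem_nhdsWithin] with u hu
      simp only [mem_Ioi] at hu; simp only [mem_Iio]; linarith
  refine ⟨A, hF, hA, lF, ?_⟩
  have hev : ∀ᶠ u in 𝓝[>] (0:ℝ), f (1 - u) ∈ Ioo (0:ℝ) 2 :=
    lF.eventually (isOpen_Ioo.mem_nhds (by norm_num))
  obtain ⟨η0, hη0, hη⟩ := (mem_nhdsGT_iff_exists_Ioo_subset).1 hev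
  set η := min η0 2
  have hηp : 0 < η := lt_min hη0 (by norm_num)
  have s1 : ∀ u ∈ Ioo 0 η, u ∈ Ioo (0:ℝ) 2 := fun u hu => ⟨hu.1, hu.2.trans_le (min_le_right _ _)⟩
  have s2 : ∀ u ∈ Ioo 0 η, 0 < f (1 - u) ∧ f (1 - u) < 2 := fun u hu =>
    hη ⟨hu.1, hu.2.trans_le (min_le_left _ _)⟩
  have hP : ∀ u ∈ Ioo 0 η, 0 < u * (2 - u) ∧ u * (2 - u) ≤ 2 * u := fun u hu =>
    ⟨mul_pos hu.1 (by linarith [(s1 u hu).2]), by nlinarith [hu.1]⟩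
  have up := aux_flux η (2*p) 2 (fun u => f (1-u)) A (fun u => u * (2 - u)) _ (by linarith) hP
    (fun u hu => hF u (s1 u hu)) (fun u hu => hA u (s1 u hu))
    (fun u hu => by nlinarith [s2 u hu]) (fun u hu => by linarith [s2 u hu])
  have lo := aux_flux η (2*p) 2 (fun u => -f (1-u)) (fun u => -A u) (fun u => u * (2 - u)) _
    (by linarith) hP
    (fun u hu => by rw [neg_div]; exact (hF u (s1 u hu)).neg)
    (fun u hu => (hA u (s1 u hu)).neg)
    (fun u hu => by nlinarith [s2 u hu]) (fun u hu => by linarith [s2 u hu])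
  have t1 : Tendsto (fun u : ℝ => 2 * p * u) (𝓝[>] 0) (𝓝 0) := by
    have : Tendsto (fun u : ℝ => 2 * p * u) (𝓝 0) (𝓝 (2 * p * 0)) := tendsto_id.const_mul _
    rw [mul_zero] at this
    exact this.mono_left nhdsWithin_le_nhds
  refine tendsto_of_tendsto_of_tendsto_of_le_of_le' (by simpa using t1.neg) t1 ?_ ?_
  · filter_upwards [Ioo_mem_nhdsGT hηp] with u hu
    linarith [lo u hu]
  · filter_upwards [Ioo_mem_nhdsGT hηp] with u hu
    exact up u hu

/-- Asymptotics of the largest zero: `p (1 − z_p) → j₀²/2` as `p → ∞`, where `j₀` is the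
first positive zero of the Bessel function of order zero. -/
theorem largest_zero_asymptotics (j₀ : ℝ) (hj₀pos : 0 < j₀)
    (hj₀zero : besselJ0 j₀ = 0)
    (hj₀first : ∀ x : ℝ, 0 < x → x < j₀ → besselJ0 x ≠ 0) :
    ∀ ε : ℝ, 0 < ε → ∃ P : ℝ, ∀ p : ℝ, P < p →
      ∀ f : ℝ → ℝ, ∀ z : ℝ, IsBddLegendreSol p f → IsLargestZero f z →
        |p * (1 - z) - j₀ ^ 2 / 2| < ε := by
  intro ε hε
  refine ⟨j₀ ^ 2 + j₀ ^ 4 / (8 * ε), fun p hpP f z hf hz => ?_⟩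
  obtain ⟨hz1, hz0, hzpos⟩ := hz
  have hj2 : 0 < j₀ ^ 2 := by positivity
  have hq : 0 < j₀ ^ 4 / (8 * ε) := by positivity
  have hp : 0 < p := by linarith
  obtain ⟨A, hF, hA, lF, lA⟩ := aux_leg_s19 p hp f hf
  have hBz : auxB (j₀ ^ 2 / 4) = 0 := by rw [← auxB_eq, hj₀zero]
  have fpos : ∀ u, 0 < u → u < 1 - z → 0 < f (1 - u) := fun u h1 h2 =>
    hzpos _ ⟨by linarith, by linarith⟩
  have hw2 : 1 - z < 2 := by linarith [hz1.1]
  have hw0 : 0 < 1 - z := by linarith [hz1.2]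
  set δ := j₀ ^ 2 / (2 * p) with hδ
  have hδp : δ * p = j₀ ^ 2 / 2 := by rw [hδ]; field_simp
  have hδ0 : 0 < δ := by positivity
  have upper : 1 - z ≤ δ := by
    by_contra! hc
    obtain ⟨g1, g2, g3, g4⟩ := aux_cmp p (p/2) hp (by linarith)
    refine aux_sturm p δ hp hδ0 (fun u => f (1 - u)) _ A _ (fun u => u * (2 - u)) _ ?_
      (fun u hu => hF u ⟨hu.1, by linarith [hu.2]⟩) (fun u hu => g1 u hu.1)
      (fun u hu => hA u ⟨hu.1, by linarith [hu.2]⟩) (fun u hu => g2 u) lF g3 lA g4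
      (fun u hu => fpos u hu.1 (by linarith [hu.2])) ?_ ?_
    · intro u hu
      refine ⟨mul_pos hu.1 (by linarith [hu.2]), ?_⟩
      have : p / (p / 2) = 2 := by field_simp
      rw [this]; nlinarith [hu.1]
    · intro u hu
      exact auxB_pos j₀ hj₀pos hj₀first _ (mul_pos (by linarith) hu.1) (by nlinarith [hu.2])
    · rw [← hBz]; congr 1; linarith
  have hδ1 : δ < 1 := by
    by_contra! h; nlinarith
  have lower : (2 - δ) * j₀ ^ 2 / 4 ≤ p * (1 - z) := by
    by_contra! hc
    have ha : 0 < p / (2 - δ) := div_pos hp (by linarith)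
    obtain ⟨g1, g2, g3, g4⟩ := aux_cmp p (p/(2-δ)) hp ha
    refine aux_sturm p (1 - z) hp hw0 _ (fun u => f (1 - u)) _ A _ (fun u => u * (2 - u)) ?_
      (fun u hu => g1 u hu.1) (fun u hu => hF u ⟨hu.1, by linarith [hu.2]⟩)
      (fun u hu => g2 u) (fun u hu => hA u ⟨hu.1, by linarith [hu.2]⟩) g3 lF g4 lA
      ?_ (fun u hu => fpos u hu.1 hu.2) (by simpa using hz0)
    · intro u hu
      have h2 : 2 - δ ≠ 0 := by linarith
      have : p / (p / (2 - δ)) = 2 - δ := by field_simp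
      rw [this]
      exact ⟨mul_pos (by linarith) hu.1, by nlinarith [hu.1, hu.2]⟩
    · intro u hu
      refine auxB_pos j₀ hj₀pos hj₀first _ (mul_pos ha hu.1) ?_
      rw [div_mul_eq_mul_div, div_lt_iff₀ (by linarith)]
      nlinarith [hu.2, mul_le_mul_of_nonneg_left hu.2 hp.le]
  have h1 : p * (1 - z) ≤ j₀ ^ 2 / 2 := by nlinarith
  have h2 : δ * j₀ ^ 2 / 4 < ε := by
    have : j₀ ^ 4 / (8 * ε) < p := by linarith
    rw [div_lt_iff₀ (by positivity)] at this
    have e : δ * j₀ ^ 2 / 4 = j₀ ^ 4 / (8 * p) := by rw [hδ]; field_simp; ring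
    rw [e, div_lt_iff₀ (by positivity)]
    linarith
  rw [abs_lt]
  constructor <;> linarith
end
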